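/- arXiv:1712.06462 — 3 statements merged into one kernel-verified Lean document; each statement's English description precedes it below -/
import Mathlib

section
/- (Margulis.) Let G be a subgroup of the group of homeomorphisms of the circle AddCircle ℝ 1. Then either there exists a Borel probability measure on the circle invariant under every element of G, or G contains a nonabelian free subgroup: there exist f, g ∈ G such that the group homomorphism from the free group on two generators to G sending the generators to f and g is injective. -/
open MeasureTheory

namespace CircleDeg1Lift

open Set Filter Topology Function

lemma units_continuous (f : CircleDeg1Liftˣ) : Continuous f := by
  rw [← coe_toOrderIso]
  exact (toOrderIso f).continuous

lemma units_strictMono (f : CircleDeg1Liftˣ) : StrictMono f := by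
  rw [← coe_toOrderIso]
  exact (toOrderIso f).strictMono

/-- Every nonempty closed subset of `ℝ` that is invariant under `Γ` is everything. -/
def IsMinimalAction (Γ : Subgroup CircleDeg1Liftˣ) : Prop :=
  ∀ Z : Set ℝ, IsClosed Z → Z.Nonempty → (∀ h ∈ Γ, ∀ x ∈ Z, h x ∈ Z) → Z = univ

/-- The additive group of all `t` such that `x ↦ x + t` commutes with `Γ`. -/
def centralTranslations (Γ : Subgroup CircleDeg1Liftˣ) : AddSubgroup ℝ where
  carrier := {t | ∀ h ∈ Γ, ∀ x, h (x + t) = h x + t}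
  zero_mem' := by simp
  add_mem' := by
    intro a b ha hb h hh x
    rw [← add_assoc, hb h hh, ha h hh, add_assoc]
  neg_mem' := by
    intro a ha h hh x
    have := ha h hh (x + -a)
    rw [neg_add_cancel_right] at this
    linarith

lemma mem_centralTranslations {Γ : Subgroup CircleDeg1Liftˣ} {t : ℝ} :
    t ∈ centralTranslations Γ ↔ ∀ h ∈ Γ, ∀ x, h (x + t) = h x + t := Iff.rfl

lemma one_mem_centralTranslations (Γ : Subgroup CircleDeg1Liftˣ) :
    (1 : ℝ) ∈ centralTranslations Γ := fun h _ x => (h : CircleDeg1Lift).map_add_one x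

lemma isClosed_centralTranslations (Γ : Subgroup CircleDeg1Liftˣ) :
    IsClosed (centralTranslations Γ : Set ℝ) := by
  have : (centralTranslations Γ : Set ℝ) = ⋂ h ∈ Γ, ⋂ x : ℝ, {t | h (x + t) = h x + t} := by
    ext t; simp [mem_centralTranslations]
  rw [this]
  refine isClosed_biInter fun h _ => isClosed_iInter fun x => isClosed_eq ?_ (by fun_prop)
  exact (units_continuous h).comp (by fun_prop)

lemma IsMinimalAction.exists_mem {Γ : Subgroup CircleDeg1Liftˣ} (hΓ : IsMinimalAction Γ) (x : ℝ)
    {J : Set ℝ} (hJ : IsOpen J) (hne : J.Nonempty) : ∃ h ∈ Γ, h x ∈ J := by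
  have key := hΓ (closure {y | ∃ h ∈ Γ, h x = y}) isClosed_closure
    ⟨x, subset_closure ⟨1, one_mem _, by simp⟩⟩ (by
      intro h hh y hy
      refine map_mem_closure (units_continuous h) hy ?_
      rintro _ ⟨k, hk, rfl⟩
      exact ⟨h * k, mul_mem hh hk, by simp⟩)
  obtain ⟨z, hz⟩ := hne
  have hz' : z ∈ closure {y | ∃ h ∈ Γ, h x = y} := key ▸ mem_univ z
  obtain ⟨_, hyJ, k, hk, rfl⟩ := mem_closure_iff.1 hz' J hJ hz
  exact ⟨k, hk, hyJ⟩

lemma IsMinimalAction.mem_centralTranslations_of_point {Γ : Subgroup CircleDeg1Liftˣ}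
    (hΓ : IsMinimalAction Γ) {x t : ℝ} (hx : ∀ h ∈ Γ, h (x + t) = h x + t) :
    t ∈ centralTranslations Γ := by
  have key := hΓ (⋂ h ∈ Γ, {x | h (x + t) = h x + t})
    (isClosed_biInter fun h _ => isClosed_eq
      ((units_continuous h).comp (by fun_prop)) (by have := units_continuous h; fun_prop))
    ⟨x, by simpa using hx⟩ (by
      intro h hh y hy
      simp only [mem_iInter, mem_ofPred_eq] at hy ⊢
      intro k hk
      have := hy (k * h) (mul_mem hk hh)
      simp only [Units.val_mul, mul_apply] at this
      rw [← this, hy h hh])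
  intro h hh y
  have hy : y ∈ ⋂ h ∈ Γ, {x | h (x + t) = h x + t} := key ▸ mem_univ y
  simp only [mem_iInter, mem_ofPred_eq] at hy
  exact hy h hh

lemma exists_zpow_translate_mul {Γ : Subgroup CircleDeg1Liftˣ}
    (hone : translate (Multiplicative.ofAdd 1) ∈ Γ) {h : CircleDeg1Liftˣ} (hh : h ∈ Γ) (x : ℝ) :
    ∃ k ∈ Γ, ∃ m : ℤ, (∀ y, k y = h y + m) ∧ k x ∈ Icc (0 : ℝ) 1 := by
  refine ⟨translate (Multiplicative.ofAdd 1) ^ (-⌊h x⌋) * h, mul_mem (zpow_mem hone _) hh,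
    -⌊h x⌋, ?_, ?_⟩
  · intro y
    rw [translate_zpow]
    simp [add_comm]
  · rw [translate_zpow]
    simp only [Units.val_mul, mul_apply, translate_apply, mem_Icc]
    push_cast
    constructor <;> linarith [Int.floor_le (h x), Int.lt_floor_add_one (h x)]

lemma map_sub_map_le (f : CircleDeg1Lift) {a b : ℝ} : f b - f a ≤ ⌈b - a⌉ := by
  have := f.monotone (show b ≤ a + ⌈b - a⌉ by linarith [Int.le_ceil (b - a)])
  rw [map_add_int] at this
  linarith

lemma closure_range_induction {ι : Type*} {s : ι → CircleDeg1Liftˣ} (hinv : ∀ i, ∃ j, s j = (s i)⁻¹)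
    {p : CircleDeg1Liftˣ → Prop} (one : p 1) (mul : ∀ i g, g ∈ Subgroup.closure (range s) → p g →
      p (s i * g)) {g : CircleDeg1Liftˣ} (hg : g ∈ Subgroup.closure (range s)) : p g := by
  induction hg using Subgroup.closure_induction_left with
  | one => exact one
  | mul_left x hx y hy ih =>
    obtain ⟨i, rfl⟩ := hx
    exact mul i y hy ih
  | inv_mul_cancel x hx y hy ih =>
    obtain ⟨i, rfl⟩ := hx
    obtain ⟨j, hj⟩ := hinv i
    exact hj ▸ mul j y hy ih

lemma IsMinimalAction.isLUB_mem_centralTranslations {ι : Type*} [Fintype ι]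
    {s : ι → CircleDeg1Liftˣ} (hΓ : IsMinimalAction (Subgroup.closure (range s)))
    (hinv : ∀ i, ∃ j, s j = (s i)⁻¹)
    (hone : translate (Multiplicative.ofAdd 1) ∈ Subgroup.closure (range s))
    (hstat : ∃ c, ∀ x, ∑ i, s i x = Fintype.card ι * x + c) (a b : ℝ) :
    ∃ t ∈ centralTranslations (Subgroup.closure (range s)),
      IsLUB {r | ∃ h ∈ Subgroup.closure (range s), h b - h a = r} t := by
  set Γ := Subgroup.closure (range s) with hΓdef
  set A := {r | ∃ h ∈ Γ, h b - h a = r} with hA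
  have hAne : A.Nonempty := ⟨_, 1, one_mem _, rfl⟩
  have hAbdd : BddAbove A := ⟨⌈b - a⌉, by rintro _ ⟨h, -, rfl⟩; exact map_sub_map_le _⟩
  obtain ⟨t, ht⟩ : ∃ t, IsLUB A t := ⟨_, isLUB_csSup hAne hAbdd⟩
  refine ⟨t, ?_, ht⟩
  obtain ⟨u, -, -, hu, huA⟩ := ht.exists_seq_monotone_tendsto hAne
  choose h hh hhu using huA
  choose k hk m hkm hk01 using fun n => exists_zpow_translate_mul hone (hh n) a
  obtain ⟨α, -, φ, hφ, hα⟩ := isCompact_Icc.tendsto_subseq hk01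
  have hkb : Tendsto (fun n => k (φ n) b) atTop (𝓝 (α + t)) := by
    have : (fun n => k (φ n) b) = fun n => k (φ n) a + u (φ n) := by
      ext n; rw [hkm, hkm, ← hhu]; ring
    rw [this]
    exact hα.add (hu.comp hφ.tendsto_atTop)
  have hle : ∀ g ∈ Γ, g (α + t) - g α ≤ t := by
    intro g hg
    have h1 : Tendsto (fun n => g (k (φ n) b) - g (k (φ n) a)) atTop (𝓝 (g (α + t) - g α)) :=
      (((units_continuous g).tendsto _).comp hkb).sub (((units_continuous g).tendsto _).comp hα)
    exact le_of_tendsto' h1 fun n => ht.1 ⟨g * k (φ n), mul_mem hg (hk _), by simp⟩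
  have hstep : ∀ g ∈ Γ, g (α + t) - g α = t → ∀ i, s i (g (α + t)) - s i (g α) = t := by
    intro g hg hgt
    obtain ⟨c, hc⟩ := hstat
    have hi : ∀ i ∈ Finset.univ, s i (g (α + t)) - s i (g α) ≤ t := fun i _ => by
      simpa using hle (s i * g) (mul_mem (Subgroup.subset_closure ⟨i, rfl⟩) hg)
    have hsum : ∑ i, (s i (g (α + t)) - s i (g α)) = ∑ _i : ι, t := by
      rw [Finset.sum_sub_distrib, hc, hc]
      simp only [Finset.sum_const, Finset.card_univ, nsmul_eq_mul]
      linear_combination (Fintype.card ι : ℝ) * hgt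
    exact fun i => (Finset.sum_eq_sum_iff_of_le hi).1 hsum i (Finset.mem_univ i)
  refine hΓ.mem_centralTranslations_of_point (x := α) fun g hg => ?_
  suffices g (α + t) - g α = t by linarith
  exact closure_range_induction hinv (p := fun g => g (α + t) - g α = t) (by simp)
    (fun i g hg ih => by simpa using hstep g hg ih i) hg

/-- A pair of lifts `f`, `g` for which there are four disjoint `1`-periodic sets `V j` such that
`f` maps the complement of `V 0` to `V 1` and `g` maps the complement of `V 2` to `V 3`. -/
def IsPingPongPair (f g : CircleDeg1Liftˣ) : Prop :=
  ∃ V : Fin 4 → Set ℝ, (∀ j, (V j).Nonempty) ∧ Pairwise (Disjoint on V) ∧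
    (∀ j x, x + 1 ∈ V j ↔ x ∈ V j) ∧ (∀ x ∉ V 0, f x ∈ V 1) ∧ ∀ x ∉ V 2, g x ∈ V 3

lemma IsMinimalAction.exists_mapsTo_Icc {Γ : Subgroup CircleDeg1Liftˣ} (hΓ : IsMinimalAction Γ)
    (hone : translate (Multiplicative.ofAdd 1) ∈ Γ) {τ : ℝ} (hτ : τ ∈ centralTranslations Γ)
    (hexp : ∀ a b : ℝ, a < b → ∀ ε > 0, ∃ h ∈ Γ, τ - ε < h b - h a) {a b c d : ℝ}
    (hab : a < b) (hcd : c < d) : ∃ f ∈ Γ, MapsTo f (Icc b (a + τ)) (Ioo c d) := by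
  choose h hh hlt using fun n : ℕ => hexp a b hab (1 / ((n : ℝ) + 1)) (by positivity)
  choose k hk m hkm hk01 using fun n => exists_zpow_translate_mul hone (hh n) b
  obtain ⟨β, -, φ, hφ, hβ⟩ := isCompact_Icc.tendsto_subseq hk01
  obtain ⟨g, hg, hgβ⟩ := hΓ.exists_mem β (isOpen_Ioo (a := c) (b := d)) (nonempty_Ioo.2 hcd)
  have h0 : Tendsto (fun n => k (φ n) b + 1 / ((φ n : ℝ) + 1)) atTop (𝓝 β) := by
    simpa using hβ.add (tendsto_one_div_add_atTop_nhds_zero_nat.comp hφ.tendsto_atTop)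
  have hO : ∀ᶠ x in 𝓝 β, g x ∈ Ioo c d :=
    (units_continuous g).continuousAt.eventually (isOpen_Ioo.mem_nhds hgβ)
  obtain ⟨n, hn1, hn2⟩ := ((hβ.eventually hO).and (h0.eventually hO)).exists
  refine ⟨g * k (φ n), mul_mem hg (hk _), fun x hx => ?_⟩
  simp only [Units.val_mul, mul_apply]
  have h1 : k (φ n) b ≤ k (φ n) x := (k (φ n) : CircleDeg1Lift).monotone hx.1
  have h2 : k (φ n) x ≤ k (φ n) b + 1 / ((φ n : ℝ) + 1) := by
    have h3 := (k (φ n) : CircleDeg1Lift).monotone hx.2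
    rw [hτ _ (hk _)] at h3
    have h4 := hlt (φ n)
    rw [hkm] at h3 ⊢
    rw [hkm] at h3 ⊢
    linarith
  exact ⟨hn1.1.trans_le ((g : CircleDeg1Lift).monotone h1),
    ((g : CircleDeg1Lift).monotone h2).trans_lt hn2.2⟩

lemma IsMinimalAction.exists_isPingPongPair_of_expanding {Γ : Subgroup CircleDeg1Liftˣ}
    (hΓ : IsMinimalAction Γ)
    (hone : translate (Multiplicative.ofAdd 1) ∈ Γ) {τ : ℝ} (hτ0 : 0 < τ)
    (hτ : centralTranslations Γ = AddSubgroup.closure {τ})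
    (hexp : ∀ a b : ℝ, a < b → ∀ ε > 0, ∃ h ∈ Γ, τ - ε < h b - h a) :
    ∃ f ∈ Γ, ∃ g ∈ Γ, IsPingPongPair f g := by
  have hτmem : τ ∈ centralTranslations Γ := hτ ▸ AddSubgroup.subset_closure rfl
  obtain ⟨N, hN⟩ : ∃ N : ℤ, N • τ = 1 :=
    AddSubgroup.mem_closure_singleton.1 (hτ ▸ one_mem_centralTranslations Γ)
  set V : Fin 4 → Set ℝ := fun j => {x | Int.fract (x / τ) ∈ Ioo ((j : ℝ) / 4) ((j + 1) / 4)}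
    with hV
  have hper : ∀ j x (n : ℤ), x + n • τ ∈ V j ↔ x ∈ V j := by
    intro j x n
    simp only [hV, mem_ofPred_eq]
    have h1 : (x + n • τ) / τ = x / τ + n := by rw [zsmul_eq_mul]; field_simp
    rw [h1, Int.fract_add_intCast]
  have hIoo : ∀ (j : Fin 4) x, x ∈ Ioo ((j : ℝ) / 4 * τ) ((j + 1) / 4 * τ) → x ∈ V j := by
    intro j x hx
    have h1 : x / τ ∈ Ioo ((j : ℝ) / 4) ((j + 1) / 4) :=
      ⟨(lt_div_iff₀ hτ0).2 hx.1, (div_lt_iff₀ hτ0).2 hx.2⟩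
    have hj : ((j : ℕ) : ℝ) ≤ 3 := by exact_mod_cast Nat.lt_succ_iff.1 j.2
    have h0 : (0 : ℝ) ≤ (j : ℕ) := Nat.cast_nonneg _
    have h2 : Int.fract (x / τ) = x / τ :=
      Int.fract_eq_self.2 ⟨by linarith [h1.1], by linarith [h1.2]⟩
    simpa only [hV, mem_ofPred_eq, h2] using h1
  have hmap : ∀ i j : Fin 4, ∃ f ∈ Γ, ∀ x ∉ V i, f x ∈ V j := by
    intro i j
    obtain ⟨f, hf, hfm⟩ := hΓ.exists_mapsTo_Icc hone hτmem hexp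
      (show ((i : ℝ) / 4 * τ) < ((i + 1) / 4 * τ) by nlinarith)
      (show ((j : ℝ) / 4 * τ) < ((j + 1) / 4 * τ) by nlinarith)
    refine ⟨f, hf, fun x hx => ?_⟩
    obtain ⟨n, hn, -⟩ := existsUnique_add_zsmul_mem_Ioc hτ0 x ((i : ℝ) / 4 * τ)
    have hy : x + n • τ ∉ V i := by rwa [hper]
    have hfx : f (x + n • τ) ∈ V j := hIoo j _ (hfm ⟨by
      by_contra hlt
      exact hy (hIoo i _ ⟨hn.1, not_le.1 hlt⟩), hn.2⟩)
    rwa [(centralTranslations Γ).zsmul_mem hτmem n f hf, hper] at hfx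
  obtain ⟨f, hf, hfm⟩ := hmap 0 1
  obtain ⟨g, hg, hgm⟩ := hmap 2 3
  refine ⟨f, hf, g, hg, V, fun j => ?_, ?_, fun j x => ?_, hfm, hgm⟩
  · obtain ⟨x, hx⟩ := nonempty_Ioo.2 (show ((j : ℝ) / 4 * τ) < ((j + 1) / 4 * τ) by nlinarith)
    exact ⟨x, hIoo j x hx⟩
  · intro i j hij
    refine Set.disjoint_left.2 fun x hxi hxj => hij ?_
    simp only [hV, mem_ofPred_eq, mem_Ioo] at hxi hxj
    have h1 : ((i : ℕ) : ℝ) < (j : ℕ) + 1 := by linarith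
    have h2 : ((j : ℕ) : ℝ) < (i : ℕ) + 1 := by linarith
    norm_cast at h1 h2
    ext; omega
  · rw [← hN, hper]

/-- A minimal action for which the identity is a stationary distribution function either consists
of translations or contains a ping-pong pair. -/
theorem IsMinimalAction.translations_or_exists_isPingPongPair {ι : Type*} [Fintype ι]
    {s : ι → CircleDeg1Liftˣ} (hΓ : IsMinimalAction (Subgroup.closure (range s)))
    (hinv : ∀ i, ∃ j, s j = (s i)⁻¹)
    (hone : translate (Multiplicative.ofAdd 1) ∈ Subgroup.closure (range s))
    (hstat : ∃ c, ∀ x, ∑ i, s i x = Fintype.card ι * x + c) :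
    (∀ i, ∃ c, ∀ x, s i x = x + c) ∨
      ∃ f ∈ Subgroup.closure (range s), ∃ g ∈ Subgroup.closure (range s),
        IsPingPongPair f g := by
  set Γ := Subgroup.closure (range s) with hΓdef
  rcases (centralTranslations Γ).dense_or_cyclic with hd | ⟨τ, hτ⟩
  · left
    intro i
    have huniv : (centralTranslations Γ : Set ℝ) = univ := by
      rw [← (isClosed_centralTranslations Γ).closure_eq, hd.closure_eq]
    refine ⟨s i 0, fun x => ?_⟩
    have hx : x ∈ (centralTranslations Γ : Set ℝ) := huniv ▸ mem_univ x
    simpa [add_comm] using hx (s i) (Subgroup.subset_closure ⟨i, rfl⟩) 0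
  · right
    wlog hτ0 : 0 < τ generalizing τ
    · refine this (-τ) ?_ ?_
      · rw [hτ, ← AddSubgroup.zmultiples_eq_closure, ← AddSubgroup.zmultiples_eq_closure,
          AddSubgroup.zmultiples_neg]
      · rcases (not_lt.1 hτ0).lt_or_eq with h | rfl
        · linarith
        · have := one_mem_centralTranslations Γ
          rw [hτ] at this
          obtain ⟨n, hn⟩ := AddSubgroup.mem_closure_singleton.1 this
          simp at hn
    have hτmem : τ ∈ centralTranslations Γ := hτ ▸ AddSubgroup.subset_closure rfl
    refine hΓ.exists_isPingPongPair_of_expanding hone hτ0 hτ ?_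
    intro a b hab ε hε
    wlog hb : b < a + τ generalizing b
    · obtain ⟨h, hh, hlt⟩ := this (a + τ / 2) (by linarith) (by linarith)
      refine ⟨h, hh, hlt.trans_le ?_⟩
      have := (h : CircleDeg1Lift).monotone (show a + τ / 2 ≤ b by linarith)
      linarith
    obtain ⟨t, ht, hlub⟩ := hΓ.isLUB_mem_centralTranslations hinv hone hstat a b
    have htpos : 0 < t := by
      have : b - a ≤ t := hlub.1 ⟨1, one_mem _, by simp⟩
      linarith
    have htle : t ≤ τ := hlub.2 (by
      rintro _ ⟨h, hh, rfl⟩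
      have := (h : CircleDeg1Lift).monotone hb.le
      rw [hτmem h hh] at this
      linarith)
    have htτ : t = τ := by
      obtain ⟨n, hn⟩ := AddSubgroup.mem_closure_singleton.1 (hτ ▸ ht)
      rw [zsmul_eq_mul] at hn
      have h1 : (0 : ℝ) < n := by
        by_contra h; nlinarith
      have h2 : (1 : ℝ) ≤ n := by exact_mod_cast h1
      nlinarith
    obtain ⟨_, ⟨h, hh, rfl⟩, hlt, -⟩ := hlub.exists_between (show τ - ε < t by linarith)
    exact ⟨h, hh, hlt⟩

lemma add_intCast_mem_of_invariant {Γ : Subgroup CircleDeg1Liftˣ}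
    (hone : translate (Multiplicative.ofAdd 1) ∈ Γ) {Z : Set ℝ} (hZ : ∀ h ∈ Γ, ∀ x ∈ Z, h x ∈ Z)
    {x : ℝ} (hx : x ∈ Z) (m : ℤ) : x + m ∈ Z := by
  have := hZ _ (zpow_mem hone m) x hx
  rw [translate_zpow, translate_apply] at this
  simpa [add_comm] using this

lemma exists_minimal_isClosed_invariant {Γ : Subgroup CircleDeg1Liftˣ}
    (hone : translate (Multiplicative.ofAdd 1) ∈ Γ) :
    ∃ K : Set ℝ, IsClosed K ∧ K.Nonempty ∧ (∀ h ∈ Γ, ∀ x ∈ K, h x ∈ K) ∧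
      ∀ Z ⊆ K, IsClosed Z → Z.Nonempty → (∀ h ∈ Γ, ∀ x ∈ Z, h x ∈ Z) → Z = K := by
  obtain ⟨K, -, hK⟩ := zorn_superset_nonempty
    {Z : Set ℝ | IsClosed Z ∧ Z.Nonempty ∧ ∀ h ∈ Γ, ∀ x ∈ Z, h x ∈ Z} (by
      intro c hc hchain hne
      refine ⟨⋂₀ c, ⟨isClosed_sInter fun Z hZ => (hc hZ).1, ?_, fun h hh x hx Z hZ =>
        (hc hZ).2.2 h hh x (hx Z hZ)⟩, fun Z hZ => sInter_subset_of_mem hZ⟩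
      have : Nonempty c := hne.to_subtype
      have key := IsCompact.nonempty_iInter_of_directed_nonempty_isCompact_isClosed
        (fun Z : c => (Z : Set ℝ) ∩ Icc 0 1) (by
          rintro ⟨A, hA⟩ ⟨B, hB⟩
          rcases hchain.total hA hB with h | h
          · exact ⟨⟨A, hA⟩, le_rfl, inter_subset_inter_left _ h⟩
          · exact ⟨⟨B, hB⟩, inter_subset_inter_left _ h, le_rfl⟩) (by
          rintro ⟨A, hA⟩
          obtain ⟨x, hx⟩ := (hc hA).2.1
          refine ⟨x + (-⌊x⌋ : ℤ), add_intCast_mem_of_invariant hone (hc hA).2.2 hx _, ?_⟩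
          push_cast
          constructor <;> linarith [Int.floor_le x, Int.lt_floor_add_one x])
        (fun Z => isCompact_Icc.inter_left (hc Z.2).1)
        (fun Z => (hc Z.2).1.inter isClosed_Icc)
      obtain ⟨x, hx⟩ := key
      exact ⟨x, fun Z hZ => (mem_iInter.1 hx ⟨Z, hZ⟩).1⟩)
    univ ⟨isClosed_univ, univ_nonempty, fun _ _ _ _ => mem_univ _⟩
  exact ⟨K, hK.prop.1, hK.prop.2.1, hK.prop.2.2, fun Z hZK h1 h2 h3 =>
    hZK.antisymm (hK.le_of_le ⟨h1, h2, h3⟩ hZK)⟩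

/-- The pointwise mean of a finite family of lifts. -/
noncomputable def mean {κ : Type*} [Fintype κ] [Nonempty κ] (D : κ → CircleDeg1Lift) :
    CircleDeg1Lift where
  toFun x := (∑ k, D k x) / Fintype.card κ
  monotone' x y hxy := by
    have : ∀ k ∈ Finset.univ, D k x ≤ D k y := fun k _ => (D k).monotone hxy
    have := Finset.sum_le_sum this
    dsimp only
    gcongr
  map_add_one' x := by
    simp [Finset.sum_add_distrib, add_div]

lemma mean_apply {κ : Type*} [Fintype κ] [Nonempty κ] (D : κ → CircleDeg1Lift) (x : ℝ) :
    mean D x = (∑ k, D k x) / Fintype.card κ := rfl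

lemma map_sub_map_zero_mem_Icc (F : CircleDeg1Lift) (x : ℝ) :
    F x - F 0 ∈ Icc (⌊x⌋ : ℝ) ⌈x⌉ :=
  ⟨by linarith [F.le_map_of_map_zero x], by linarith [F.map_le_of_map_zero x]⟩

lemma exists_tendsto_ultrafilter {α : Type*} (u : Ultrafilter α) (D : α → CircleDeg1Lift) :
    ∃ F : CircleDeg1Lift, ∀ x, Tendsto (fun a => D a x - D a 0) u (𝓝 (F x)) := by
  have h : ∀ x, ∃ y, Tendsto (fun a => D a x - D a 0) u (𝓝 y) := by
    intro x
    obtain ⟨y, -, hy⟩ := (isCompact_Icc (a := (⌊x⌋ : ℝ)) (b := ⌈x⌉)).ultrafilter_le_nhds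
      (u.map fun a => D a x - D a 0)
      (le_principal_iff.2 (Eventually.of_forall fun a => map_sub_map_zero_mem_Icc (D a) x :
        ∀ᶠ a in (u : Filter α), D a x - D a 0 ∈ Icc (⌊x⌋ : ℝ) ⌈x⌉))
    exact ⟨y, hy⟩
  choose F hF using h
  refine ⟨⟨⟨F, fun x y hxy => le_of_tendsto_of_tendsto' (hF x) (hF y) fun a =>
    sub_le_sub_right ((D a).monotone hxy) _⟩, fun x => ?_⟩, hF⟩
  refine tendsto_nhds_unique (hF (x + 1)) ?_
  have : (fun a => D a (x + 1) - D a 0) = fun a => D a x - D a 0 + 1 := by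
    ext a; rw [map_add_one]; ring
  rw [this]
  exact (hF x).add_const 1

/-- The step function lift jumping by one at every point of `k + ℤ`. -/
noncomputable def floorLift (k : ℝ) : CircleDeg1Lift where
  toFun x := ⌊x - k⌋
  monotone' x y hxy := Int.cast_le.2 (Int.floor_mono (sub_le_sub_right hxy k))
  map_add_one' x := by
    rw [add_sub_right_comm, Int.floor_add_one]
    push_cast; rfl

lemma floorLift_apply (k x : ℝ) : floorLift k x = ⌊x - k⌋ := rfl

/-- `F` is constant on every interval disjoint from `K`. -/
def IsConstOff (F : CircleDeg1Lift) (K : Set ℝ) : Prop :=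
  ∀ u v, u ≤ v → Disjoint (Icc u v) K → F u = F v

lemma exists_isConstOff {K : Set ℝ} {k : ℝ} (hk : ∀ m : ℤ, k + m ∈ K) :
    ∃ F : CircleDeg1Lift, F.IsConstOff K := by
  refine ⟨floorLift k, fun u v huv hd => ?_⟩
  · simp only [floorLift_apply]
    by_contra hne
    have hlt : ⌊u - k⌋ < ⌊v - k⌋ :=
      lt_of_le_of_ne (Int.floor_mono (sub_le_sub_right huv k)) (by exact_mod_cast hne)
    refine Set.disjoint_left.1 hd ⟨?_, ?_⟩ (hk ⌊v - k⌋)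
    · linarith [Int.floor_lt.1 hlt]
    · linarith [Int.floor_le (v - k)]

lemma exists_stationary {ι : Type*} [Fintype ι] [Nonempty ι] (s : ι → CircleDeg1Liftˣ)
    {K : Set ℝ} (hK : ∀ i, ∀ x, s i x ∈ K → x ∈ K) (F₀ : CircleDeg1Lift) (hF₀ : F₀.IsConstOff K) :
    ∃ F : CircleDeg1Lift, F.IsConstOff K ∧
      ∃ c, ∀ x, ∑ i, F (s i x) = Fintype.card ι * F x + c := by
  set σ : CircleDeg1Lift → CircleDeg1Lift := fun F => mean fun i => F * s i with hσ
  have hσsum : ∀ F x, ∑ i, F (s i x) = Fintype.card ι * σ F x := by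
    intro F x
    simp only [hσ, mean_apply, mul_apply]
    field_simp
  have hσK : ∀ F : CircleDeg1Lift, F.IsConstOff K → (σ F).IsConstOff K := by
    intro F hF u v huv hd
    simp only [hσ, mean_apply, mul_apply]
    congr 1
    refine Finset.sum_congr rfl fun i _ => hF _ _ ((s i : CircleDeg1Lift).monotone huv) ?_
    refine Set.disjoint_left.2 fun y hy hyK => ?_
    obtain ⟨x, rfl⟩ : ∃ x, s i x = y := ⟨(s i)⁻¹ y, by simp⟩
    rw [mem_Icc, (units_strictMono (s i)).le_iff_le, (units_strictMono (s i)).le_iff_le] at hy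
    exact Set.disjoint_left.1 hd hy (hK i x hyK)
  have hitK : ∀ n, (σ^[n] F₀).IsConstOff K := by
    intro n
    induction n with
    | zero => exact hF₀
    | succ n ih => rw [iterate_succ_apply']; exact hσK _ ih
  set D : ℕ → CircleDeg1Lift := fun n => mean fun k : Fin (n + 1) => σ^[k] F₀ with hD
  have hDapp : ∀ n x, D n x = (∑ k ∈ Finset.range (n + 1), (σ^[k] F₀) x) / (n + 1) := by
    intro n x
    rw [← Fin.sum_univ_eq_sum_range (fun k => (σ^[k] F₀) x)]
    simp [hD, mean_apply]
  have hDσ : ∀ n x, ∑ i, D n (s i x) =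
      Fintype.card ι * (D n x + ((σ^[n + 1] F₀) x - F₀ x) * (1 / ((n : ℝ) + 1))) := by
    intro n x
    have h1 : ∑ i, D n (s i x)
        = Fintype.card ι * ((∑ k ∈ Finset.range (n + 1), (σ^[k + 1] F₀) x) / (n + 1)) := by
      simp only [hDapp]
      rw [← Finset.sum_div, Finset.sum_comm]
      simp only [hσsum, iterate_succ_apply']
      rw [← Finset.mul_sum, mul_div_assoc]
    have h2 := Finset.sum_range_succ (fun k => (σ^[k] F₀) x) (n + 1)
    rw [Finset.sum_range_succ'] at h2
    simp only [iterate_zero, id] at h2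
    rw [h1, hDapp, eq_sub_of_add_eq h2]
    ring
  obtain ⟨F, hF⟩ := exists_tendsto_ultrafilter (hyperfilter ℕ) D
  have hF0 : F 0 = 0 := by
    refine tendsto_nhds_unique (hF 0) ?_
    simp
  refine ⟨F, fun u v huv hd => ?_, ∑ i, F (s i 0), fun x => ?_⟩
  · refine tendsto_nhds_unique (hF u) ?_
    have : ∀ n, D n u = D n v := fun n => by
      simp only [hDapp]
      congr 1
      exact Finset.sum_congr rfl fun k _ => hitK k u v huv hd
    simpa only [this] using hF v
  · have hlim : Tendsto (fun n : ℕ => (1 : ℝ) / ((n : ℝ) + 1)) (hyperfilter ℕ) (𝓝 0) :=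
      tendsto_one_div_add_atTop_nhds_zero_nat.mono_left Nat.hyperfilter_le_atTop
    have h1 : Tendsto (fun n => ∑ i, ((D n (s i x) - D n 0) - (D n (s i 0) - D n 0)))
        (hyperfilter ℕ) (𝓝 (∑ i, (F (s i x) - F (s i 0)))) :=
      tendsto_finsetSum _ fun i _ => (hF _).sub (hF _)
    have herr : Tendsto (fun n : ℕ => (((σ^[n + 1] F₀) x - (σ^[n + 1] F₀) 0) - (F₀ x - F₀ 0)) *
        (1 / ((n : ℝ) + 1))) (hyperfilter ℕ) (𝓝 0) := by
      refine bdd_le_mul_tendsto_zero (b := ⌊x⌋ - (F₀ x - F₀ 0)) (B := ⌈x⌉ - (F₀ x - F₀ 0))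
        (Eventually.of_forall fun n => ?_) (Eventually.of_forall fun n => ?_) hlim
      · linarith [(map_sub_map_zero_mem_Icc (σ^[n + 1] F₀) x).1]
      · linarith [(map_sub_map_zero_mem_Icc (σ^[n + 1] F₀) x).2]
    have h2 : Tendsto (fun n => Fintype.card ι * ((D n x - D n 0) +
        (((σ^[n + 1] F₀) x - (σ^[n + 1] F₀) 0) - (F₀ x - F₀ 0)) * (1 / ((n : ℝ) + 1))))
        (hyperfilter ℕ) (𝓝 (Fintype.card ι * (F x + 0))) :=
      ((hF x).add herr).const_mul _
    have h3 := tendsto_nhds_unique h1 (h2.congr fun n => by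
      rw [Finset.sum_sub_distrib, Finset.sum_sub_distrib, Finset.sum_sub_distrib, hDσ, hDσ]
      ring)
    rw [Finset.sum_sub_distrib] at h3
    linarith

lemma exists_invariant_of_finite {Γ : Subgroup CircleDeg1Liftˣ}
    (hone : translate (Multiplicative.ofAdd 1) ∈ Γ) {A : Set ℝ} (hne : A.Nonempty)
    (hA : ∀ h ∈ Γ, ∀ x ∈ A, h x ∈ A) (hfin : (A ∩ Ico 0 1).Finite) :
    ∃ F : CircleDeg1Lift, ∀ h ∈ Γ, ∃ c, ∀ x, F (h x) = F x + c := by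
  set B := A ∩ Ico 0 1 with hB
  have hfract : ∀ x ∈ A, Int.fract x ∈ B := fun x hx => by
    refine ⟨?_, Int.fract_nonneg x, Int.fract_lt_one x⟩
    have := add_intCast_mem_of_invariant hone hA hx (-⌊x⌋)
    push_cast at this
    rwa [← sub_eq_add_neg, Int.self_sub_floor] at this
  have : Fintype B := hfin.fintype
  have : Nonempty B := let ⟨x, hx⟩ := hne; ⟨⟨Int.fract x, hfract x hx⟩⟩
  refine ⟨mean fun b : B => floorLift b, fun h hh =>
    ⟨-(∑ b : B, (⌊h⁻¹ (b : ℝ)⌋ : ℝ)) / Fintype.card B, fun x => ?_⟩⟩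
  have hA' : ∀ b : B, h⁻¹ (b : ℝ) ∈ A := fun b => hA _ (inv_mem hh) _ b.2.1
  let e : B → B := fun b => ⟨Int.fract (h⁻¹ (b : ℝ)), hfract _ (hA' b)⟩
  have he : Injective e := by
    intro b b' hbb
    have hbb : Int.fract (h⁻¹ (b : ℝ)) = Int.fract (h⁻¹ (b' : ℝ)) := congrArg Subtype.val hbb
    obtain ⟨m, hm⟩ := Int.fract_eq_fract.1 hbb
    have hm : h⁻¹ (b : ℝ) = h⁻¹ (b' : ℝ) + m := by linarith
    rw [← map_add_int] at hm
    have hbm := (units_strictMono h⁻¹).injective hm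
    have h1 : ((b : ℝ) - 1) < b' := by linarith [b.2.2.2, b'.2.2.1]
    have h2 : (b' : ℝ) - 1 < b := by linarith [b'.2.2.2, b.2.2.1]
    have h3 : (m : ℝ) < 1 := by linarith
    have h4 : (-1 : ℝ) < m := by linarith
    have h5 : m < 1 := by exact_mod_cast h3
    have h6 : -1 < m := by exact_mod_cast h4
    have h7 : m = 0 := by omega
    rw [h7, Int.cast_zero, add_zero] at hbm
    exact Subtype.ext hbm
  have hfloor : ∀ b : B, (⌊h x - b⌋ : ℝ) = ⌊x - e b⌋ - ⌊h⁻¹ (b : ℝ)⌋ := by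
    intro b
    have h1 : ⌊h x - b⌋ = ⌊x - h⁻¹ (b : ℝ)⌋ := by
      refine eq_of_forall_le_iff fun m => ?_
      rw [Int.le_floor, Int.le_floor, le_sub_iff_add_le, le_sub_iff_add_le, add_comm,
        add_comm (m : ℝ), ← map_add_int, ← (units_strictMono h).le_iff_le (a := h⁻¹ _)]
      simp
    have h2 : x - e b = x - h⁻¹ (b : ℝ) + ⌊h⁻¹ (b : ℝ)⌋ := by
      change x - Int.fract _ = _
      rw [← Int.self_sub_floor]; ring
    rw [h1, h2, Int.floor_add_intCast]
    push_cast; ring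
  have hsum : ∑ b : B, (⌊x - e b⌋ : ℝ) = ∑ b : B, (⌊x - b⌋ : ℝ) :=
    Fintype.sum_bijective e (Finite.injective_iff_bijective.1 he) _ _ fun _ => rfl
  simp only [mean_apply, floorLift_apply, hfloor, Finset.sum_sub_distrib, hsum]
  ring

/-- The size of the discontinuity of `F` at `x`. -/
noncomputable def jump (F : CircleDeg1Lift) (x : ℝ) : ℝ := rightLim F x - leftLim F x

lemma tendsto_units_nhdsGT (h : CircleDeg1Liftˣ) (x : ℝ) : Tendsto h (𝓝[>] x) (𝓝[>] (h x)) :=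
  ((units_continuous h).continuousWithinAt).tendsto_nhdsWithin fun _ hy => units_strictMono h hy

lemma tendsto_units_nhdsLT (h : CircleDeg1Liftˣ) (x : ℝ) : Tendsto h (𝓝[<] x) (𝓝[<] (h x)) :=
  ((units_continuous h).continuousWithinAt).tendsto_nhdsWithin fun _ hy => units_strictMono h hy

lemma sum_jump {ι : Type*} [Fintype ι] {s : ι → CircleDeg1Liftˣ} {F : CircleDeg1Lift} {a c : ℝ}
    (hstat : ∀ x, ∑ i, F (s i x) = a * F x + c) (x : ℝ) :
    ∑ i, F.jump (s i x) = a * F.jump x := by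
  have hr : ∑ i, rightLim F (s i x) = a * rightLim F x + c := by
    refine tendsto_nhds_unique (tendsto_finsetSum _ fun i _ =>
      (F.monotone.tendsto_rightLim (s i x)).comp (tendsto_units_nhdsGT (s i) x)) ?_
    simp only [comp_apply, hstat]
    exact ((F.monotone.tendsto_rightLim x).const_mul a).add_const c
  have hl : ∑ i, leftLim F (s i x) = a * leftLim F x + c := by
    refine tendsto_nhds_unique (tendsto_finsetSum _ fun i _ =>
      (F.monotone.tendsto_leftLim (s i x)).comp (tendsto_units_nhdsLT (s i) x)) ?_
    simp only [comp_apply, hstat]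
    exact ((F.monotone.tendsto_leftLim x).const_mul a).add_const c
  simp only [jump, Finset.sum_sub_distrib, hr, hl]
  ring

lemma jump_add_intCast (F : CircleDeg1Lift) (x : ℝ) (m : ℤ) : F.jump (x + m) = F.jump x := by
  have := sum_jump (ι := Unit) (s := fun _ => translate (Multiplicative.ofAdd (m : ℝ))) (F := F)
    (a := 1) (c := m) (by simp [add_comm]) x
  simpa [add_comm] using this

lemma eventually_jump_lt (F : CircleDeg1Lift) (x : ℝ) {δ : ℝ} (hδ : 0 < δ) :
    ∀ᶠ y in 𝓝[≠] x, F.jump y < δ := by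
  rw [← Iio_union_Ioi, nhdsWithin_union, eventually_sup]
  constructor
  · obtain ⟨z, hz, hzx⟩ := (((F.monotone.tendsto_leftLim x).eventually
      (lt_mem_nhds (sub_lt_self _ hδ))).and self_mem_nhdsWithin).exists
    filter_upwards [Ioo_mem_nhdsLT hzx] with y hy
    have h1 := F.monotone.le_leftLim hy.1
    have h2 := F.monotone.rightLim_le_leftLim hy.2
    unfold jump
    linarith
  · obtain ⟨z, hz, hzx⟩ := (((F.monotone.tendsto_rightLim x).eventually
      (gt_mem_nhds (lt_add_of_pos_right _ hδ))).and self_mem_nhdsWithin).exists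
    filter_upwards [Ioo_mem_nhdsGT hzx] with y hy
    have h1 := F.monotone.rightLim_le hy.2
    have h2 := F.monotone.rightLim_le_leftLim hy.1
    unfold jump
    linarith

lemma finite_le_jump (F : CircleDeg1Lift) {δ : ℝ} (hδ : 0 < δ) :
    ({x | δ ≤ F.jump x} ∩ Ico 0 1).Finite := by
  by_contra hinf
  obtain ⟨x, -, hx⟩ := Set.Infinite.exists_accPt_of_subset_isCompact hinf isCompact_Icc
    (inter_subset_right.trans Ico_subset_Icc_self)
  obtain ⟨y, hy, hlt⟩ :=
    ((accPt_iff_frequently_nhdsNE.1 hx).and_eventually (F.eventually_jump_lt x hδ)).exists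
  exact absurd hy.1 (not_le.2 hlt)

lemma continuous_or_exists_invariant {ι : Type*} [Fintype ι] {s : ι → CircleDeg1Liftˣ}
    (hinv : ∀ i, ∃ j, s j = (s i)⁻¹)
    (hone : translate (Multiplicative.ofAdd 1) ∈ Subgroup.closure (range s))
    {F : CircleDeg1Lift} (hstat : ∃ c, ∀ x, ∑ i, F (s i x) = Fintype.card ι * F x + c) :
    Continuous F ∨ ∃ F : CircleDeg1Lift, ∀ i, ∃ c, ∀ x, F (s i x) = F x + c := by
  obtain ⟨c, hc⟩ := hstat
  by_cases hcont : ∀ x, F.jump x ≤ 0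
  · left
    refine continuous_iff_continuousAt.2 fun x => ?_
    rw [F.monotone.continuousAt_iff_leftLim_eq_rightLim]
    exact (F.monotone.leftLim_le_rightLim le_rfl).antisymm (sub_nonpos.1 (hcont x))
  · right
    push Not at hcont
    obtain ⟨x₀, hx₀⟩ := hcont
    have hfract : ∀ x, F.jump (Int.fract x) = F.jump x := fun x => by
      rw [← Int.self_sub_floor, sub_eq_add_neg, ← Int.cast_neg, jump_add_intCast]
    have hfin := F.finite_le_jump hx₀
    obtain ⟨m, hm, hmax⟩ := Set.exists_max_image _ F.jump hfin
      ⟨Int.fract x₀, (hfract x₀).ge, Int.fract_nonneg _, Int.fract_lt_one _⟩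
    have hmax' : ∀ x, F.jump x ≤ F.jump m := by
      intro x
      by_cases hx : F.jump x₀ ≤ F.jump x
      · rw [← hfract x]
        exact hmax _ ⟨hx.trans_eq (hfract x).symm, Int.fract_nonneg _, Int.fract_lt_one _⟩
      · exact (not_le.1 hx).le.trans hm.1
    have hstep : ∀ x, F.jump x = F.jump m → ∀ i, F.jump (s i x) = F.jump m := by
      intro x hx i
      have hsum : ∑ i, F.jump (s i x) = ∑ _i : ι, F.jump m := by
        rw [sum_jump hc, hx]; simp
      exact (Finset.sum_eq_sum_iff_of_le fun i _ => hmax' _).1 hsum i (Finset.mem_univ i)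
    obtain ⟨G, hG⟩ := exists_invariant_of_finite hone (A := {x | F.jump x = F.jump m}) ⟨m, rfl⟩
      (fun h hh x hx => closure_range_induction hinv (p := fun h => F.jump (h x) = F.jump m)
        (by simpa using hx) (fun i g _ ih => by simpa using hstep _ ih i) hh)
      (hfin.subset fun x hx => ⟨hm.1.trans hx.1.ge, hx.2⟩)
    exact ⟨G, fun i => hG _ (Subgroup.subset_closure ⟨i, rfl⟩)⟩

lemma exists_semiconj_of_surjective {F : CircleDeg1Lift} (hF : Surjective F) {h : CircleDeg1Lift}
    (hh : ∀ x y, F x = F y → F (h x) = F (h y)) : ∃ k : CircleDeg1Lift, ∀ x, k (F x) = F (h x) := by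
  have hs : ∀ y, F (surjInv hF y) = y := surjInv_eq hF
  refine ⟨⟨⟨fun y => F (h (surjInv hF y)), fun y z hyz => ?_⟩, fun y => ?_⟩, fun x => hh _ _ (hs _)⟩
  · rcases hyz.eq_or_lt with rfl | hlt
    · rfl
    · refine F.monotone (h.monotone (le_of_not_ge fun hle => ?_))
      have := F.monotone hle
      rw [hs, hs] at this
      exact absurd hlt (not_lt.2 this)
  · change F (h (surjInv hF (y + 1))) = F (h (surjInv hF y)) + 1
    rw [← map_add_one, ← map_add_one]
    exact hh _ _ (by rw [hs, map_add_one, hs])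

lemma exists_units_semiconj_of_surjective {F : CircleDeg1Lift} (hF : Surjective F)
    {h : CircleDeg1Liftˣ} (h₁ : ∀ x y, F x = F y → F (h x) = F (h y))
    (h₂ : ∀ x y, F x = F y → F (h⁻¹ x) = F (h⁻¹ y)) :
    ∃ k : CircleDeg1Liftˣ, ∀ x, k (F x) = F (h x) := by
  obtain ⟨k, hk⟩ := exists_semiconj_of_surjective hF h₁
  obtain ⟨l, hl⟩ := exists_semiconj_of_surjective hF (h := ((h⁻¹ : CircleDeg1Liftˣ))) h₂
  refine ⟨⟨k, l, ?_, ?_⟩, hk⟩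
  · ext y
    obtain ⟨x, rfl⟩ := hF y
    rw [mul_apply, hl, hk]; simp
  · ext y
    obtain ⟨x, rfl⟩ := hF y
    rw [mul_apply, hk, hl]; simp

lemma units_ext_of_semiconj {F : CircleDeg1Lift} (hF : Surjective F) {h k l : CircleDeg1Liftˣ}
    (hk : ∀ x, k (F x) = F (h x)) (hl : ∀ x, l (F x) = F (h x)) : k = l := by
  ext y
  obtain ⟨x, rfl⟩ := hF y
  rw [hk, hl]

lemma inv_semiconj {F : CircleDeg1Lift} {h k : CircleDeg1Liftˣ}
    (hk : ∀ x, k (F x) = F (h x)) (x : ℝ) : k⁻¹ (F x) = F (h⁻¹ x) := by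
  have := hk (h⁻¹ x)
  rw [units_apply_inv_apply] at this
  rw [← this, units_inv_apply_apply]

/-- A continuous lift that is constant off `K` maps `K` onto `ℝ`. -/
lemma IsConstOff.exists_mem_eq {F : CircleDeg1Lift} {K : Set ℝ} (h : F.IsConstOff K)
    (hF : Continuous F) (hK : IsClosed K) {k : ℝ} (hk : ∀ m : ℤ, k + m ∈ K) (y : ℝ) :
    ∃ x ∈ K, F x = y := by
  obtain ⟨x, rfl⟩ := F.continuous_iff_surjective.1 hF y
  have hne : (K ∩ Iic x).Nonempty :=
    ⟨k + ⌊x - k⌋, hk _, by rw [mem_Iic]; linarith [Int.floor_le (x - k)]⟩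
  have hbdd : BddAbove (K ∩ Iic x) := ⟨x, fun y hy => hy.2⟩
  have hu := (hK.inter isClosed_Iic).csSup_mem hne hbdd
  set u := sSup (K ∩ Iic x)
  refine ⟨u, hu.1, ?_⟩
  rcases (mem_Iic.1 hu.2).eq_or_lt with heq | hlt
  · rw [heq]
  · refine tendsto_nhds_unique (hF.continuousWithinAt (s := Ioi u)).tendsto
      (tendsto_const_nhds.congr' ?_)
    filter_upwards [Ioo_mem_nhdsGT hlt] with v hv
    refine (h v x hv.2.le (Set.disjoint_left.2 fun w hw hwK => ?_)).symm
    exact absurd (le_csSup hbdd ⟨hwK, hw.2⟩) (not_le.2 (hv.1.trans_le hw.1))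

lemma map_eq_map_of_sum {ι : Type*} [Fintype ι] {s : ι → CircleDeg1Liftˣ} {F : CircleDeg1Lift}
    {a c : ℝ} (hstat : ∀ x, ∑ i, F (s i x) = a * F x + c) {x y : ℝ} (hxy : F x = F y) (i : ι) :
    F (s i x) = F (s i y) := by
  wlog hle : x ≤ y generalizing x y
  · exact (this hxy.symm (le_of_not_ge hle)).symm
  refine (Finset.sum_eq_sum_iff_of_le fun i _ => F.monotone ((s i : CircleDeg1Lift).monotone hle)).1
    ?_ i (Finset.mem_univ i)
  rw [hstat, hstat, hxy]

theorem exists_invariant_or_exists_isPingPongPair {ι : Type*} [Fintype ι] [Nonempty ι]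
    {s : ι → CircleDeg1Liftˣ} (hinv : ∀ i, ∃ j, s j = (s i)⁻¹)
    (hone : translate (Multiplicative.ofAdd 1) ∈ Subgroup.closure (range s)) :
    (∃ F : CircleDeg1Lift, ∀ i, ∃ c, ∀ x, F (s i x) = F x + c) ∨
      ∃ f ∈ Subgroup.closure (range s), ∃ g ∈ Subgroup.closure (range s), IsPingPongPair f g := by
  obtain ⟨K, hKcl, ⟨k, hk⟩, hKinv, hKmin⟩ := exists_minimal_isClosed_invariant hone
  have hmem : ∀ i, s i ∈ Subgroup.closure (range s) := fun i => Subgroup.subset_closure ⟨i, rfl⟩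
  have hkm : ∀ m : ℤ, k + m ∈ K := add_intCast_mem_of_invariant hone hKinv hk
  obtain ⟨F₀, hF₀⟩ := exists_isConstOff hkm
  obtain ⟨F, hFK, c, hc⟩ := exists_stationary s (K := K)
    (fun i x hx => by simpa using hKinv _ (inv_mem (hmem i)) _ hx) F₀ hF₀
  rcases continuous_or_exists_invariant hinv hone ⟨c, hc⟩ with hF | hF
  swap
  · exact Or.inl hF
  have hsurj : Surjective F := F.continuous_iff_surjective.1 hF
  have hfib : ∀ h ∈ Subgroup.closure (range s), ∀ x y, F x = F y → F (h x) = F (h y) :=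
    fun h hh => closure_range_induction hinv
      (p := fun h : CircleDeg1Liftˣ => ∀ x y, F x = F y → F (h x) = F (h y))
      (by simp) (fun i g _ ih x y hxy => by simpa using map_eq_map_of_sum hc (ih x y hxy) i) hh
  have hex : ∀ h ∈ Subgroup.closure (range s), ∃ k : CircleDeg1Liftˣ, ∀ x, k (F x) = F (h x) :=
    fun h hh => exists_units_semiconj_of_surjective hsurj (hfib h hh) (hfib _ (inv_mem hh))
  choose s' hs' using fun i => hex _ (hmem i)
  have hinv' : ∀ i, ∃ j, s' j = (s' i)⁻¹ := fun i => by
    obtain ⟨j, hj⟩ := hinv i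
    exact ⟨j, units_ext_of_semiconj hsurj (h := s j) (hs' j)
      (by rw [hj]; exact inv_semiconj (hs' i))⟩
  have hdown : ∀ h ∈ Subgroup.closure (range s), ∃ k ∈ Subgroup.closure (range s'),
      ∀ x, k (F x) = F (h x) := fun h hh => closure_range_induction hinv
    (p := fun h : CircleDeg1Liftˣ => ∃ k ∈ Subgroup.closure (range s'), ∀ x, k (F x) = F (h x))
    ⟨1, one_mem _, by simp⟩ (by
      rintro i g - ⟨k, hk, hkg⟩
      exact ⟨s' i * k, mul_mem (Subgroup.subset_closure ⟨i, rfl⟩) hk, by simp [hkg, hs']⟩) hh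
  have hup : ∀ k ∈ Subgroup.closure (range s'), ∃ h ∈ Subgroup.closure (range s),
      ∀ x, k (F x) = F (h x) := fun h hh => closure_range_induction hinv'
    (p := fun k : CircleDeg1Liftˣ => ∃ h ∈ Subgroup.closure (range s), ∀ x, k (F x) = F (h x))
    ⟨1, one_mem _, by simp⟩ (by
      rintro i g - ⟨h, hh, hhg⟩
      exact ⟨s i * h, mul_mem (hmem i) hh, by simp [hhg, hs']⟩) hh
  have hone' : translate (Multiplicative.ofAdd 1) ∈ Subgroup.closure (range s') := by
    obtain ⟨k, hk, hkF⟩ := hdown _ hone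
    have heq : k = translate (Multiplicative.ofAdd 1) :=
      units_ext_of_semiconj hsurj hkF fun x => by simp
    rwa [heq] at hk
  have hstat' : ∃ c, ∀ x, ∑ i, s' i x = Fintype.card ι * x + c := ⟨c, fun y => by
    obtain ⟨x, rfl⟩ := hsurj y
    simp only [hs', hc]⟩
  have hmin' : IsMinimalAction (Subgroup.closure (range s')) := by
    rintro Z hZ ⟨z, hz⟩ hZinv
    obtain ⟨x, hxK, rfl⟩ := hFK.exists_mem_eq hF hKcl hkm z
    have key := hKmin (F ⁻¹' Z ∩ K) inter_subset_right ((hZ.preimage hF).inter hKcl)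
      ⟨x, hz, hxK⟩ (by
        rintro h hh y ⟨hyZ, hyK⟩
        obtain ⟨l, hl, hlF⟩ := hdown h hh
        exact ⟨by rw [mem_preimage, ← hlF]; exact hZinv l hl _ hyZ, hKinv h hh y hyK⟩)
    refine eq_univ_of_forall fun w => ?_
    obtain ⟨y, hyK, rfl⟩ := hFK.exists_mem_eq hF hKcl hkm w
    exact (key.ge hyK).1
  rcases hmin'.translations_or_exists_isPingPongPair hinv' hone' hstat' with
    htr | ⟨f', hf', g', hg', V, hne, hdisj, hper, hf, hg⟩
  · exact Or.inl ⟨F, fun i => (htr i).imp fun c hc x => by rw [← hs', hc]⟩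
  · obtain ⟨f, hfΓ, hfF⟩ := hup f' hf'
    obtain ⟨g, hgΓ, hgF⟩ := hup g' hg'
    refine Or.inr ⟨f, hfΓ, g, hgΓ, fun j => F ⁻¹' V j, fun j => (hne j).preimage hsurj,
      fun i j hij => (hdisj hij).preimage F, fun j x => by simp [hper],
      fun x hx => ?_, fun x hx => ?_⟩
    · rw [mem_preimage, ← hfF]; exact hf _ hx
    · rw [mem_preimage, ← hgF]; exact hg _ hx

lemma exists_invariant_finset_or_exists_isPingPongPair {Γ : Subgroup CircleDeg1Liftˣ}
    (hone : translate (Multiplicative.ofAdd 1) ∈ Γ) (A : Finset Γ) :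
    (∃ F : CircleDeg1Lift, ∀ g ∈ A, ∃ c, ∀ x, F ((g : CircleDeg1Liftˣ) x) = F x + c) ∨
      ∃ f ∈ Γ, ∃ g ∈ Γ, IsPingPongPair f g := by
  let a : Option A → CircleDeg1Liftˣ := fun o =>
    o.elim (translate (Multiplicative.ofAdd 1)) fun g => g.1
  let s : Option A ⊕ Option A → CircleDeg1Liftˣ := Sum.elim a fun o => (a o)⁻¹
  have ha : ∀ o, a o ∈ Γ := by
    rintro (_ | g)
    exacts [hone, g.1.2]
  have hle : Subgroup.closure (range s) ≤ Γ := by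
    rw [Subgroup.closure_le]
    rintro _ ⟨o | o, rfl⟩
    exacts [ha o, inv_mem (ha o)]
  have hinv : ∀ i, ∃ j, s j = (s i)⁻¹ := by
    rintro (o | o)
    exacts [⟨Sum.inr o, rfl⟩, ⟨Sum.inl o, (inv_inv _).symm⟩]
  rcases exists_invariant_or_exists_isPingPongPair hinv
    (Subgroup.subset_closure ⟨Sum.inl none, rfl⟩) with ⟨F, hF⟩ | ⟨f, hf, g, hg, h⟩
  · exact Or.inl ⟨F, fun g hg => hF (Sum.inl (some ⟨g, hg⟩))⟩
  · exact Or.inr ⟨f, hle hf, g, hle hg, h⟩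

theorem exists_invariant_or_exists_isPingPongPair_subgroup {Γ : Subgroup CircleDeg1Liftˣ}
    (hone : translate (Multiplicative.ofAdd 1) ∈ Γ) :
    (∃ F : CircleDeg1Lift, ∀ g ∈ Γ, ∃ c, ∀ x, F (g x) = F x + c) ∨
      ∃ f ∈ Γ, ∃ g ∈ Γ, IsPingPongPair f g := by
  refine or_iff_not_imp_right.2 fun hpp => ?_
  choose D hD using fun A =>
    (exists_invariant_finset_or_exists_isPingPongPair hone A).resolve_right hpp
  obtain ⟨F, hF⟩ := exists_tendsto_ultrafilter (Ultrafilter.of (atTop : Filter (Finset Γ))) D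
  refine ⟨F, fun g hg => ⟨F (g 0) - F 0, fun x => ?_⟩⟩
  have hev : ∀ᶠ A in (Ultrafilter.of (atTop : Filter (Finset Γ)) : Filter (Finset Γ)),
      (D A (g x) - D A 0) - (D A x - D A 0) = (D A (g 0) - D A 0) - (D A 0 - D A 0) := by
    filter_upwards [Ultrafilter.of_le atTop (eventually_ge_atTop {(⟨g, hg⟩ : Γ)})] with A hA
    obtain ⟨c, hc⟩ := hD A ⟨g, hg⟩ (Finset.singleton_subset_iff.1 hA)
    have h1 := hc x
    have h2 := hc 0
    dsimp only at h1 h2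
    linarith
  have := tendsto_nhds_unique_of_eventuallyEq ((hF (g x)).sub (hF x)) ((hF (g 0)).sub (hF 0)) hev
  linarith

lemma rightLim_apply_units {F : CircleDeg1Lift} {g : CircleDeg1Liftˣ} {c : ℝ}
    (h : ∀ x, F (g x) = F x + c) (x : ℝ) : rightLim F (g x) = rightLim F x + c := by
  refine tendsto_nhds_unique
    ((F.monotone.tendsto_rightLim (g x)).comp (tendsto_units_nhdsGT g x)) ?_
  simp only [comp_def, h]
  exact (F.monotone.tendsto_rightLim x).add_const c

lemma units_inv_apply_lt_iff {g : CircleDeg1Liftˣ} {x y : ℝ} : g⁻¹ x < y ↔ x < g y := by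
  rw [← (units_strictMono g).lt_iff_lt, units_apply_inv_apply]

lemma units_preimage_Ioc (g : CircleDeg1Liftˣ) (a b : ℝ) :
    g ⁻¹' Ioc a b = Ioc (g⁻¹ a) (g⁻¹ b) := by
  ext x
  rw [mem_preimage, mem_Ioc, mem_Ioc, units_inv_apply_lt_iff, ← not_lt, ← not_lt,
    units_inv_apply_lt_iff]

lemma map_stieltjes_measure {F : CircleDeg1Lift} {g : CircleDeg1Liftˣ}
    (h : ∃ c, ∀ x, F (g x) = F x + c) :
    F.monotone.stieltjesFunction.measure.map g = F.monotone.stieltjesFunction.measure := by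
  obtain ⟨c, hc⟩ := h
  refine (Measure.ext_of_Ioc _ _ fun a b _ => ?_).symm
  rw [Measure.map_apply (units_continuous g).measurable measurableSet_Ioc, units_preimage_Ioc,
    StieltjesFunction.measure_Ioc, StieltjesFunction.measure_Ioc]
  simp only [Monotone.stieltjesFunction_eq]
  have ha := rightLim_apply_units hc (g⁻¹ a)
  have hb := rightLim_apply_units hc (g⁻¹ b)
  rw [units_apply_inv_apply] at ha hb
  rw [ha, hb]
  congr 1
  ring

lemma coe_intCast_addCircle (m : ℤ) : ((m : ℝ) : AddCircle (1 : ℝ)) = 0 :=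
  AddCircle.coe_eq_zero_iff 1 |>.2 ⟨m, by simp⟩

/-- The measure induced on the circle by a lift of degree one. -/
noncomputable def circleMeasure (F : CircleDeg1Lift) : Measure (AddCircle (1 : ℝ)) :=
  (F.monotone.stieltjesFunction.measure.restrict (Ioc 0 1)).map ((↑) : ℝ → AddCircle (1 : ℝ))

lemma map_translate_stieltjes_measure (F : CircleDeg1Lift) (m : ℤ) :
    F.monotone.stieltjesFunction.measure.map (fun x : ℝ => m + x) =
      F.monotone.stieltjesFunction.measure :=
  map_stieltjes_measure (g := translate (Multiplicative.ofAdd (m : ℝ)))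
    ⟨m, fun x => by simp [add_comm]⟩

lemma circleMeasure_apply (F : CircleDeg1Lift) {A : Set (AddCircle (1 : ℝ))} (hA : MeasurableSet A)
    (t : ℝ) : F.circleMeasure A =
      F.monotone.stieltjesFunction.measure (((↑) : ℝ → AddCircle (1 : ℝ)) ⁻¹' A ∩ Ioc t (t + 1)) := by
  have hmeas := AddCircle.measurable_mk' (a := (1 : ℝ)) hA
  rw [circleMeasure, Measure.map_apply AddCircle.measurable_mk' hA, Measure.restrict_apply hmeas]
  have : VAddInvariantMeasure (AddSubgroup.zmultiples (1 : ℝ)) ℝ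
      F.monotone.stieltjesFunction.measure := ⟨by
    rintro ⟨_, m, rfl⟩ S hS
    conv_rhs => rw [← F.map_translate_stieltjes_measure m]
    rw [Measure.map_apply (by fun_prop) hS]
    simp [AddSubgroup.vadd_def]⟩
  have hdom := isAddFundamentalDomain_Ioc one_pos 0 F.monotone.stieltjesFunction.measure
  rw [zero_add] at hdom
  refine hdom.measure_set_eq (isAddFundamentalDomain_Ioc one_pos t _) hmeas ?_
  rintro ⟨_, m, rfl⟩
  ext x
  simp [AddSubgroup.vadd_def, coe_intCast_addCircle]

lemma isProbabilityMeasure_circleMeasure (F : CircleDeg1Lift) :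
    IsProbabilityMeasure F.circleMeasure := by
  refine ⟨?_⟩
  rw [F.circleMeasure_apply MeasurableSet.univ 0, preimage_univ, univ_inter,
    StieltjesFunction.measure_Ioc]
  have := rightLim_apply_units (F := F) (g := translate (Multiplicative.ofAdd 1)) (c := 1)
    (fun x => by simp [add_comm]) 0
  simp only [translate_apply, add_zero] at this
  simp [Monotone.stieltjesFunction_eq, this]

lemma map_circleMeasure {F : CircleDeg1Lift} {g : CircleDeg1Liftˣ}
    (h : ∃ c, ∀ x, F (g x) = F x + c) {φ : AddCircle (1 : ℝ) → AddCircle (1 : ℝ)}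
    (hφ : Continuous φ) (hgφ : ∀ x : ℝ, ((g x : ℝ) : AddCircle (1 : ℝ)) = φ x) :
    F.circleMeasure.map φ = F.circleMeasure := by
  ext A hA
  rw [Measure.map_apply hφ.measurable hA, F.circleMeasure_apply (hφ.measurable hA) (g⁻¹ 0),
    F.circleMeasure_apply hA 0]
  conv_rhs => rw [← map_stieltjes_measure h]
  rw [Measure.map_apply (units_continuous g).measurable
    ((AddCircle.measurable_mk' hA).inter measurableSet_Ioc), preimage_inter, units_preimage_Ioc,
    map_add_one]
  congr 2
  ext x
  simp [hgφ]

/-- The real function `h` is a lift of the self-map `φ` of the circle. -/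
def IsCircleLift (h : ℝ → ℝ) (φ : AddCircle (1 : ℝ) → AddCircle (1 : ℝ)) : Prop :=
  ∀ x : ℝ, ((h x : ℝ) : AddCircle (1 : ℝ)) = φ x

lemma IsCircleLift.comp {h k : ℝ → ℝ} {φ ψ : AddCircle (1 : ℝ) → AddCircle (1 : ℝ)}
    (hh : IsCircleLift h φ) (hk : IsCircleLift k ψ) : IsCircleLift (h ∘ k) (φ ∘ ψ) := fun x => by
  rw [comp_apply, hh, hk, comp_apply]

lemma exists_isCircleLift {φ : AddCircle (1 : ℝ) → AddCircle (1 : ℝ)} (hφ : Continuous φ) :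
    ∃ h : ℝ → ℝ, Continuous h ∧ IsCircleLift h φ := by
  obtain ⟨e, he⟩ := QuotientAddGroup.mk_surjective (φ ((0 : ℝ) : AddCircle (1 : ℝ)))
  obtain ⟨h, ⟨-, hh⟩, -⟩ := (AddCircle.isCoveringMap_coe (1 : ℝ)).existsUnique_continuousMap_lifts
    ⟨fun x : ℝ => φ x, hφ.comp (AddCircle.continuous_mk' 1)⟩ (0 : ℝ) e he
  exact ⟨h, h.continuous, fun x => congrFun hh x⟩

lemma coe_addCircle_eq_iff {x y : ℝ} :
    (x : AddCircle (1 : ℝ)) = y ↔ ∃ m : ℤ, x = y + m := by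
  rw [← sub_eq_zero, ← AddCircle.coe_sub, AddCircle.coe_eq_zero_iff]
  simp only [zsmul_eq_mul, mul_one]
  exact exists_congr fun m => ⟨fun h => by linarith, fun h => by linarith⟩

lemma IsCircleLift.exists_eq_add_intCast {h k : ℝ → ℝ}
    {φ : AddCircle (1 : ℝ) → AddCircle (1 : ℝ)} (hh : IsCircleLift h φ) (hk : IsCircleLift k φ)
    (hhc : Continuous h) (hkc : Continuous k) : ∃ m : ℤ, ∀ x, h x = k x + m := by
  obtain ⟨m, hm⟩ := coe_addCircle_eq_iff.1 ((hh 0).trans (hk 0).symm)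
  refine ⟨m, congrFun ((AddCircle.isCoveringMap_coe (1 : ℝ)).eq_of_comp_eq hhc
    (hkc.add continuous_const) (funext fun x => ?_) 0 hm)⟩
  simp only [comp_apply]
  rw [hh, AddCircle.coe_add, coe_intCast_addCircle, add_zero, hk]

lemma exists_bijective_isCircleLift {g : Equiv.Perm (AddCircle (1 : ℝ))} (hg : Continuous g)
    (hg' : Continuous ⇑g⁻¹) : ∃ h : ℝ → ℝ, Continuous h ∧ IsCircleLift h g ∧ Bijective h := by
  obtain ⟨h, hhc, hh⟩ := exists_isCircleLift hg
  obtain ⟨k, hkc, hk⟩ := exists_isCircleLift hg'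
  obtain ⟨m, hm⟩ := (hh.comp hk).exists_eq_add_intCast (k := id) (fun x => by simp)
    (hhc.comp hkc) continuous_id
  obtain ⟨n, hn⟩ := (hk.comp hh).exists_eq_add_intCast (k := id) (fun x => by simp)
    (hkc.comp hhc) continuous_id
  refine ⟨h, hhc, hh, fun x y hxy => ?_, fun y => ⟨k (y - m), ?_⟩⟩
  · have hx := hn x
    have hy := hn y
    rw [comp_apply, hxy] at hx
    rw [comp_apply] at hy
    exact add_right_cancel (hx.symm.trans hy)
  · simpa using hm (y - m)

lemma exists_units_of_strictMono_isCircleLift {g : Equiv.Perm (AddCircle (1 : ℝ))} {h : ℝ → ℝ}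
    (hhc : Continuous h) (hh : IsCircleLift h g) (hmono : StrictMono h) (hsurj : Surjective h) :
    ∃ u : CircleDeg1Liftˣ, IsCircleLift u g := by
  obtain ⟨d, hd⟩ := IsCircleLift.exists_eq_add_intCast (h := fun x => h (x + 1)) (k := h) (φ := g)
    (fun x => by rw [hh, AddCircle.coe_add_period]) hh (by fun_prop) hhc
  have hd1 : d = 1 := by
    refine le_antisymm ?_ ?_
    · obtain ⟨x, hx⟩ := hsurj (h 0 + 1)
      have hgx : g x = g (0 : ℝ) := by
        rw [← hh, ← hh, hx, AddCircle.coe_add_period]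
      obtain ⟨j, hj⟩ := coe_addCircle_eq_iff.1 (g.injective hgx)
      have h0 : 0 < x := hmono.lt_iff_lt.1 (by rw [hx]; linarith)
      have h1 : (1 : ℝ) ≤ x := by
        rw [hj, zero_add] at h0 ⊢
        exact_mod_cast h0
      have h2 := hmono.monotone h1
      have h3 := hd 0
      rw [zero_add] at h3
      have : (d : ℝ) ≤ 1 := by linarith
      exact_mod_cast this
    · have h1 : h 0 < h (0 + 1) := hmono (by norm_num)
      rw [hd 0] at h1
      have : (0 : ℝ) < d := by linarith
      exact_mod_cast this
  let H : CircleDeg1Lift := ⟨⟨h, hmono.monotone⟩, fun x => by simpa [hd1] using hd x⟩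
  obtain ⟨u, hu⟩ := isUnit_iff_bijective.2 (show Bijective H from ⟨hmono.injective, hsurj⟩)
  exact ⟨u, fun x => by rw [hu]; exact hh x⟩

/-- The permutations of the circle that lift to an increasing homeomorphism of the line. -/
def orientationPreserving : Subgroup (Equiv.Perm (AddCircle (1 : ℝ))) where
  carrier := {g | ∃ u : CircleDeg1Liftˣ, IsCircleLift u g}
  one_mem' := ⟨1, fun x => by simp⟩
  mul_mem' := by
    rintro a b ⟨u, hu⟩ ⟨v, hv⟩
    exact ⟨u * v, fun x => by simpa using hu.comp hv x⟩
  inv_mem' := by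
    rintro a ⟨u, hu⟩
    refine ⟨u⁻¹, fun x => a.injective ?_⟩
    rw [← hu, units_apply_inv_apply]
    simp

/-- All lifts to the line of the orientation preserving elements of `G`. -/
def liftSubgroup (G : Subgroup (Equiv.Perm (AddCircle (1 : ℝ)))) : Subgroup CircleDeg1Liftˣ where
  carrier := {u | ∃ g ∈ G, IsCircleLift u g}
  one_mem' := ⟨1, one_mem _, fun x => by simp⟩
  mul_mem' := by
    rintro u v ⟨a, ha, hu⟩ ⟨b, hb, hv⟩
    exact ⟨a * b, mul_mem ha hb, fun x => by simpa using hu.comp hv x⟩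
  inv_mem' := by
    rintro u ⟨a, ha, hu⟩
    refine ⟨a⁻¹, inv_mem ha, fun x => a.injective ?_⟩
    rw [← hu, units_apply_inv_apply]
    simp

lemma translate_one_mem_liftSubgroup (G : Subgroup (Equiv.Perm (AddCircle (1 : ℝ)))) :
    translate (Multiplicative.ofAdd 1) ∈ liftSubgroup G :=
  ⟨1, one_mem _, fun x => by simp⟩

lemma mul_mem_orientationPreserving {G : Subgroup (Equiv.Perm (AddCircle (1 : ℝ)))}
    (hcont : ∀ g ∈ G, Continuous ⇑g) {a b : Equiv.Perm (AddCircle (1 : ℝ))} (ha : a ∈ G)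
    (hb : b ∈ G) (ha' : a ∉ orientationPreserving) (hb' : b ∉ orientationPreserving) :
    a * b ∈ orientationPreserving := by
  have key : ∀ g ∈ G, g ∉ orientationPreserving →
      ∃ h : ℝ → ℝ, Continuous h ∧ IsCircleLift h g ∧ Surjective h ∧ StrictAnti h := by
    intro g hg hg'
    obtain ⟨h, hhc, hh, hbij⟩ := exists_bijective_isCircleLift (hcont g hg) (hcont _ (inv_mem hg))
    refine ⟨h, hhc, hh, hbij.2, (hhc.strictMono_of_inj hbij.1).resolve_left fun hmono => hg' ?_⟩
    exact exists_units_of_strictMono_isCircleLift hhc hh hmono hbij.2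
  obtain ⟨h, hhc, hh, hsurj, hanti⟩ := key a ha ha'
  obtain ⟨k, hkc, hk, ksurj, kanti⟩ := key b hb hb'
  exact exists_units_of_strictMono_isCircleLift (hhc.comp hkc) (hh.comp hk) (hanti.comp kanti)
    (hsurj.comp ksurj)

lemma exists_isProbabilityMeasure_of_index_two {X : Type*} [MeasurableSpace X]
    {G P : Subgroup (Equiv.Perm X)} (hmeas : ∀ g ∈ G, Measurable ⇑g)
    (hP : ∀ a ∈ G, ∀ b ∈ G, a ∉ P → b ∉ P → a * b ∈ P) {μ : Measure X} [IsProbabilityMeasure μ]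
    (hμ : ∀ g ∈ G, g ∈ P → μ.map ⇑g = μ) :
    ∃ ν : Measure X, IsProbabilityMeasure ν ∧ ∀ g ∈ G, ν.map ⇑g = ν := by
  by_cases hGP : G ≤ P
  · exact ⟨μ, inferInstance, fun g hg => hμ g hg (hGP hg)⟩
  obtain ⟨r, hr, hrP⟩ := SetLike.not_le_iff_exists.1 hGP
  have hmul : ∀ a ∈ G, ∀ b ∈ G, μ.map ⇑(a * b) = (μ.map ⇑b).map ⇑a := fun a ha b hb =>
    (Measure.map_map (hmeas a ha) (hmeas b hb)).symm
  have hri : r⁻¹ ∈ G := inv_mem hr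
  have hriP : r⁻¹ ∉ P := fun h => hrP (inv_mem_iff.1 h)
  have hout : ∀ g ∈ G, g ∉ P → μ.map ⇑g = μ.map ⇑r := by
    intro g hg hgP
    conv_lhs => rw [← mul_inv_cancel_left r g]
    rw [hmul r hr _ (mul_mem hri hg), hμ _ (mul_mem hri hg) (hP _ hri _ hg hriP hgP)]
  have : IsProbabilityMeasure (μ.map ⇑r) :=
    Measure.isProbabilityMeasure_map (hmeas r hr).aemeasurable
  refine ⟨(2⁻¹ : ENNReal) • (μ + μ.map ⇑r), ⟨?_⟩, fun g hg => ?_⟩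
  · simp only [Measure.smul_apply, Measure.add_apply, measure_univ, smul_eq_mul, one_add_one_eq_two]
    exact ENNReal.inv_mul_cancel two_ne_zero ENNReal.ofNat_ne_top
  · rw [Measure.map_smul, Measure.map_add _ _ (hmeas g hg), ← hmul g hg r hr]
    congr 1
    by_cases hgP : g ∈ P
    · rw [hμ g hg hgP, hout (g * r) (mul_mem hg hr) fun h => hrP ((P.mul_mem_cancel_left hgP).1 h)]
    · rw [hout g hg hgP, hμ _ (mul_mem hg hr) (hP g hg r hr hgP hrP), add_comm]

lemma IsPingPongPair.injective_lift {f g : CircleDeg1Liftˣ} (h : IsPingPongPair f g)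
    {G : Subgroup (Equiv.Perm (AddCircle (1 : ℝ)))} {φ ψ : G}
    (hf : IsCircleLift f (φ : Equiv.Perm (AddCircle (1 : ℝ))))
    (hg : IsCircleLift g (ψ : Equiv.Perm (AddCircle (1 : ℝ)))) :
    Injective (FreeGroup.lift fun b : Bool => if b then φ else ψ) := by
  obtain ⟨V, hne, hdisj, hper, hfV, hgV⟩ := h
  let π : ℝ → AddCircle (1 : ℝ) := (↑)
  have hmem : ∀ j x, π x ∈ π '' V j ↔ x ∈ V j := by
    refine fun j x => ⟨?_, mem_image_of_mem π⟩
    rintro ⟨y, hy, hyx⟩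
    obtain ⟨m, rfl⟩ := coe_addCircle_eq_iff.1 hyx
    have hp : Periodic (fun x => x ∈ V j) 1 := fun x => propext (hper j x)
    have := hp.int_mul m x
    rw [mul_one] at this
    exact this.mp hy
  have hdisj' : ∀ i j, i ≠ j → Disjoint (π '' V i) (π '' V j) := by
    refine fun i j hij => Set.disjoint_left.2 ?_
    rintro _ ⟨x, hx, rfl⟩ hx'
    exact Set.disjoint_left.1 (hdisj hij) hx ((hmem j x).1 hx')
  let a : Bool → G := fun b => if b then φ else ψ
  have hplay : ∀ b p, p ∉ π '' V (bif b then 0 else 2) → a b • p ∈ π '' V (bif b then 1 else 3) := by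
    intro b p hp
    obtain ⟨x, rfl⟩ := QuotientAddGroup.mk_surjective p
    cases b
    · exact ⟨g x, hgV x fun hx => hp ((hmem 2 x).2 hx), hg x⟩
    · exact ⟨f x, hfV x fun hx => hp ((hmem 0 x).2 hx), hf x⟩
  refine FreeGroup.injective_lift_of_ping_pong a (fun b => π '' V (bif b then 1 else 3))
    (fun b => π '' V (bif b then 0 else 2)) (fun b => (hne _).image π)
    (fun b c hbc => hdisj' _ _ ?_) (fun b c hbc => hdisj' _ _ ?_) (fun b c => hdisj' _ _ ?_)
    (fun b => ?_) (fun b => ?_)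
  · cases b <;> cases c <;> simp_all
  · cases b <;> cases c <;> simp_all
  · cases b <;> cases c <;> simp
  · rintro _ ⟨p, hp, rfl⟩
    exact hplay b p hp
  · rintro _ ⟨p, hp, rfl⟩
    by_contra hq
    refine hp ?_
    have := hplay b _ hq
    simpa using this

end CircleDeg1Lift

/-- Margulis. For every subgroup `G` of the group of homeomorphisms of
the circle `AddCircle ℝ 1` (realized as a subgroup of permutations all of whose elements
act continuously), either there is a `G`-invariant Borel probability measure on the
circle, or `G` contains a nonabelian free subgroup. -/
theorem margulis_invariant_measure_or_free_subgroup
    (G : Subgroup (Equiv.Perm (AddCircle (1 : ℝ))))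
    (hcont : ∀ g ∈ G, Continuous ⇑g) :
    (∃ μ : Measure (AddCircle (1 : ℝ)), IsProbabilityMeasure μ ∧
      ∀ g ∈ G, Measure.map ⇑g μ = μ) ∨
    (∃ f g : G, Function.Injective
      ⇑(FreeGroup.lift (fun b : Bool => if b then f else g) : FreeGroup Bool →* G)) := by
  rcases CircleDeg1Lift.exists_invariant_or_exists_isPingPongPair_subgroup
    (CircleDeg1Lift.translate_one_mem_liftSubgroup G) with
    ⟨F, hF⟩ | ⟨f, ⟨φ, hφ, hf⟩, g, ⟨ψ, hψ, hg⟩, hfg⟩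
  · have := F.isProbabilityMeasure_circleMeasure
    refine Or.inl (CircleDeg1Lift.exists_isProbabilityMeasure_of_index_two
      (fun g hg => (hcont g hg).measurable)
      (fun a ha b hb => CircleDeg1Lift.mul_mem_orientationPreserving hcont ha hb)
      (μ := F.circleMeasure) ?_)
    rintro g hg ⟨u, hu⟩
    exact CircleDeg1Lift.map_circleMeasure (hF u ⟨g, hg, hu⟩) (hcont g hg) hu
  · exact Or.inr ⟨⟨φ, hφ⟩, ⟨ψ, hψ⟩, hfg.injective_lift hf hg⟩
end

section
/- (Kerékjártó.) Let D = {x ∈ ℝ² : ‖x‖ ≤ 1} be the closed unit disk and let f : D → D be a homeomorphism of D that restricts to the identity on the boundary circle {x : ‖x‖ = 1}. If f is periodic, i.e. f^n = id for some integer n ≥ 1, then f = id. In particular, the group of homeomorphisms of the 2-disk that are the identity on the boundary is torsion-free. -/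
/-- The closed unit disk in the Euclidean plane. -/
abbrev UnitDisk : Set (EuclideanSpace ℝ (Fin 2)) :=
  Metric.closedBall (0 : EuclideanSpace ℝ (Fin 2)) 1

open Metric Complex Set Filter Topology

/-- Lifts through `exp` of paths on the real line are determined by one value. -/
theorem eq_of_exp_comp_eq {a b : ℝ → ℂ} (ha : Continuous a) (hb : Continuous b)
    (h : ∀ t, exp (a t) = exp (b t)) (h0 : a 0 = b 0) (t : ℝ) : a t = b t :=
  congrFun (isCoveringMap_exp.eq_of_comp_eq ha hb
    (funext fun t ↦ Subtype.ext (h t)) 0 h0) t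

theorem exists_continuous_exp_eq {A : Type*} [TopologicalSpace A] [SimplyConnectedSpace A]
    [LocallyPathConnectedSpace A] {g : A → ℂ} (hg : Continuous g) (h0 : ∀ a, g a ≠ 0) :
    ∃ φ : A → ℂ, Continuous φ ∧ ∀ a, g a = exp (φ a) := by
  obtain ⟨a₀⟩ : Nonempty A := inferInstance
  obtain ⟨F, ⟨-, hF⟩, -⟩ := isCoveringMap_exp.existsUnique_continuousMap_lifts
    ⟨fun a ↦ (⟨g a, h0 a⟩ : {z : ℂ // z ≠ 0}), by fun_prop⟩ a₀ (log (g a₀))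
    (Subtype.ext (exp_log (h0 a₀)))
  exact ⟨F, F.continuous, fun a ↦ (congrArg Subtype.val (congrFun hF a)).symm⟩

/-- A continuous function without zeros on a closed disc has a continuous logarithm there. -/
theorem exists_continuous_exp_eq_on_closedBall {g : ℂ → ℂ} (hg : Continuous g) (c : ℂ) {r : ℝ}
    (hr : 0 < r) (h0 : ∀ x ∈ closedBall c r, g x ≠ 0) :
    ∃ φ : ℂ → ℂ, Continuous φ ∧ ∀ x ∈ closedBall c r, g x = exp (φ x) := by
  have hpos : ∀ x : ℂ, 0 < max r ‖x - c‖ := fun x ↦ lt_max_of_lt_left hr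
  let ρ : ℂ → ℂ := fun x ↦ c + ((r / max r ‖x - c‖ : ℝ) : ℂ) * (x - c)
  have hρ : Continuous ρ := by
    have : Continuous fun x : ℂ ↦ r / max r ‖x - c‖ :=
      continuous_const.div (by fun_prop) fun x ↦ (hpos x).ne'
    fun_prop
  have hmem : ∀ x, ρ x ∈ closedBall c r := fun x ↦ by
    rw [mem_closedBall, dist_eq_norm, add_sub_cancel_left, norm_mul, norm_real,
      Real.norm_of_nonneg (div_pos hr (hpos x)).le, div_mul_eq_mul_div, div_le_iff₀ (hpos x)]
    gcongr
    exact le_max_right _ _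
  obtain ⟨φ, hφ, h⟩ := exists_continuous_exp_eq (hg.comp hρ) fun x ↦ h0 _ (hmem x)
  refine ⟨φ, hφ, fun x hx ↦ ?_⟩
  rw [mem_closedBall, dist_eq_norm] at hx
  rw [← h x]
  simp [hr.ne', ρ, max_eq_left hx]

/-- On a circle, a continuous function without zeros is a power of `z - c` times an
exponential. -/
theorem exists_eq_zpow_mul_exp_on_sphere {g : ℂ → ℂ} {c : ℂ} {r : ℝ} (hr : 0 < r)
    (hg : ContinuousOn g (sphere c r)) (h0 : ∀ x ∈ sphere c r, g x ≠ 0) :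
    ∃ (n : ℤ) (ψ : ℂ → ℂ), Continuous ψ ∧ ∀ x ∈ sphere c r, g x = (x - c) ^ n * exp (ψ x) := by
  have hmem : ∀ θ, circleMap c r θ ∈ sphere c r := circleMap_mem_sphere c hr.le
  have hgc : Continuous fun θ : ℝ ↦ g (circleMap c r θ) :=
    hg.comp_continuous (continuous_circleMap c r) hmem
  obtain ⟨L, hL, hgL⟩ := exists_continuous_exp_eq hgc fun θ ↦ h0 _ (hmem θ)
  have hper : ∀ θ, exp (L (θ + 2 * Real.pi)) = exp (L θ) := fun θ ↦ by
    rw [← hgL, ← hgL, periodic_circleMap]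
  obtain ⟨n, hn⟩ := exp_eq_exp_iff_exists_int.mp (hper 0)
  have hstep : ∀ θ, L (θ + 2 * Real.pi) = L θ + n * (2 * Real.pi * I) :=
    eq_of_exp_comp_eq (by fun_prop) (by fun_prop)
      (fun θ ↦ by rw [hper, exp_add, exp_int_mul_two_pi_mul_I, mul_one]) hn
  let M : ℝ → ℂ := fun θ ↦ L θ - n * (θ * I) - n * Real.log r
  have hM : Function.Periodic M (2 * Real.pi) := fun θ ↦ by
    simp only [M, hstep]; push_cast; ring
  have hMc : Continuous M := by fun_prop
  have hlift : Continuous hM.lift := hMc.quotient_liftOn' _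
  let q : sphere c r → Circle := fun x ↦ ⟨(x - c) / r, by
    have := x.2
    rw [mem_sphere, dist_eq_norm] at this
    simp [Submonoid.unitSphere, this, abs_of_pos hr, hr.ne']⟩
  have hq : Continuous q := by
    refine Continuous.subtype_mk ?_ _
    exact (continuous_subtype_val.sub continuous_const).div_const _
  obtain ⟨ψ, hψ⟩ := ContinuousMap.exists_restrict_eq (isClosed_sphere (x := c) (ε := r))
    ⟨fun x ↦ hM.lift (AddCircle.homeomorphCircle'.symm (q x)), by fun_prop⟩
  refine ⟨n, ψ, ψ.continuous, fun x hx ↦ ?_⟩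
  obtain ⟨θ, rfl⟩ : ∃ θ, circleMap c r θ = x := by
    have : x ∈ range (circleMap c r) := by rwa [range_circleMap, abs_of_pos hr]
    exact this
  have hψθ : ψ (circleMap c r θ) = M θ := by
    have h1 := congrArg (fun F ↦ F ⟨circleMap c r θ, hx⟩) hψ
    have h2 : q ⟨circleMap c r θ, hx⟩ =
        AddCircle.homeomorphCircle' (θ : AddCircle (2 * Real.pi)) := by
      rw [AddCircle.homeomorphCircle'_apply_mk]
      ext
      simp [q, circleMap, hr.ne']
    simp only [ContinuousMap.restrict_apply, ContinuousMap.coe_mk, h2,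
      Homeomorph.symm_apply_apply, Function.Periodic.lift_coe] at h1
    exact h1
  have hr' : (r : ℂ) = exp (Real.log r) := by rw [← ofReal_exp, Real.exp_log hr]
  rw [hψθ, hgL θ]
  simp only [circleMap, add_sub_cancel_left, M]
  rw [hr', ← exp_add, ← exp_int_mul, ← exp_add]
  congr 1
  ring

/-- `g` has winding number `n` around the origin along the unit circle. -/
def HasUnitWinding (g : ℂ → ℂ) (n : ℤ) : Prop :=
  ∃ φ : ℂ → ℂ, ContinuousOn φ (sphere 0 1) ∧ ∀ x ∈ sphere (0 : ℂ) 1, g x = x ^ n * exp (φ x)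

namespace HasUnitWinding

theorem congr {g h : ℂ → ℂ} {n : ℤ} (hg : HasUnitWinding g n)
    (H : ∀ x ∈ sphere (0 : ℂ) 1, h x = g x) : HasUnitWinding h n := by
  obtain ⟨φ, hφ, hx⟩ := hg
  exact ⟨φ, hφ, fun x h ↦ (H x h).trans (hx x h)⟩

theorem mul {g h : ℂ → ℂ} {m n : ℤ} (hg : HasUnitWinding g m) (hh : HasUnitWinding h n) :
    HasUnitWinding (fun x ↦ g x * h x) (m + n) := by
  obtain ⟨φ, hφ, hgx⟩ := hg
  obtain ⟨ψ, hψ, hhx⟩ := hh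
  refine ⟨fun x ↦ φ x + ψ x, hφ.add hψ, fun x hx ↦ ?_⟩
  have : x ≠ 0 := ne_of_mem_sphere hx one_ne_zero
  simp only [hgx x hx, hhx x hx, exp_add, zpow_add₀ this]
  ring

theorem zpow {g : ℂ → ℂ} {m : ℤ} (hg : HasUnitWinding g m) (k : ℤ) :
    HasUnitWinding (fun x ↦ g x ^ k) (m * k) := by
  obtain ⟨φ, hφ, hgx⟩ := hg
  refine ⟨fun x ↦ k * φ x, continuousOn_const.mul hφ, fun x hx ↦ ?_⟩
  simp only [hgx x hx, mul_zpow, exp_int_mul, zpow_mul]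

/-- A function close to `1` has winding number zero. -/
theorem of_norm_sub_one_lt {u : ℂ → ℂ} (hu : ContinuousOn u (sphere 0 1))
    (h : ∀ x ∈ sphere (0 : ℂ) 1, ‖u x - 1‖ < 1) : HasUnitWinding u 0 := by
  have hs : ∀ x ∈ sphere (0 : ℂ) 1, u x ∈ slitPlane := fun x hx ↦ by
    have := mem_slitPlane_of_norm_lt_one (h x hx)
    rwa [add_sub_cancel] at this
  refine ⟨fun x ↦ log (u x), hu.clog hs, fun x hx ↦ ?_⟩
  rw [exp_log (slitPlane_ne_zero (hs x hx)), zpow_zero, one_mul]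

theorem sub_const {c : ℂ} (hc : ‖c‖ < 1) : HasUnitWinding (fun x ↦ x - c) 1 := by
  have h0 : ∀ x ∈ sphere (0 : ℂ) 1, x ≠ 0 := fun x hx ↦ ne_of_mem_sphere hx one_ne_zero
  have h1 : HasUnitWinding (fun x ↦ x) 1 :=
    ⟨fun _ ↦ 0, continuousOn_const, fun x _ ↦ by simp⟩
  have h2 : HasUnitWinding (fun x ↦ 1 - c / x) 0 := by
    refine of_norm_sub_one_lt
      (continuousOn_const.sub (continuousOn_const.div continuousOn_id h0)) fun x hx ↦ ?_
    have : ‖x‖ = 1 := by simpa using hx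
    simpa [this] using hc
  refine (h1.mul h2).congr fun x hx ↦ ?_
  have := h0 x hx
  field_simp

theorem const {a : ℂ} (ha : a ≠ 0) : HasUnitWinding (fun _ ↦ a) 0 :=
  ⟨fun _ ↦ log a, continuousOn_const, fun x _ ↦ by simp [exp_log ha]⟩

theorem unique {g : ℂ → ℂ} {m n : ℤ} (hm : HasUnitWinding g m) (hn : HasUnitWinding g n) :
    m = n := by
  obtain ⟨φ, hφ, hφx⟩ := hm
  obtain ⟨ψ, hψ, hψx⟩ := hn
  have hmem : ∀ θ, circleMap 0 1 θ ∈ sphere (0 : ℂ) 1 := circleMap_mem_sphere 0 zero_le_one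
  have hφc := hφ.comp_continuous (continuous_circleMap 0 1) hmem
  have hψc := hψ.comp_continuous (continuous_circleMap 0 1) hmem
  let a : ℝ → ℂ := fun θ ↦ (m - n) * (θ * I) + (φ (circleMap 0 1 θ) - ψ (circleMap 0 1 θ))
  have ha : Continuous a :=
    (by fun_prop : Continuous fun θ : ℝ ↦ ((m : ℂ) - n) * (θ * I)).add (hφc.sub hψc)
  have hexp : ∀ θ, exp (a θ) = 1 := fun θ ↦ by
    have h := (hφx _ (hmem θ)).symm.trans (hψx _ (hmem θ))
    have hz : circleMap 0 1 θ = exp (θ * I) := by simp [circleMap]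
    rw [hz, ← exp_int_mul, ← exp_int_mul, ← exp_add, ← exp_add, ← hz] at h
    have haθ : a θ = (m * (θ * I) + φ (circleMap 0 1 θ)) -
        (n * (θ * I) + ψ (circleMap 0 1 θ)) := by
      simp only [a]; ring
    rw [haθ, exp_sub, h, div_self (exp_ne_zero _)]
  have h := eq_of_exp_comp_eq ha (continuous_const (y := a 0))
    (fun t ↦ by rw [hexp, hexp]) rfl (2 * Real.pi)
  have h2 : circleMap 0 1 (2 * Real.pi) = circleMap (0 : ℂ) 1 0 := by
    simpa using periodic_circleMap (0 : ℂ) 1 0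
  simp only [a, h2, ofReal_zero, zero_mul, mul_zero, zero_add, add_eq_right] at h
  have : ((m : ℂ) - n) = 0 := by simpa [Real.pi_ne_zero] using h
  exact_mod_cast sub_eq_zero.mp this

end HasUnitWinding

/-- A continuous function can be perturbed, by an arbitrarily small amount on a given compact
set, so as to have no zeros on a given circle. -/
theorem exists_perturbation_ne_zero_on_sphere {g : ℂ → ℂ} (hg : Continuous g) {K : Set ℂ}
    (hK : IsCompact K) (c : ℂ) {r : ℝ} (hr : 0 ≤ r) {ε : ℝ} (hε : 0 < ε) :
    ∃ φ : ℂ → ℂ, Continuous φ ∧ (∀ x ∈ K, ‖φ x‖ < ε) ∧ ∀ x ∈ sphere c r, g x + φ x ≠ 0 := by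
  obtain ⟨δ, hδ, hδε⟩ := mem_uniformity_dist.mp
    (hK.uniformContinuousAt_of_continuousAt g (fun a _ ↦ hg.continuousAt)
      (dist_mem_uniformity (show 0 < ε / 2 by positivity)))
  obtain ⟨s, hs, hsg⟩ := hg.exists_contDiff_dist_le_of_forall_mem_ball_dist_le hδ
  have hsK : ∀ x ∈ K, dist (s x) (g x) ≤ ε / 2 := fun a ha ↦ hsg a _ fun x hx ↦ by
    rw [dist_comm]
    exact (hδε (a := a) (b := x) (by rwa [dist_comm]) ha).le
  have hγ : ContDiff ℝ 1 fun θ : ℝ ↦ s (circleMap c r θ) :=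
    (hs.of_le (by simp)).comp (contDiff_circleMap c r)
  have hd := hγ.dense_compl_range_of_finrank_lt_finrank (by simp)
  obtain ⟨v, hv, hvε⟩ := hd.exists_dist_lt 0 (show 0 < ε / 2 by positivity)
  refine ⟨fun x ↦ s x - v - g x, (hs.continuous.sub continuous_const).sub hg, fun x hx ↦ ?_,
    fun x hx h ↦ hv ?_⟩
  · have h1 := hsK x hx
    rw [dist_zero_left] at hvε
    rw [dist_eq_norm] at h1
    calc ‖s x - v - g x‖ = ‖(s x - g x) - v‖ := by ring_nf
      _ ≤ ‖s x - g x‖ + ‖v‖ := norm_sub_le _ _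
      _ < ε := by linarith
  · have : x ∈ range (circleMap c r) := by rwa [range_circleMap, abs_of_nonneg hr]
    obtain ⟨θ, rfl⟩ := this
    exact ⟨θ, by linear_combination h⟩

section PeriodicMap

variable {F : ℂ → ℂ} {p : ℕ}

theorem prod_range_iterate_apply (hper : ∀ x, F^[p] x = x) (g : ℂ → ℂ) (x : ℂ) :
    ∏ i ∈ Finset.range p, g (F^[i] (F x)) = ∏ i ∈ Finset.range p, g (F^[i] x) := by
  simp only [← Function.iterate_succ_apply]
  cases p with
  | zero => rfl
  | succ q =>
    rw [Finset.prod_range_succ, hper, Finset.prod_range_succ' (fun i ↦ g (F^[i] x))]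
    rfl

theorem sum_range_iterate_apply (hper : ∀ x, F^[p] x = x) (g : ℂ → ℂ) (x : ℂ) :
    ∑ i ∈ Finset.range p, g (F^[i] (F x)) = ∑ i ∈ Finset.range p, g (F^[i] x) := by
  simp only [← Function.iterate_succ_apply]
  cases p with
  | zero => rfl
  | succ q =>
    rw [Finset.sum_range_succ, hper, Finset.sum_range_succ' (fun i ↦ g (F^[i] x))]
    rfl

theorem apply_iterate_of_invariant {g : ℂ → ℂ} (hg : ∀ x, g (F x) = g x) (i : ℕ) (x : ℂ) :
    g (F^[i] x) = g x := by
  induction i generalizing x with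
  | zero => rfl
  | succ i ih => rw [Function.iterate_succ_apply, ih, hg]

theorem norm_iterate_le_one (hper : ∀ x, F^[p] x = x) (hp : p ≠ 0)
    (hout : ∀ x, 1 ≤ ‖x‖ → F x = x) {x : ℂ} (hx : ‖x‖ ≤ 1) (i : ℕ) : ‖F^[i] x‖ ≤ 1 := by
  have key : ∀ x, ‖x‖ ≤ 1 → ‖F x‖ ≤ 1 := fun x hx ↦ by
    by_contra! h
    have h1 : F^[p - 1] (F x) = F x := Function.iterate_fixed (hout _ h.le) _
    rw [← Function.iterate_succ_apply, Nat.succ_eq_add_one, Nat.sub_add_cancel (by omega),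
      hper] at h1
    rw [← h1] at h
    exact h.not_ge hx
  induction i with
  | zero => exact hx
  | succ i ih => rw [Function.iterate_succ_apply']; exact key _ ih

/-- The closed disc with centre `c` and radius `r` lies in the open unit disc and is disjoint
from its nontrivial translates under the cyclic group of order `p` generated by `F`. -/
structure IsWanderingDisc (F : ℂ → ℂ) (p : ℕ) (c : ℂ) (r : ℝ) : Prop where
  pos : 0 < r
  subset_ball : closedBall c r ⊆ ball 0 1
  notMem : ∀ i, 0 < i → i < p → ∀ x ∈ closedBall c r, F^[i] x ∉ closedBall c r

/-- The union of the translates of an open disc. -/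
def discOrbit (F : ℂ → ℂ) (c : ℂ) (r : ℝ) : Set ℂ := {x | ∃ i : ℕ, F^[i] x ∈ ball c r}

theorem isOpen_discOrbit (hF : Continuous F) (c : ℂ) (r : ℝ) : IsOpen (discOrbit F c r) := by
  simp only [discOrbit, ofPred_exists]
  exact isOpen_iUnion fun i ↦ isOpen_ball.preimage (hF.iterate i)

theorem exists_lt_iterate_mem_of_iterate_mem (hper : ∀ x, F^[p] x = x) (hp : p ≠ 0) {x : ℂ}
    {s : Set ℂ} {i : ℕ} (h : F^[i] x ∈ s) : ∃ j < p, F^[j] x ∈ s := by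
  refine ⟨i % p, Nat.mod_lt _ (Nat.pos_of_ne_zero hp), ?_⟩
  have : Function.IsPeriodicPt F p x := hper x
  rwa [this.iterate_mod_apply]

theorem exists_iterate_mem_sphere_of_mem_frontier (hF : Continuous F) (hper : ∀ x, F^[p] x = x)
    (hp : p ≠ 0) {c : ℂ} {r : ℝ} {x : ℂ} (hx : x ∈ frontier (discOrbit F c r)) :
    ∃ i < p, F^[i] x ∈ sphere c r := by
  rw [(isOpen_discOrbit hF c r).frontier_eq] at hx
  have hsub : discOrbit F c r ⊆ ⋃ i ∈ Finset.range p, F^[i] ⁻¹' closedBall c r := by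
    rintro y ⟨i, hi⟩
    obtain ⟨j, hj, h⟩ := exists_lt_iterate_mem_of_iterate_mem hper hp hi
    exact mem_biUnion (Finset.mem_coe.mpr (Finset.mem_range.mpr hj)) (ball_subset_closedBall h)
  have hcl : IsClosed (⋃ i ∈ Finset.range p, F^[i] ⁻¹' closedBall c r) :=
    isClosed_biUnion_finset fun i _ ↦ isClosed_closedBall.preimage (hF.iterate i)
  have := closure_minimal hsub hcl hx.1
  simp only [mem_iUnion, Finset.mem_range, mem_preimage] at this
  obtain ⟨i, hi, h⟩ := this
  exact ⟨i, hi, (mem_closedBall.mp h).antisymm (not_lt.mp fun h' ↦ hx.2 ⟨i, h'⟩)⟩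

namespace IsWanderingDisc

variable {c : ℂ} {r : ℝ}

theorem norm_lt_one_of_mem_discOrbit (hd : IsWanderingDisc F p c r)
    (hout : ∀ x, 1 ≤ ‖x‖ → F x = x) {x : ℂ} (hx : x ∈ discOrbit F c r) : ‖x‖ < 1 := by
  obtain ⟨i, hi⟩ := hx
  by_contra! h
  rw [Function.iterate_fixed (hout x h)] at hi
  have := hd.subset_ball (ball_subset_closedBall hi)
  rw [mem_ball_zero_iff] at this
  exact this.not_ge h

/-- A function prescribed on the boundary of a wandering disc extends to an invariant one. -/
theorem exists_invariant_extension (hd : IsWanderingDisc F p c r) (hF : Continuous F)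
    (hper : ∀ x, F^[p] x = x) (hp : p ≠ 0) {φ : ℂ → ℂ} (hφ : Continuous φ) :
    ∃ η : ℂ → ℂ, Continuous η ∧ (∀ x, η (F x) = η x) ∧ (∀ x ∈ sphere c r, η x = φ x) ∧
      ∀ x ε, (∀ i, ‖φ (F^[i] x)‖ ≤ ε) → ‖η x‖ ≤ p * ε := by
  have hcl : IsClosed (⋃ i ∈ Finset.Ioo 0 p, F^[i] '' closedBall c r) :=
    isClosed_biUnion_finset fun i _ ↦
      ((isCompact_closedBall c r).image (hF.iterate i)).isClosed
  have hdisj : Disjoint (⋃ i ∈ Finset.Ioo 0 p, F^[i] '' closedBall c r) (sphere c r) := by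
    rw [Set.disjoint_left]
    intro x hx hxs
    simp only [mem_iUnion, Finset.mem_Ioo] at hx
    obtain ⟨i, ⟨hi0, hip⟩, y, hy, rfl⟩ := hx
    exact hd.notMem i hi0 hip y hy (sphere_subset_closedBall hxs)
  obtain ⟨χ, hχ0, hχ1, hχ⟩ := exists_continuous_zero_one_of_isClosed hcl
    (isClosed_sphere (x := c) (ε := r)) hdisj
  refine ⟨fun x ↦ ∑ i ∈ Finset.range p, (χ (F^[i] x) : ℂ) * φ (F^[i] x), ?_,
    fun x ↦ sum_range_iterate_apply hper (fun x ↦ (χ x : ℂ) * φ x) x, fun x hx ↦ ?_,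
    fun x ε hε ↦ ?_⟩
  · refine continuous_finsetSum _ fun i _ ↦ ?_
    have := hF.iterate i
    fun_prop
  · obtain ⟨q, rfl⟩ := Nat.exists_eq_succ_of_ne_zero hp
    beta_reduce
    rw [Finset.sum_range_succ', Finset.sum_eq_zero]
    · simp [hχ1 hx]
    · intro i hi
      have : χ (F^[i + 1] x) = 0 := hχ0 <| by
        simp only [mem_iUnion, Finset.mem_Ioo]
        exact ⟨i + 1, ⟨by omega, by simpa using hi⟩, x, sphere_subset_closedBall hx, rfl⟩
      rw [this, ofReal_zero, zero_mul]
  · refine (norm_sum_le_of_le (n := fun _ ↦ ε) _ fun i _ ↦ ?_).trans (by simp)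
    rw [norm_mul, norm_real, Real.norm_of_nonneg (hχ _).1]
    exact (mul_le_of_le_one_left (norm_nonneg _) (hχ _).2).trans (hε i)

/-- Zeros of an invariant function in the orbit of a wandering disc can be divided out, at the
cost of changing the winding number by a multiple of `p`. -/
theorem exists_invariant_ne_zero (hd : IsWanderingDisc F p c r) (hF : Continuous F)
    (hper : ∀ x, F^[p] x = x) (hp : p ≠ 0) (hout : ∀ x, 1 ≤ ‖x‖ → F x = x)
    {h : ℂ → ℂ} (hh : Continuous h) (hinv : ∀ x, h (F x) = h x)
    (h0 : ∀ x ∈ sphere c r, h x ≠ 0) :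
    ∃ (g : ℂ → ℂ) (n : ℤ), Continuous g ∧ (∀ x, g (F x) = g x) ∧
      (∀ x, g x = 0 → x ∉ discOrbit F c r ∧ h x = 0) ∧
      ∀ m, HasUnitWinding g m → HasUnitWinding h (m + p * n) := by
  have hc : c ∈ ball c r := mem_ball_self hd.pos
  obtain ⟨n, ψ, hψ, hhψ⟩ := exists_eq_zpow_mul_exp_on_sphere hd.pos hh.continuousOn h0
  let H : ℂ → ℂ := fun x ↦ ∏ i ∈ Finset.range p, (F^[i] x - c)
  have hHc : Continuous H := continuous_finsetProd _ fun i _ ↦ (hF.iterate i).sub continuous_const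
  have hHinv : ∀ x, H (F x) = H x := prod_range_iterate_apply hper fun x ↦ x - c
  have hH0 : ∀ x, x ∉ discOrbit F c r → H x ≠ 0 := fun x hx ↦
    Finset.prod_ne_zero_iff.mpr fun i _ hi ↦ hx ⟨i, by rwa [sub_eq_zero.mp hi]⟩
  let R : ℂ → ℂ := fun x ↦ ∏ i ∈ Finset.range (p - 1), (F^[i + 1] x - c)
  have hRc : Continuous R :=
    continuous_finsetProd _ fun i _ ↦ (hF.iterate (i + 1)).sub continuous_const
  have hHR : ∀ x, H x = (x - c) * R x := fun x ↦ by
    obtain ⟨q, rfl⟩ := Nat.exists_eq_succ_of_ne_zero hp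
    simp only [H, R]
    rw [Finset.prod_range_succ', mul_comm]
    rfl
  have hR0 : ∀ x ∈ closedBall c r, R x ≠ 0 := fun x hx ↦
    Finset.prod_ne_zero_iff.mpr fun i hi h ↦ hd.notMem (i + 1) (by omega)
      (by have := Finset.mem_range.mp hi; omega) x hx
      (by rw [sub_eq_zero.mp h]; exact ball_subset_closedBall hc)
  obtain ⟨ρ, hρ, hRρ⟩ := exists_continuous_exp_eq_on_closedBall hRc c hd.pos hR0
  obtain ⟨η, hη, hηinv, hηeq, -⟩ := hd.exists_invariant_extension hF hper hp
    (φ := fun x ↦ ψ x - n * ρ x) (by fun_prop)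
  have hsphere : ∀ x ∈ sphere c r, exp (η x) = h x / H x ^ n := fun x hx ↦ by
    have hxc : x - c ≠ 0 := sub_ne_zero.mpr (ne_of_mem_sphere hx hd.pos.ne')
    rw [hηeq x hx, hHR, hhψ x hx, hRρ x (sphere_subset_closedBall hx), mul_zpow, ← exp_int_mul,
      exp_sub, mul_div_mul_left _ _ (zpow_ne_zero n hxc)]
  have hO : ∀ x, F x ∈ discOrbit F c r ↔ x ∈ discOrbit F c r := fun x ↦ by
    refine ⟨fun ⟨i, hi⟩ ↦ ⟨i + 1, hi⟩, fun ⟨i, hi⟩ ↦ ⟨i + (p - 1), ?_⟩⟩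
    rwa [← Function.iterate_succ_apply, Nat.succ_eq_add_one, add_assoc,
      Nat.sub_add_cancel (by omega), Function.iterate_add_apply, hper]
  classical
  let g : ℂ → ℂ := fun x ↦ if x ∈ discOrbit F c r then exp (η x) else h x / H x ^ n
  have hclosure : ∀ x ∈ closure {x | x ∉ discOrbit F c r}, H x ≠ 0 := fun x hx ↦
    hH0 x ((isOpen_discOrbit hF c r).isClosed_compl.closure_eq.subset hx)
  refine ⟨g, n, ?_, fun x ↦ ?_, fun x hx ↦ ?_, fun m hm ↦ ?_⟩
  · refine continuous_if (fun x hx ↦ ?_) (by fun_prop)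
      (hh.continuousOn.div (hHc.continuousOn.zpow₀ n fun x hx ↦ Or.inl (hclosure x hx))
        fun x hx ↦ zpow_ne_zero n (hclosure x hx))
    obtain ⟨i, -, hi⟩ := exists_iterate_mem_sphere_of_mem_frontier hF hper hp hx
    have := hsphere _ hi
    rwa [apply_iterate_of_invariant hηinv, apply_iterate_of_invariant hinv,
      apply_iterate_of_invariant hHinv] at this
  · simp only [g, hO, hηinv, hinv, hHinv]
  · by_cases hxO : x ∈ discOrbit F c r
    · simp [g, hxO] at hx
    · simp only [g, hxO, if_false, div_eq_zero_iff, zpow_ne_zero n (hH0 x hxO), or_false] at hx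
      exact ⟨hxO, hx⟩
  · have hHw : HasUnitWinding H p := by
      have hc1 : ‖c‖ < 1 := mem_ball_zero_iff.mp (hd.subset_ball (ball_subset_closedBall hc))
      have := (HasUnitWinding.sub_const hc1).zpow p
      rw [one_mul] at this
      refine this.congr fun x hx ↦ ?_
      have hx1 : 1 ≤ ‖x‖ := (mem_sphere_zero_iff_norm.mp hx).ge
      simp [H, Function.iterate_fixed (hout x hx1)]
    refine (hm.mul (hHw.zpow n)).congr fun x hx ↦ ?_
    have hxO : x ∉ discOrbit F c r := fun h ↦
      (hd.norm_lt_one_of_mem_discOrbit hout h).ne (mem_sphere_zero_iff_norm.mp hx)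
    simp only [g, hxO, if_false]
    rw [div_mul_cancel₀ _ (zpow_ne_zero n (hH0 x hxO))]

end IsWanderingDisc

/-- The winding number of an invariant function whose zeros are covered by orbits of wandering
discs is divisible by `p`. -/
theorem exists_hasUnitWinding_mul (hF : Continuous F) (hper : ∀ x, F^[p] x = x) (hp : p ≠ 0)
    (hout : ∀ x, 1 ≤ ‖x‖ → F x = x) (s : Finset (ℂ × ℝ))
    (hs : ∀ d ∈ s, IsWanderingDisc F p d.1 d.2) {h : ℂ → ℂ} (hh : Continuous h)
    (hinv : ∀ x, h (F x) = h x)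
    (hzero : ∀ x, ‖x‖ ≤ 1 → h x = 0 → ∃ d ∈ s, x ∈ discOrbit F d.1 d.2) :
    ∃ k : ℤ, HasUnitWinding h (p * k) := by
  classical
  induction s using Finset.induction_on generalizing h with
  | empty =>
    obtain ⟨φ, hφ, hx⟩ := exists_continuous_exp_eq_on_closedBall hh 0 one_pos fun x hx h0 ↦ by
      simpa using hzero x (mem_closedBall_zero_iff.mp hx) h0
    exact ⟨0, φ, hφ.continuousOn, fun x h ↦ by simp [hx x (sphere_subset_closedBall h)]⟩
  | insert d s hds ih =>
    have hd : IsWanderingDisc F p d.1 d.2 := hs d (Finset.mem_insert_self _ _)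
    let O : Set ℂ := ⋃ d' ∈ insert d s, discOrbit F d'.1 d'.2
    have hO : IsOpen O := isOpen_biUnion fun d' _ ↦ isOpen_discOrbit hF _ _
    have hmemO : ∀ x, x ∈ O ↔ ∃ d' ∈ insert d s, x ∈ discOrbit F d'.1 d'.2 := fun x ↦ by
      simp only [O, mem_iUnion, exists_prop]
    obtain ⟨δ, hδ, hδh⟩ : ∃ δ > 0, ∀ x ∈ closedBall (0 : ℂ) 1 \ O, δ ≤ ‖h x‖ := by
      have hK : IsCompact (closedBall (0 : ℂ) 1 \ O) := (isCompact_closedBall 0 1).diff hO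
      refine hK.exists_forall_le' hh.norm.continuousOn fun x hx ↦ norm_pos_iff.mpr fun h0 ↦ ?_
      exact hx.2 ((hmemO x).mpr (hzero x (mem_closedBall_zero_iff.mp hx.1) h0))
    have hp' : (0 : ℝ) < p := by positivity
    obtain ⟨φ, hφ, hφε, hφ0⟩ := exists_perturbation_ne_zero_on_sphere hh
      (isCompact_closedBall (0 : ℂ) 1) d.1 hd.pos.le
      (show 0 < δ / (2 * p) by positivity)
    obtain ⟨η, hη, hηinv, hηeq, hηle⟩ := hd.exists_invariant_extension hF hper hp hφ
    have hηδ : ∀ x, ‖x‖ ≤ 1 → ‖η x‖ < δ := fun x hx ↦ by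
      have := hηle x _ fun i ↦ (hφε _ (mem_closedBall_zero_iff.mpr
        (norm_iterate_le_one hper hp hout hx i))).le
      have h2 : p * (δ / (2 * p)) = δ / 2 := by field_simp
      rw [h2] at this
      linarith
    obtain ⟨g, n, hg, hginv, hg0, hgw⟩ := hd.exists_invariant_ne_zero hF hper hp hout
      (h := fun x ↦ h x + η x) (hh.add hη) (fun x ↦ by rw [hinv, hηinv]) fun x hx ↦ by
        rw [hηeq x hx]; exact hφ0 x hx
    obtain ⟨k, hk⟩ := ih (fun d' hd' ↦ hs d' (Finset.mem_insert_of_mem hd')) hg hginv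
      fun x hx hgx ↦ by
        obtain ⟨hxd, hx0⟩ := hg0 x hgx
        have hxO : x ∈ O := by
          by_contra hxO
          have h1 := hδh x ⟨mem_closedBall_zero_iff.mpr hx, hxO⟩
          have h2 := hηδ x hx
          rw [eq_neg_of_add_eq_zero_left hx0, norm_neg] at h1
          exact h2.not_ge h1
        obtain ⟨d', hd', hxd'⟩ := (hmemO x).mp hxO
        rcases Finset.mem_insert.mp hd' with rfl | hd'
        · exact absurd hxd' hxd
        · exact ⟨d', hd', hxd'⟩
    have hsO : ∀ x ∈ sphere (0 : ℂ) 1, δ ≤ ‖h x‖ ∧ ‖η x‖ < δ := fun x hx ↦ by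
      have hx1 := mem_sphere_zero_iff_norm.mp hx
      refine ⟨hδh x ⟨sphere_subset_closedBall hx, fun hxO ↦ ?_⟩, hηδ x hx1.le⟩
      obtain ⟨d', hd', hxd'⟩ := (hmemO x).mp hxO
      exact ((hs d' hd').norm_lt_one_of_mem_discOrbit hout hxd').ne hx1
    have hh0 : ∀ x ∈ sphere (0 : ℂ) 1, h x ≠ 0 := fun x hx ↦
      norm_pos_iff.mp (hδ.trans_le (hsO x hx).1)
    have hu : HasUnitWinding (fun x ↦ 1 + η x / h x) 0 := by
      refine .of_norm_sub_one_lt (continuousOn_const.add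
        (hη.continuousOn.div hh.continuousOn hh0)) fun x hx ↦ ?_
      rw [add_sub_cancel_left, norm_div, div_lt_one (norm_pos_iff.mpr (hh0 x hx))]
      exact (hsO x hx).2.trans_le (hsO x hx).1
    refine ⟨k + n, ?_⟩
    have := (hgw _ hk).mul (hu.zpow (-1))
    rw [zero_mul, add_zero, ← mul_add] at this
    refine this.congr fun x hx ↦ ?_
    have h1 := hh0 x hx
    have h2 : h x + η x ≠ 0 := fun h0 ↦ by
      have h3 := hsO x hx
      rw [eq_neg_of_add_eq_zero_left h0, norm_neg] at h3
      exact h3.2.not_ge h3.1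
    rw [zpow_neg_one]
    field_simp

theorem exists_isWanderingDisc (hF : Continuous F) (hper : ∀ x, F^[p] x = x) (hp : p.Prime)
    {x : ℂ} (hx : ‖x‖ < 1) (hFx : F x ≠ x) : ∃ r, IsWanderingDisc F p x r := by
  have hev : ∀ i ∈ Finset.Ioo 0 p, ∀ᶠ r in 𝓝[>] (0 : ℝ),
      ∀ z ∈ closedBall x r, F^[i] z ∉ closedBall x r := fun i hi ↦ by
    obtain ⟨hi0, hip⟩ := Finset.mem_Ioo.mp hi
    have hne : F^[i] x ≠ x := fun h ↦ by
      have h1 : Function.IsPeriodicPt F (i.gcd p) x :=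
        Function.IsPeriodicPt.gcd h (hper x)
      rw [((hp.coprime_iff_not_dvd.mpr (Nat.not_dvd_of_pos_of_lt hi0 hip)).symm).gcd_eq_one] at h1
      exact hFx h1
    obtain ⟨ε, hε, hεs⟩ := Metric.eventually_nhds_iff.mp
      ((((hF.iterate i).dist continuous_const).continuousAt (x := x)).eventually
        (lt_mem_nhds (half_lt_self (dist_pos.mpr hne))))
    filter_upwards [Ioo_mem_nhdsGT (lt_min hε (half_pos (dist_pos.mpr hne)))] with r hr z hz hz'
    have h1 := hεs ((mem_closedBall.mp hz).trans_lt (hr.2.trans_le (min_le_left _ _)))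
    have h2 := hr.2.trans_le (min_le_right _ _)
    rw [mem_closedBall] at hz'
    linarith
  have h1 := (Finset.eventually_all (Finset.Ioo 0 p)).mpr hev
  obtain ⟨r, hr, hr1, hr0⟩ := (h1.and ((Ioo_mem_nhdsGT (sub_pos.mpr hx) :
    ∀ᶠ r in 𝓝[>] (0 : ℝ), r ∈ Ioo 0 (1 - ‖x‖)))).exists
  refine ⟨r, hr1, fun z hz ↦ ?_, fun i hi0 hip ↦ hr i (Finset.mem_Ioo.mpr ⟨hi0, hip⟩)⟩
  rw [mem_ball_zero_iff]
  rw [mem_closedBall, dist_eq_norm] at hz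
  have := norm_le_norm_add_norm_sub' z x
  linarith

theorem eq_self_of_prime_period (hF : Continuous F) (hper : ∀ x, F^[p] x = x) (hp : p.Prime)
    (hout : ∀ x, 1 ≤ ‖x‖ → F x = x) (y : ℂ) : F y = y := by
  by_contra hy
  have hy1 : ‖y‖ < 1 := by
    by_contra! h
    exact hy (hout y h)
  have hp0 : (p : ℂ) ≠ 0 := Nat.cast_ne_zero.mpr hp.ne_zero
  let h : ℂ → ℂ := fun x ↦ ∑ i ∈ Finset.range p, (F^[i] x - y)
  have hh : Continuous h := continuous_finsetSum _ fun i _ ↦ (hF.iterate i).sub continuous_const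
  have hinv : ∀ x, h (F x) = h x := sum_range_iterate_apply hper fun x ↦ x - y
  have hfix : ∀ x, F x = x → h x = p * (x - y) := fun x hx ↦ by
    simp [h, Function.iterate_fixed hx, mul_sub]
  have hmove : ∀ x, h x = 0 → F x ≠ x := fun x h0 hx ↦ by
    rw [hfix x hx] at h0
    have : x = y := sub_eq_zero.mp ((mul_eq_zero.mp h0).resolve_left hp0)
    exact hy (this ▸ hx)
  have hdisc : ∀ x, h x = 0 → ∃ r, IsWanderingDisc F p x r := fun x h0 ↦
    exists_isWanderingDisc hF hper hp
      (lt_of_not_ge fun h1 ↦ hmove x h0 (hout x h1)) (hmove x h0)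
  choose! r hr using hdisc
  have hK : IsCompact (closedBall (0 : ℂ) 1 ∩ h ⁻¹' {0}) :=
    (isCompact_closedBall 0 1).inter_right (isClosed_singleton.preimage hh)
  obtain ⟨t, htK, ht⟩ := hK.elim_nhds_subcover (fun x ↦ ball x (r x)) fun x hx ↦
    ball_mem_nhds x (hr x hx.2).pos
  classical
  obtain ⟨k, hk⟩ := exists_hasUnitWinding_mul hF hper hp.ne_zero hout
    (t.image fun x ↦ (x, r x)) (fun d hd ↦ by
      obtain ⟨x, hx, rfl⟩ := Finset.mem_image.mp hd
      exact hr x (htK x hx).2) hh hinv fun x hx h0 ↦ by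
      obtain ⟨z, hz, hxz⟩ := mem_iUnion₂.mp (ht ⟨mem_closedBall_zero_iff.mpr hx, h0⟩)
      exact ⟨(z, r z), Finset.mem_image_of_mem _ hz, 0, hxz⟩
  have hone : HasUnitWinding h (0 + 1) :=
    ((HasUnitWinding.const hp0).mul (.sub_const hy1)).congr fun x hx ↦
      hfix x (hout x (mem_sphere_zero_iff_norm.mp hx).ge)
  have hdvd : (p : ℤ) ∣ 1 := ⟨k, by simpa using hone.unique hk⟩
  exact hp.one_lt.ne' (by exact_mod_cast Int.eq_one_of_dvd_one (by positivity) hdvd)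

end PeriodicMap

theorem eq_self_of_iterate_eq_self {n : ℕ} (hn : n ≠ 0) {F : ℂ → ℂ} (hF : Continuous F)
    (hper : ∀ x, F^[n] x = x) (hout : ∀ x, 1 ≤ ‖x‖ → F x = x) (y : ℂ) : F y = y := by
  induction n using Nat.strong_induction_on generalizing y with
  | _ n ih =>
    rcases eq_or_ne n 1 with rfl | h1
    · exact hper y
    obtain ⟨p, hp, m, rfl⟩ := Nat.exists_prime_and_dvd h1
    have hm : m ≠ 0 := right_ne_zero_of_mul hn
    refine ih m (lt_mul_of_one_lt_left (Nat.pos_of_ne_zero hm) hp.one_lt) hm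
      (eq_self_of_prime_period (hF.iterate m) (fun x ↦ ?_) hp
        fun x hx ↦ Function.iterate_fixed (hout x hx) m) y
    rw [← Function.iterate_mul, mul_comm, hper]

/-- Kerékjártó. A periodic homeomorphism of the closed 2-disk that is
the identity on the boundary circle is the identity. In particular, the group of
homeomorphisms of the disk fixing the boundary pointwise is torsion-free. -/
theorem kerekjarto_periodic_disk_homeo_fixing_boundary_is_id
    (f : UnitDisk ≃ₜ UnitDisk)
    (hbd : ∀ x : UnitDisk, ‖(x : EuclideanSpace ℝ (Fin 2))‖ = 1 → f x = x)
    (n : ℕ) (hn : 1 ≤ n) (hper : ∀ x : UnitDisk, (⇑f)^[n] x = x) :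
    ∀ x : UnitDisk, f x = x := by
  let e : ℂ ≃ₗᵢ[ℝ] EuclideanSpace ℝ (Fin 2) := orthonormalBasisOneI.repr
  have he : ∀ z : ℂ, ‖z‖ ≤ 1 → e z ∈ UnitDisk := fun z hz ↦ by simpa using hz
  have hmem : ∀ x : UnitDisk, ‖e.symm x‖ ≤ 1 := fun x ↦ by
    simpa only [e.symm.norm_map] using mem_closedBall_zero_iff.mp x.2
  classical
  let F : ℂ → ℂ := fun z ↦ if hz : ‖z‖ ≤ 1 then e.symm (f ⟨e z, he z hz⟩) else z
  have hFe : ∀ x : UnitDisk, F (e.symm x) = e.symm (f x) := fun x ↦ by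
    simp only [F, hmem x, dite_true, e.apply_symm_apply]
  have hiter : ∀ (i : ℕ) (x : UnitDisk), F^[i] (e.symm x) = e.symm (f^[i] x) := fun i x ↦ by
    induction i generalizing x with
    | zero => rfl
    | succ i ih => rw [Function.iterate_succ_apply, hFe, ih, Function.iterate_succ_apply]
  have hout : ∀ z, 1 ≤ ‖z‖ → F z = z := fun z hz ↦ by
    rcases hz.eq_or_lt with h | h
    · simp only [F, h.ge, dite_true]
      rw [hbd ⟨e z, he z h.ge⟩ (by simp [h])]
      simp
    · simp [F, h.not_ge]
  have hFc : Continuous F := by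
    have hunion : closedBall (0 : ℂ) 1 ∪ (ball (0 : ℂ) 1)ᶜ = univ :=
      eq_univ_of_forall fun z ↦ (le_or_gt ‖z‖ 1).imp (by simp) fun h ↦ by simpa using h.le
    rw [← continuousOn_univ, ← hunion]
    refine ContinuousOn.union_of_isClosed ?_ ?_ isClosed_closedBall isOpen_ball.isClosed_compl
    · rw [continuousOn_iff_continuous_domRestrict]
      have : Continuous fun z : closedBall (0 : ℂ) 1 ↦
          e.symm (f ⟨e z, he z (mem_closedBall_zero_iff.mp z.2)⟩) := by fun_prop
      refine this.congr fun z ↦ ?_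
      simp [F, mem_closedBall_zero_iff.mp z.2]
    · exact continuousOn_id.congr fun z hz ↦ hout z (by simpa using hz)
  have hFper : ∀ z, F^[n] z = z := fun z ↦ by
    rcases le_or_gt ‖z‖ 1 with h | h
    · simpa [hper] using hiter n ⟨e z, he z h⟩
    · exact Function.iterate_fixed (hout z h.le) n
  intro x
  have := eq_self_of_iterate_eq_self (by omega) hFc hFper hout (e.symm x)
  rw [hFe] at this
  exact Subtype.ext (e.symm.injective this)
end

section
/- (Linnell.) For any group G, the collection of positive cones of left orders on G, viewed as a set of subsets of G, is either finite or uncountable; it is never countably infinite. Equivalently, the space of left orders of a left-orderable group is finite or uncountable. -/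
/-- A positive cone on a group `G`: a subset closed under multiplication such that `G` is
the disjoint union of `P`, `P⁻¹` and `{1}`. Positive cones correspond to left-invariant
strict total orders via `g ≻ 1 ↔ g ∈ P`. -/
def IsPositiveCone {G : Type*} [Group G] (P : Set G) : Prop :=
  (∀ p ∈ P, ∀ q ∈ P, p * q ∈ P) ∧
  (∀ g : G, g ∈ P ∨ g⁻¹ ∈ P ∨ g = 1) ∧
  (∀ g : G, g ∈ P → g⁻¹ ∉ P) ∧
  (1 : G) ∉ P

open scoped commutatorElement

/-- A real-valued function on a group that turns products into sums. -/
def IsAdditive {G : Type*} [Group G] (ψ : G → ℝ) : Prop :=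
  ∀ x y, ψ (x * y) = ψ x + ψ y

namespace IsAdditive

variable {G : Type*} [Group G] {ψ : G → ℝ}

/-- The homomorphism given by an additive function. -/
def toMonoidHom (h : IsAdditive ψ) : G →* Multiplicative ℝ :=
  MonoidHom.mk' (fun x => Multiplicative.ofAdd (ψ x)) fun x y => by rw [h, ofAdd_add]

theorem map_one (h : IsAdditive ψ) : ψ 1 = 0 := by
  have := h 1 1
  rw [mul_one] at this
  linarith

theorem map_inv (h : IsAdditive ψ) (x : G) : ψ x⁻¹ = -ψ x := by
  have := h x x⁻¹
  rw [mul_inv_cancel, h.map_one] at this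
  linarith

theorem map_zpow (h : IsAdditive ψ) (x : G) (n : ℤ) : ψ (x ^ n) = n * ψ x := by
  have := congrArg Multiplicative.toAdd (_root_.map_zpow h.toMonoidHom x n)
  rw [toAdd_zpow, zsmul_eq_mul] at this
  exact this

theorem map_pow (h : IsAdditive ψ) (x : G) (n : ℕ) : ψ (x ^ n) = n * ψ x := by
  have := h.map_zpow x n
  rwa [zpow_natCast, Int.cast_natCast] at this

theorem map_conj (h : IsAdditive ψ) (x y : G) : ψ (x * y * x⁻¹) = ψ y := by
  rw [h, h, h.map_inv]
  ring

theorem map_commutatorElement (h : IsAdditive ψ) (x y : G) : ψ ⁅x, y⁆ = 0 := by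
  rw [commutatorElement_def, h, h.map_conj, h.map_inv]
  ring

/-- The kernel of an additive function. -/
def ker (h : IsAdditive ψ) : Subgroup G := h.toMonoidHom.ker

theorem mem_ker (h : IsAdditive ψ) {x : G} : x ∈ h.ker ↔ ψ x = 0 := Iff.rfl

instance normal_ker (h : IsAdditive ψ) : h.ker.Normal :=
  inferInstanceAs h.toMonoidHom.ker.Normal

/-- An additive function on a subgroup that vanishes on commutators of the whole group extends to
the whole group. -/
theorem exists_extension {N : Subgroup G} {φ : N → ℝ} (hφ : IsAdditive φ)
    (h : ∀ n : N, (n : G) ∈ commutator G → φ n = 0) :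
    ∃ Φ : G → ℝ, IsAdditive Φ ∧ ∀ n : N, Φ n = φ n := by
  let f : N →* Abelianization G := Abelianization.of.comp N.subtype
  have hf : Function.Surjective f.rangeRestrict := f.rangeRestrict_surjective
  have hker : f.rangeRestrict.ker ≤ hφ.toMonoidHom.ker := by
    intro n hn
    rw [MonoidHom.ker_rangeRestrict, MonoidHom.mem_ker] at hn
    refine h n ?_
    rw [← Abelianization.ker_of]
    exact hn
  let g : f.range →* Multiplicative ℝ :=
    f.rangeRestrict.liftOfSurjective hf ⟨hφ.toMonoidHom, hker⟩
  have hg : ∀ n, g (f.rangeRestrict n) = hφ.toMonoidHom n := fun n =>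
    f.rangeRestrict.liftOfRightInverse_comp_apply _ (Function.rightInverse_surjInv hf)
      ⟨hφ.toMonoidHom, hker⟩ n
  obtain ⟨k, hk⟩ := (Module.Baer.of_divisible ℝ).extension_property_addMonoidHom
    (MonoidHom.toAdditive f.range.subtype) f.range.subtype_injective
    (MonoidHom.toAdditiveLeft g)
  refine ⟨fun x => k (Additive.ofMul (Abelianization.of x)), fun x y => ?_, fun n => ?_⟩
  · change k (Additive.ofMul (Abelianization.of (x * y))) = _
    rw [_root_.map_mul, ofMul_mul, map_add]
  · have h1 := DFunLike.congr_fun hk (Additive.ofMul (f.rangeRestrict n))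
    exact h1.trans (congrArg Multiplicative.toAdd (hg n))

/-- A nonzero additive function whose values are pairwise commensurable. -/
def IsRankOne (ψ : G → ℝ) : Prop :=
  (∃ x, ψ x ≠ 0) ∧ ∀ x y, ψ y ≠ 0 → ∃ i j : ℤ, i ≠ 0 ∧ i * ψ x = j * ψ y

end IsAdditive

/-- The commutator of two elements, as an element of a subgroup containing all commutators. -/
def commutatorIn {G : Type*} [Group G] {N : Subgroup G} (hN : ∀ x y : G, ⁅x, y⁆ ∈ N) (x y : G) :
    N :=
  ⟨⁅x, y⁆, hN x y⟩

section Commutator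

variable {G : Type*} [Group G] {N : Subgroup G} (hN : ∀ x y : G, ⁅x, y⁆ ∈ N)

theorem commutatorIn_mul_left [N.Normal] (x y z : G) :
    commutatorIn hN (x * y) z =
      MulAut.conjNormal x (commutatorIn hN y z) * commutatorIn hN x z := by
  ext
  simp only [commutatorIn, Subgroup.coe_mul, MulAut.conjNormal_apply, commutatorElement_def]
  group

theorem commutatorIn_coe_left [N.Normal] (n : N) (z : G) :
    commutatorIn hN n z = n * MulAut.conjNormal z n⁻¹ := by
  ext
  simp only [commutatorIn, Subgroup.coe_mul, MulAut.conjNormal_apply, commutatorElement_def,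
    Subgroup.coe_inv]
  group

theorem commutatorIn_inv (x y : G) : (commutatorIn hN x y)⁻¹ = commutatorIn hN y x :=
  Subtype.ext (commutatorElement_inv x y)

theorem commutatorIn_self (x : G) : commutatorIn hN x x = 1 :=
  Subtype.ext (commutatorElement_self x)

end Commutator

theorem exists_int_mul_add_mul_neg {a b c : ℝ} (hc : c ≠ 0) (h : |c| < |a - b|) :
    ∃ p : ℤ, (p * c + a) * (p * c + b) < 0 := by
  wlog hc0 : 0 < c generalizing c
  · obtain ⟨p, hp⟩ := this (c := -c) (neg_ne_zero.2 hc) (by rwa [abs_neg])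
      (by rcases lt_or_gt_of_ne hc with h' | h' <;> [linarith; exact absurd h' hc0])
    exact ⟨-p, by push_cast; linarith⟩
  wlog hab : a < b generalizing a b
  · obtain ⟨p, hp⟩ := this (a := b) (b := a) (by rwa [abs_sub_comm]) (by
      rcases lt_trichotomy a b with h' | h' | h'
      · exact absurd h' hab
      · rw [h', sub_self, abs_zero] at h
        exact absurd h (not_lt.2 (abs_nonneg _))
      · exact h')
    exact ⟨p, by linarith⟩
  rw [abs_of_pos hc0, abs_of_neg (by linarith)] at h
  refine ⟨⌈-a / c⌉ - 1, ?_⟩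
  have h1 := Int.ceil_lt_add_one (-a / c)
  have h2 := Int.le_ceil (-a / c)
  have h3 : ((⌈-a / c⌉ : ℝ) - 1) * c < -a := by
    rw [← lt_div_iff₀ hc0]
    linarith
  have h4 : -a ≤ (⌈-a / c⌉ : ℝ) * c := by
    rwa [← div_le_iff₀ hc0]
  push_cast
  exact mul_neg_of_neg_of_pos (by linarith) (by linarith)

namespace IsPositiveCone

section Basic

variable {G : Type*} [Group G] {P : Set G}

protected theorem mul_mem (hP : IsPositiveCone P) {x y : G} (hx : x ∈ P) (hy : y ∈ P) : x * y ∈ P :=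
  hP.1 x hx y hy

theorem one_notMem (hP : IsPositiveCone P) : (1 : G) ∉ P := hP.2.2.2

theorem inv_notMem (hP : IsPositiveCone P) {x : G} (hx : x ∈ P) : x⁻¹ ∉ P := hP.2.2.1 x hx

theorem ne_one (hP : IsPositiveCone P) {x : G} (hx : x ∈ P) : x ≠ 1 :=
  fun h => hP.one_notMem (h ▸ hx)

theorem mem_or_inv_mem (hP : IsPositiveCone P) {x : G} (hx : x ≠ 1) : x ∈ P ∨ x⁻¹ ∈ P := by
  rcases hP.2.1 x with h | h | h
  · exact .inl h
  · exact .inr h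
  · exact absurd h hx

theorem inv_mem_of_notMem (hP : IsPositiveCone P) {x : G} (hx : x ≠ 1) (h : x ∉ P) : x⁻¹ ∈ P :=
  (hP.mem_or_inv_mem hx).resolve_left h

protected theorem pow_mem (hP : IsPositiveCone P) {x : G} (hx : x ∈ P) {n : ℕ} (hn : n ≠ 0) :
    x ^ n ∈ P := by
  induction n with
  | zero => exact absurd rfl hn
  | succ n ih =>
    rcases Nat.eq_zero_or_pos n with rfl | h
    · simpa using hx
    · rw [pow_succ]
      exact hP.mul_mem (ih h.ne') hx

theorem mem_of_pow_mem (hP : IsPositiveCone P) {x : G} {n : ℕ} (h : x ^ n ∈ P) : x ∈ P := by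
  by_contra hx
  have hn : n ≠ 0 := by
    rintro rfl
    exact hP.one_notMem (by simpa using h)
  have hx1 : x ≠ 1 := by
    rintro rfl
    exact hP.one_notMem (by simpa using h)
  have := hP.pow_mem (hP.inv_mem_of_notMem hx1 hx) hn
  rw [inv_pow] at this
  exact hP.inv_notMem h this

theorem eq_of_subset (hP : IsPositiveCone P) {Q : Set G} (hQ : IsPositiveCone Q) (h : P ⊆ Q) :
    P = Q := by
  refine h.antisymm fun x hx => ?_
  by_contra hxP
  exact hQ.inv_notMem hx (h (hP.inv_mem_of_notMem (hQ.ne_one hx) hxP))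

protected theorem comap {H : Type*} [Group H] {f : H →* G} (hf : Function.Injective f)
    (hP : IsPositiveCone P) : IsPositiveCone (f ⁻¹' P) := by
  refine ⟨fun p hp q hq => ?_, fun g => ?_, fun g hg hg' => ?_, ?_⟩
  · simpa using hP.mul_mem hp hq
  · rcases hP.2.1 (f g) with h | h | h
    · exact .inl h
    · exact .inr (.inl (by simpa using h))
    · exact .inr (.inr (hf (by simpa using h)))
  · exact hP.inv_notMem hg (by simpa using hg')
  · simpa using hP.one_notMem

/-- A positive cocycle defines a left preorder, which a left order refines lexicographically. -/
theorem lex (hP : IsPositiveCone P) {l a : G → ℝ} (hl : ∀ g, 0 < l g)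
    (ha : ∀ g h, a (g * h) = a g + l g * a h) :
    IsPositiveCone {g | 0 < a g ∨ a g = 0 ∧ g ∈ P} := by
  have ha1 : a 1 = 0 := by
    have := ha 1 1
    rw [mul_one] at this
    have h : l 1 * a 1 = 0 := by linarith
    exact (mul_eq_zero.1 h).resolve_left (hl 1).ne'
  have hinv : ∀ g, a g = -(l g * a g⁻¹) := fun g => by
    have := ha g g⁻¹
    rw [mul_inv_cancel, ha1] at this
    linarith
  refine ⟨?_, fun g => ?_, ?_, ?_⟩
  · rintro p (hp | ⟨hp, hpP⟩) q (hq | ⟨hq, hqP⟩)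
    · left
      rw [ha]
      have := mul_pos (hl p) hq
      linarith
    · left
      rw [ha, hq]
      linarith
    · left
      rw [ha, hp]
      have := mul_pos (hl p) hq
      linarith
    · right
      exact ⟨by rw [ha, hp, hq]; simp, hP.mul_mem hpP hqP⟩
  · rcases lt_trichotomy (a g) 0 with h | h | h
    · right; left; left
      rw [hinv g] at h
      by_contra h'
      have := mul_nonneg (hl g).le (neg_nonneg.2 (not_lt.1 h'))
      linarith
    · have h' : a g⁻¹ = 0 := by
        have := hinv g
        rw [h, eq_comm, neg_eq_zero] at this
        exact (mul_eq_zero.1 this).resolve_left (hl g).ne'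
      rcases hP.2.1 g with hg | hg | hg
      · exact .inl (.inr ⟨h, hg⟩)
      · exact .inr (.inl (.inr ⟨h', hg⟩))
      · exact .inr (.inr hg)
    · exact .inl (.inl h)
  · rintro g (hg | ⟨hg, hgP⟩) (hg' | ⟨hg', hgP'⟩)
    · have := mul_pos (hl g) hg'
      linarith [hinv g]
    · have := hinv g
      rw [hg'] at this
      linarith
    · have := mul_pos (hl g) hg'
      linarith [hinv g]
    · exact hP.inv_notMem hgP hgP'
  · simp [ha1, hP.one_notMem]

/-- A family of positive cocycles indexed by the reals, any two of which have opposite signs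
somewhere, gives uncountably many left orders. -/
theorem not_countable_of_cocycles (hP : IsPositiveCone P) {l : G → ℝ} {a : ℝ → G → ℝ}
    (hl : ∀ g, 0 < l g) (ha : ∀ t g h, a t (g * h) = a t g + l g * a t h)
    (hsep : ∀ s t, s < t → ∃ g, a s g * a t g < 0) :
    ¬ {Q : Set G | IsPositiveCone Q}.Countable := by
  intro hc
  let F : ℝ → Set G := fun t => {g | 0 < a t g ∨ a t g = 0 ∧ g ∈ P}
  have hlt : ∀ s t, s < t → F s ≠ F t := by
    intro s t hst h
    obtain ⟨g, hg⟩ := hsep s t hst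
    have h' : g ∈ F s ↔ g ∈ F t := by rw [h]
    rcases mul_neg_iff.1 hg with ⟨h1, h2⟩ | ⟨h1, h2⟩
    · rcases h'.1 (.inl h1) with h3 | ⟨h3, -⟩ <;> linarith
    · rcases h'.2 (.inl h2) with h3 | ⟨h3, -⟩ <;> linarith
  have hinj : Function.Injective F := fun s t h => by
    rcases lt_trichotomy s t with h' | h' | h'
    · exact absurd h (hlt s t h')
    · exact h'
    · exact absurd h.symm (hlt t s h')
  have : (Set.univ : Set ℝ).Countable :=
    Set.MapsTo.countable_of_injOn (f := F) (fun t _ => hP.lex hl (ha t)) hinj.injOn hc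
  exact Set.not_countable_univ this

end Basic

section Uncountable

variable {G : Type*} [Group G] {P : Set G}

theorem not_countable_of_pencil (hP : IsPositiveCone P) {φ ψ : G → ℝ} (hφ : IsAdditive φ)
    (hψ : IsAdditive ψ) {n c : G} (hn : ψ n = 0) (hn' : φ n ≠ 0) (hc : ψ c ≠ 0) :
    ¬ {Q : Set G | IsPositiveCone Q}.Countable := by
  refine hP.not_countable_of_cocycles (l := fun _ => 1) (a := fun t g => φ g + t * ψ g)
    (fun _ => one_pos) (fun t g h => ?_) (fun s t hst => ?_)
  · rw [hφ, hψ]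
    ring
  · have hpos : 0 < |(s - t) * ψ c| := abs_pos.2 (mul_ne_zero (by linarith) hc)
    obtain ⟨q, hq⟩ := exists_nat_gt (|φ n| / |(s - t) * ψ c|)
    rw [div_lt_iff₀ hpos] at hq
    obtain ⟨p, hp⟩ := exists_int_mul_add_mul_neg (a := q * (φ c + s * ψ c))
      (b := q * (φ c + t * ψ c)) hn' (by
        have : q * (φ c + s * ψ c) - q * (φ c + t * ψ c) = q * ((s - t) * ψ c) := by ring
        rwa [this, abs_mul, Nat.abs_cast])
    refine ⟨n ^ p * c ^ q, ?_⟩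
    simp only [hφ _ _, hψ _ _, hφ.map_zpow, hψ.map_zpow, hφ.map_pow, hψ.map_pow, hn]
    convert hp using 1
    ring

theorem not_countable_of_scaling (hP : IsPositiveCone P) {N : Subgroup G} [N.Normal]
    (hN : ∀ x y : G, ⁅x, y⁆ ∈ N) {φ : N → ℝ} (hφ : IsAdditive φ) {l : G → ℝ}
    (hl : ∀ g, 0 < l g) (hconj : ∀ g n, φ (MulAut.conjNormal g n) = l g * φ n) {n : N}
    (hn : φ n ≠ 0) {t : G} (ht : l t ≠ 1) :
    ¬ {Q : Set G | IsPositiveCone Q}.Countable := by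
  have hlmul : ∀ g h, l (g * h) = l g * l h := fun g h => by
    have := hconj (g * h) n
    rw [map_mul, MulAut.mul_apply, hconj, hconj, ← mul_assoc] at this
    exact (mul_right_cancel₀ hn this).symm
  have hl1 : l 1 = 1 := by
    have := hlmul 1 1
    rw [mul_one] at this
    exact (mul_left_cancel₀ (hl 1).ne' (by linarith)).symm
  have hlinv : ∀ g, l g * l g⁻¹ = 1 := fun g => by rw [← hlmul, mul_inv_cancel, hl1]
  wlog ht1 : l t < 1 generalizing t
  · have h1 : 1 < l t := lt_of_le_of_ne (not_lt.1 ht1) ht.symm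
    have h2 : l t⁻¹ < 1 := by
      by_contra h
      have h3 := hlinv t
      nlinarith [not_lt.1 h]
    exact this h2.ne h2
  have ht0 : 1 - l t ≠ 0 := by linarith
  have hlpow : ∀ k : ℕ, l (t ^ k) = l t ^ k := fun k => by
    induction k with
    | zero => simp [hl1]
    | succ k ih => rw [pow_succ, pow_succ, hlmul, ih]
  set f : G → ℝ := fun g => φ (commutatorIn hN g t) / (1 - l t) with hf
  have hfmul : ∀ g h, f (g * h) = f g + l g * f h := fun g h => by
    simp only [hf]
    rw [commutatorIn_mul_left, hφ, hconj]
    ring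
  have hfN : ∀ m : N, f m = φ m := fun m => by
    simp only [hf]
    rw [commutatorIn_coe_left, hφ, hconj, hφ.map_inv]
    field_simp
    ring
  have hft : f t = 0 := by
    simp only [hf]
    rw [commutatorIn_self, hφ.map_one, zero_div]
  have hlN : ∀ m : N, l m = 1 := fun m => by
    have h1 := hconj m n
    have h2 : MulAut.conjNormal (m : G) n = m * n * m⁻¹ := by
      ext
      simp
    rw [h2, hφ.map_conj] at h1
    exact (mul_right_cancel₀ hn (by linarith)).symm
  refine hP.not_countable_of_cocycles (l := l) (a := fun x g => (l g - 1) * x + f g) hl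
    (fun x g h => ?_) (fun x y hxy => ?_)
  · rw [hfmul, hlmul]
    ring
  · obtain ⟨k, hk⟩ := exists_pow_lt_of_lt_one (div_pos (sub_pos.2 hxy) (abs_pos.2 hn)) ht1
    rw [lt_div_iff₀ (abs_pos.2 hn)] at hk
    obtain ⟨p, hp⟩ := exists_int_mul_add_mul_neg (a := -x) (b := -y) (c := l t ^ k * φ n)
      (mul_ne_zero (pow_pos (hl t) k).ne' hn) (by
        rw [abs_mul, abs_of_pos (pow_pos (hl t) k), neg_sub_neg,
          abs_of_pos (sub_pos.2 hxy)]
        exact hk)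
    set m : N := MulAut.conjNormal (t ^ k) n ^ p with hm
    have hφm : φ m = p * (l t ^ k * φ n) := by rw [hm, hφ.map_zpow, hconj, hlpow]
    refine ⟨m * t * (m⁻¹ : N), ?_⟩
    have h1 : l (m * t * (m⁻¹ : N)) = l t := by rw [hlmul, hlmul, hlN, hlN]; ring
    have h2 : f (m * t * (m⁻¹ : N)) = (1 - l t) * φ m := by
      rw [hfmul, hfmul, hft, hfN, hfN, hφ.map_inv, hlmul, hlN]
      ring
    simp only [h1, h2]
    rw [← hφm] at hp
    have h3 : 0 < (1 - l t) ^ 2 := by positivity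
    nlinarith [mul_pos_of_neg_of_neg hp (neg_neg_of_pos h3)]

theorem not_countable_of_invariant (hP : IsPositiveCone P) {ψ : G → ℝ} (hψ : IsAdditive ψ)
    (hr : IsAdditive.IsRankOne ψ) {φ : hψ.ker → ℝ} (hφ : IsAdditive φ)
    (hconj : ∀ (g : G) n, φ (MulAut.conjNormal g n) = φ n) {n : hψ.ker} (hn : φ n ≠ 0) :
    ¬ {Q : Set G | IsPositiveCone Q}.Countable := by
  have hN : ∀ x y : G, ⁅x, y⁆ ∈ hψ.ker := fun x y => hψ.map_commutatorElement x y
  obtain ⟨⟨c, hc⟩, hr⟩ := hr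
  have hadd : ∀ y, IsAdditive fun x => φ (commutatorIn hN x y) := fun y x x' => by
    change φ _ = φ _ + φ _
    rw [commutatorIn_mul_left, hφ, hconj, add_comm]
  have hswap : ∀ x y, φ (commutatorIn hN x y) = -φ (commutatorIn hN y x) := fun x y => by
    rw [← commutatorIn_inv, hφ.map_inv]
  have hker : ∀ (m : hψ.ker) y, φ (commutatorIn hN m y) = 0 := fun m y => by
    rw [commutatorIn_coe_left, hφ, hconj, hφ.map_inv]
    ring
  have hpow : ∀ y, φ (commutatorIn hN c y) = 0 → ∀ x, φ (commutatorIn hN x y) = 0 := by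
    intro y hy x
    obtain ⟨i, j, hi, hij⟩ := hr x c hc
    have hmem : x ^ i * (c ^ j)⁻¹ ∈ hψ.ker := by
      rw [hψ.mem_ker, hψ, hψ.map_inv, hψ.map_zpow, hψ.map_zpow, hij]
      ring
    have h1 := hadd y (x ^ i * (c ^ j)⁻¹) (c ^ j)
    have h2 := (hadd y).map_zpow x i
    have h3 := (hadd y).map_zpow c j
    have h4 := hker ⟨_, hmem⟩ y
    simp only [inv_mul_cancel_right] at h1 h2 h3 h4
    rw [h4, h2, h3, hy] at h1
    have : (i : ℝ) ≠ 0 := by exact_mod_cast hi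
    simpa [this] using h1
  have hzero : ∀ x y, φ (commutatorIn hN x y) = 0 := fun x y => by
    refine hpow y ?_ x
    rw [hswap, hpow c (by rw [commutatorIn_self, hφ.map_one]) y, neg_zero]
  have hle : commutator G ≤ hφ.ker.map hψ.ker.subtype := by
    rw [commutator_def, Subgroup.commutator_le]
    intro x _ y _
    exact ⟨commutatorIn hN x y, hzero x y, rfl⟩
  obtain ⟨Φ, hΦ, hΦφ⟩ := hφ.exists_extension fun m hm => by
    obtain ⟨m', hm', h⟩ := hle hm
    rw [← Subtype.ext h]
    exact hm'
  exact hP.not_countable_of_pencil hΦ hψ n.2 (by rwa [hΦφ]) hc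

/-- With only countably many left orders, the values of an additive function are commensurable. -/
theorem isRankOne (hP : IsPositiveCone P) (hc : {Q : Set G | IsPositiveCone Q}.Countable)
    {ψ : G → ℝ} (hψ : IsAdditive ψ) (h0 : ∃ x, ψ x ≠ 0) : IsAdditive.IsRankOne ψ := by
  refine ⟨h0, fun x y hy => ?_⟩
  by_contra! h
  have hx : ψ x ∉ Submodule.span ℚ {ψ y} := by
    rw [Submodule.mem_span_singleton]
    rintro ⟨q, hq⟩
    refine h q.den q.num (by simp) ?_
    have hq' : (q : ℝ) * q.den = q.num := by exact_mod_cast Rat.mul_den_eq_num q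
    rw [← hq, Rat.smul_def, ← hq']
    push_cast
    ring
  obtain ⟨L, hL, hLx⟩ := LinearMap.exists_extend_of_notMem
    (0 : Submodule.span ℚ {ψ y} →ₗ[ℚ] ℝ) hx (1 : ℝ)
  have hLy : L (ψ y) = 0 :=
    LinearMap.congr_fun hL ⟨ψ y, Submodule.mem_span_singleton_self _⟩
  exact hP.not_countable_of_pencil hψ (ψ := fun g => L (ψ g))
    (fun g g' => (congrArg L (hψ g g')).trans (map_add L _ _)) hLy hy (c := x)
      (by rw [hLx]; exact one_ne_zero) hc

end Uncountable

section Hoelder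

open Filter Topology

variable {G : Type*} [Group G] [Preorder G] [MulLeftMono G] [MulRightMono G]

theorem pow_mul_le_mul_pow {x y : G} (h : x * y ≤ y * x) (m : ℕ) : x ^ m * y ≤ y * x ^ m := by
  induction m with
  | zero => simp
  | succ m ih =>
    calc x ^ (m + 1) * y = x * (x ^ m * y) := by rw [pow_succ', mul_assoc]
      _ ≤ x * (y * x ^ m) := mul_le_mul_right ih x
      _ = x * y * x ^ m := (mul_assoc _ _ _).symm
      _ ≤ y * x * x ^ m := mul_le_mul_left h _
      _ = y * x ^ (m + 1) := by rw [pow_succ', mul_assoc]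

theorem pow_mul_pow_le_mul_pow {x y : G} (h : x * y ≤ y * x) (m : ℕ) :
    x ^ m * y ^ m ≤ (x * y) ^ m := by
  induction m with
  | zero => simp
  | succ m ih =>
    calc x ^ (m + 1) * y ^ (m + 1) = x * (x ^ m * y) * y ^ m := by
          simp only [pow_succ' x, pow_succ' y, mul_assoc]
      _ ≤ x * (y * x ^ m) * y ^ m := mul_le_mul_left (mul_le_mul_right (pow_mul_le_mul_pow h m) x) _
      _ = x * y * (x ^ m * y ^ m) := by simp only [mul_assoc]
      _ ≤ x * y * (x * y) ^ m := mul_le_mul_right ih _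
      _ = (x * y) ^ (m + 1) := (pow_succ' _ _).symm

theorem mul_pow_le_pow_mul_pow {x y : G} (h : x * y ≤ y * x) (m : ℕ) :
    (x * y) ^ m ≤ y ^ m * x ^ m := by
  induction m with
  | zero => simp
  | succ m ih =>
    calc (x * y) ^ (m + 1) = (x * y) ^ m * (x * y) := pow_succ _ _
      _ ≤ y ^ m * x ^ m * (y * x) := mul_le_mul' ih h
      _ = y ^ m * (x ^ m * y) * x := by simp only [mul_assoc]
      _ ≤ y ^ m * (y * x ^ m) * x :=
        mul_le_mul_left (mul_le_mul_right (pow_mul_le_mul_pow h m) _) _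
      _ = y ^ (m + 1) * x ^ (m + 1) := by simp only [pow_succ, mul_assoc]

/-- Hölder's theorem for archimedean total bi-invariant preorders. -/
theorem exists_isAdditive_nonneg_iff_one_le (htot : ∀ x y : G, x ≤ y ∨ y ≤ x)
    (harch : ∀ x y : G, 1 < y → ∃ m : ℕ, x ≤ y ^ m) {z : G} (hz : 1 < z) :
    ∃ ψ : G → ℝ, IsAdditive ψ ∧ ∀ x, 0 ≤ ψ x ↔ 1 ≤ x := by
  have hzle : ∀ i j : ℤ, i ≤ j → z ^ i ≤ z ^ j := fun i j hij => by
    obtain ⟨k, rfl⟩ := Int.le.dest hij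
    rw [zpow_add, zpow_natCast]
    exact le_mul_of_one_le_right' (one_le_pow_of_one_le' hz.le k)
  have hzlt : ∀ i j : ℤ, z ^ i ≤ z ^ j → i ≤ j := fun i j hij => by
    by_contra h
    have h1 : z ^ (j + 1) ≤ z ^ j := (hzle _ _ (by lia)).trans hij
    rw [zpow_add_one] at h1
    exact hz.not_ge (by simpa using h1)
  have hfloor : ∀ x : G, ∃ k : ℤ, z ^ k ≤ x ∧ x ≤ z ^ (k + 1) := by
    intro x
    obtain ⟨a, ha⟩ := harch x z hz
    obtain ⟨b, hb⟩ := harch x⁻¹ z hz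
    have hb' : z ^ (-b : ℤ) ≤ x := by
      rw [zpow_neg, zpow_natCast]
      exact inv_le_of_inv_le' hb
    obtain ⟨k, hk, hk'⟩ := Int.exists_greatest_of_bdd (P := fun k : ℤ => z ^ k ≤ x)
      ⟨a, fun k hk => hzlt k a (hk.trans (by simpa using ha))⟩ ⟨-b, hb'⟩
    refine ⟨k, hk, (htot _ _).resolve_right fun h => ?_⟩
    have := hk' _ h
    lia
  choose n hn hn' using hfloor
  have hle : ∀ x (k : ℤ), z ^ k ≤ x → k ≤ n x + 1 := fun x k h => hzlt _ _ (h.trans (hn' x))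
  have hge : ∀ x (k : ℤ), x ≤ z ^ k → n x ≤ k := fun x k h => hzlt _ _ ((hn x).trans h)
  have hlim : ∀ x, ∃ t : ℝ, Tendsto (fun m : ℕ => (n (x ^ m) : ℝ) / m) atTop (𝓝 t) := by
    intro x
    have hsub : Subadditive fun m => -(n (x ^ m) : ℝ) + 1 := fun a b => by
      have h1 := hle (x ^ (a + b)) (n (x ^ a) + n (x ^ b)) (by
        rw [zpow_add, pow_add]
        exact mul_le_mul' (hn _) (hn _))
      have h2 : ((n (x ^ a) : ℝ) + n (x ^ b)) ≤ n (x ^ (a + b)) + 1 := by exact_mod_cast h1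
      linarith
    have hbdd : BddBelow (Set.range fun m : ℕ => (-(n (x ^ m) : ℝ) + 1) / m) := by
      refine ⟨-|(n x : ℝ) + 1|, ?_⟩
      rintro _ ⟨m, rfl⟩
      rcases Nat.eq_zero_or_pos m with rfl | hm
      · simp
      have hm' : (0 : ℝ) < m := by exact_mod_cast hm
      have h1 := hge (x ^ m) ((n x + 1) * m) (by
        rw [zpow_mul, zpow_natCast]
        exact pow_le_pow_left' (hn' x) m)
      have h2 : (n (x ^ m) : ℝ) ≤ (n x + 1) * m := by exact_mod_cast h1
      rw [le_div_iff₀ hm']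
      nlinarith [le_abs_self ((n x : ℝ) + 1)]
    refine ⟨-hsub.lim, ?_⟩
    have h1 := (hsub.tendsto_lim hbdd).neg.add (tendsto_one_div_atTop_nhds_zero_nat (𝕜 := ℝ))
    rw [add_zero] at h1
    refine h1.congr fun m => ?_
    rw [← neg_div, ← add_div]
    ring
  choose ψ hψ using hlim
  have hadd : IsAdditive ψ := by
    intro x y
    have hsand : (∀ m : ℕ, x ^ m * y ^ m ≤ (x * y) ^ m ∧ (x * y) ^ m ≤ y ^ m * x ^ m) ∨
        ∀ m : ℕ, y ^ m * x ^ m ≤ (x * y) ^ m ∧ (x * y) ^ m ≤ x ^ m * y ^ m := by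
      rcases htot (x * y) (y * x) with h | h
      · exact .inl fun m => ⟨pow_mul_pow_le_mul_pow h m, mul_pow_le_pow_mul_pow h m⟩
      · have h' : OrderDual.toDual x * OrderDual.toDual y ≤
            OrderDual.toDual y * OrderDual.toDual x := h
        exact .inr fun m => ⟨mul_pow_le_pow_mul_pow h' m, pow_mul_pow_le_mul_pow h' m⟩
    have key : ∀ m : ℕ, |(n ((x * y) ^ m) : ℝ) - (n (x ^ m) + n (y ^ m))| ≤ 2 := by
      intro m
      have h1 : n (x ^ m) + n (y ^ m) ≤ n ((x * y) ^ m) + 1 := by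
        refine hle _ _ ?_
        rcases hsand with h | h
        · refine le_trans ?_ (h m).1
          rw [zpow_add]
          exact mul_le_mul' (hn _) (hn _)
        · refine le_trans ?_ (h m).1
          rw [add_comm, zpow_add]
          exact mul_le_mul' (hn _) (hn _)
      have h2 : n ((x * y) ^ m) ≤ n (x ^ m) + 1 + (n (y ^ m) + 1) := by
        refine hge _ _ ?_
        rcases hsand with h | h
        · refine (h m).2.trans ?_
          rw [add_comm, zpow_add]
          exact mul_le_mul' (hn' _) (hn' _)
        · refine (h m).2.trans ?_
          rw [zpow_add]
          exact mul_le_mul' (hn' _) (hn' _)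
      have h3 : (n (x ^ m) : ℝ) + n (y ^ m) ≤ n ((x * y) ^ m) + 1 := by exact_mod_cast h1
      have h4 : (n ((x * y) ^ m) : ℝ) ≤ n (x ^ m) + 1 + (n (y ^ m) + 1) := by exact_mod_cast h2
      rw [abs_le]
      constructor <;> linarith
    have h1 := (hψ (x * y)).sub ((hψ x).add (hψ y))
    have h2 : Tendsto (fun m : ℕ => (n ((x * y) ^ m) : ℝ) / m -
        ((n (x ^ m) : ℝ) / m + (n (y ^ m) : ℝ) / m)) atTop (𝓝 0) := by
      refine squeeze_zero_norm (fun m => ?_) (tendsto_const_div_atTop_nhds_zero_nat (2 : ℝ))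
      rw [← add_div, ← sub_div, norm_div, Real.norm_eq_abs, Real.norm_natCast]
      exact div_le_div_of_nonneg_right (key m) m.cast_nonneg
    exact sub_eq_zero.1 (tendsto_nhds_unique h1 h2)
  refine ⟨ψ, hadd, fun x => ⟨fun h => ?_, fun h => ?_⟩⟩
  · by_contra hx
    have hx' : 1 < x⁻¹ := by
      have := (htot 1 x).resolve_left hx
      exact lt_of_le_not_ge (one_le_inv'.2 this) fun h => hx (by simpa using h)
    obtain ⟨k, hk⟩ := harch z _ hx'
    have h1 : (1 : ℝ) ≤ ψ (x⁻¹ ^ k) := by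
      have h2 := (hψ (x⁻¹ ^ k)).add (tendsto_one_div_atTop_nhds_zero_nat (𝕜 := ℝ))
      rw [add_zero] at h2
      refine ge_of_tendsto h2 ?_
      filter_upwards [eventually_gt_atTop 0] with m hm
      rw [← add_div, one_le_div (by exact_mod_cast hm)]
      have h3 := hle ((x⁻¹ ^ k) ^ m) m (by
        rw [zpow_natCast]
        exact pow_le_pow_left' hk m)
      exact_mod_cast h3
    rw [hadd.map_pow, hadd.map_inv] at h1
    nlinarith [(Nat.cast_nonneg k : (0 : ℝ) ≤ k)]
  · have h2 := (hψ x).add (tendsto_one_div_atTop_nhds_zero_nat (𝕜 := ℝ))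
    rw [add_zero] at h2
    refine ge_of_tendsto' h2 fun m => ?_
    have h1 := hle (x ^ m) 0 (by simpa using one_le_pow_of_one_le' h m)
    have h3 : (0 : ℝ) ≤ n (x ^ m) + 1 := by exact_mod_cast h1
    rw [← add_div]
    positivity

end Hoelder

/-- Convexity of a subgroup for the left order with positive cone `P`. -/
def IsConvex {G : Type*} [Group G] (P : Set G) (C : Subgroup G) : Prop :=
  ∀ x y, x ∈ P → x⁻¹ * y ∈ P → y ∈ C → x ∈ C

/-- The smallest convex subgroup containing an element. -/
def convexHull {G : Type*} [Group G] (P : Set G) (x : G) : Subgroup G :=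
  sInf {C | IsConvex P C ∧ x ∈ C}

section Convex

variable {G : Type*} [Group G] {P : Set G}

theorem isConvex_convexHull (P : Set G) (x : G) : IsConvex P (convexHull P x) := by
  intro y z hy hyz hz
  rw [convexHull, Subgroup.mem_sInf] at hz ⊢
  exact fun C hC => hC.1 y z hy hyz (hz C hC)

theorem mem_convexHull (P : Set G) (x : G) : x ∈ convexHull P x := by
  rw [convexHull, Subgroup.mem_sInf]
  exact fun C hC => hC.2

theorem convexHull_le {C : Subgroup G} (hC : IsConvex P C) {x : G} (hx : x ∈ C) :
    convexHull P x ≤ C :=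
  sInf_le ⟨hC, hx⟩

theorem convexHull_inv (P : Set G) (x : G) : convexHull P x⁻¹ = convexHull P x := by
  simp [convexHull]

theorem convex_total (hP : IsPositiveCone P) {C D : Subgroup G} (hC : IsConvex P C)
    (hD : IsConvex P D) : C ≤ D ∨ D ≤ C := by
  by_contra! h
  obtain ⟨⟨x, hxC, hxD⟩, ⟨y, hyD, hyC⟩⟩ := And.imp SetLike.not_le_iff_exists.1
    SetLike.not_le_iff_exists.1 h
  wlog hx : x ∈ P generalizing x
  · exact this x⁻¹ (inv_mem hxC) (by simpa) (hP.inv_mem_of_notMem (by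
      rintro rfl
      exact hxD (one_mem _)) hx)
  wlog hy : y ∈ P generalizing y
  · exact this y⁻¹ (inv_mem hyD) (by simpa) (hP.inv_mem_of_notMem (by
      rintro rfl
      exact hyC (one_mem _)) hy)
  rcases hP.2.1 (x⁻¹ * y) with h' | h' | h'
  · exact hxD (hD x y hx h' hyD)
  · exact hyC (hC y x hy (by simpa using h') hxC)
  · rw [inv_mul_eq_one] at h'
    exact hyC (h' ▸ hxC)

theorem mul_mem_of_mem_of_notMem (hP : IsPositiveCone P) {C : Subgroup G} (hC : IsConvex P C)
    {x y : G} (hx : x ∈ C) (hy : y ∉ C) (hyP : y ∈ P) : x * y ∈ P := by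
  rcases hP.2.1 (x * y) with h | h | h
  · exact h
  · exact absurd (hC y x⁻¹ hyP (by simpa using h) (inv_mem hx)) hy
  · exact absurd (by simpa [eq_inv_of_mul_eq_one_right h] using hx) hy

theorem mul_mem_of_notMem_of_mem (hP : IsPositiveCone P) {C : Subgroup G} (hC : IsConvex P C)
    {x y : G} (hx : x ∈ C) (hy : y ∉ C) (hyP : y ∈ P) : y * x ∈ P := by
  rcases hP.2.1 (y * x) with h | h | h
  · exact h
  · have := hC (y * x)⁻¹ x⁻¹ h (by simpa using hyP) (inv_mem hx)
    refine absurd ?_ hy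
    have h2 := mul_mem (inv_mem this) (inv_mem hx)
    simpa using h2
  · exact absurd (by simpa [eq_inv_of_mul_eq_one_left h] using hx) hy

theorem convexHull_mul_of_mem_of_notMem (hP : IsPositiveCone P) {x y : G}
    (h : y ∉ convexHull P x) :
    convexHull P (x * y) = convexHull P y ∧ convexHull P (y * x) = convexHull P y := by
  have hxy : convexHull P x ≤ convexHull P y :=
    (convex_total hP (isConvex_convexHull P x) (isConvex_convexHull P y)).resolve_right
      fun h' => h (h' (mem_convexHull P y))
  have hx : x ∈ convexHull P y := hxy (mem_convexHull P x)
  have key : ∀ w, w ∉ convexHull P x → (x ∈ convexHull P w → y ∈ convexHull P w) →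
      convexHull P y ≤ convexHull P w := fun w hw hw' => by
    refine convexHull_le (isConvex_convexHull P w) (hw' ?_)
    exact (convex_total hP (isConvex_convexHull P x) (isConvex_convexHull P w)).resolve_right
      (fun h' => hw (h' (mem_convexHull P w))) (mem_convexHull P x)
  constructor
  · refine le_antisymm (convexHull_le (isConvex_convexHull P y)
      (mul_mem hx (mem_convexHull P y))) (key _ ?_ fun hx' => ?_)
    · rwa [Subgroup.mul_mem_cancel_left _ (mem_convexHull P x)]
    · exact (Subgroup.mul_mem_cancel_left _ hx').1 (mem_convexHull P (x * y))
  · refine le_antisymm (convexHull_le (isConvex_convexHull P y)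
      (mul_mem (mem_convexHull P y) hx)) (key _ ?_ fun hx' => ?_)
    · rwa [Subgroup.mul_mem_cancel_right _ (mem_convexHull P x)]
    · exact (Subgroup.mul_mem_cancel_right _ hx').1 (mem_convexHull P (y * x))

theorem convexHull_mul_of_mem {x y : G} (hx : x ∈ P) (hy : y ∈ P)
    (h : convexHull P x = convexHull P y) : convexHull P (x * y) = convexHull P x := by
  refine le_antisymm (convexHull_le (isConvex_convexHull P x)
    (mul_mem (mem_convexHull P x) (h ▸ mem_convexHull P y))) ?_
  refine convexHull_le (isConvex_convexHull P _) ?_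
  exact isConvex_convexHull P _ x (x * y) hx (by simpa using hy) (mem_convexHull P _)

/-- Reversing the order on the jumps of convex subgroups listed in `s`. -/
def flip (P : Set G) (s : Set (Subgroup G)) : Set G :=
  {x | (x ∈ P ∧ convexHull P x ∉ s) ∨ (x⁻¹ ∈ P ∧ convexHull P x ∈ s)}

theorem isPositiveCone_flip (hP : IsPositiveCone P) (s : Set (Subgroup G)) :
    IsPositiveCone (flip P s) := by
  refine ⟨?_, fun g => ?_, ?_, ?_⟩
  · intro p hp q hq
    by_cases h1 : q ∈ convexHull P p
    · by_cases h2 : p ∈ convexHull P q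
      · have heq : convexHull P p = convexHull P q :=
          le_antisymm (convexHull_le (isConvex_convexHull P q) h2)
            (convexHull_le (isConvex_convexHull P p) h1)
        rcases hp with ⟨hp, hps⟩ | ⟨hp, hps⟩ <;> rcases hq with ⟨hq, hqs⟩ | ⟨hq, hqs⟩
        · exact .inl ⟨hP.mul_mem hp hq, by rwa [convexHull_mul_of_mem hp hq heq]⟩
        · exact absurd (heq ▸ hqs) hps
        · exact absurd (heq ▸ hps) hqs
        · refine .inr ⟨by simpa using hP.mul_mem hq hp, ?_⟩
          have := convexHull_mul_of_mem hq hp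
            (by rw [convexHull_inv, convexHull_inv, heq])
          rw [← mul_inv_rev, convexHull_inv, convexHull_inv] at this
          rwa [this]
      · have heq := (convexHull_mul_of_mem_of_notMem hP h2).2
        rcases hp with ⟨hp, hps⟩ | ⟨hp, hps⟩
        · exact .inl ⟨mul_mem_of_notMem_of_mem hP (isConvex_convexHull P q)
            (mem_convexHull P q) h2 hp, by rwa [heq]⟩
        · refine .inr ⟨?_, by rwa [heq]⟩
          rw [mul_inv_rev]
          exact mul_mem_of_mem_of_notMem hP (isConvex_convexHull P q)
            (inv_mem (mem_convexHull P q)) (by simpa) hp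
    · have heq := (convexHull_mul_of_mem_of_notMem hP h1).1
      rcases hq with ⟨hq, hqs⟩ | ⟨hq, hqs⟩
      · exact .inl ⟨mul_mem_of_mem_of_notMem hP (isConvex_convexHull P p)
          (mem_convexHull P p) h1 hq, by rwa [heq]⟩
      · refine .inr ⟨?_, by rwa [heq]⟩
        rw [mul_inv_rev]
        exact mul_mem_of_notMem_of_mem hP (isConvex_convexHull P p)
          (inv_mem (mem_convexHull P p)) (by simpa) hq
  · by_cases hs : convexHull P g ∈ s
    · rcases hP.2.1 g with h | h | h
      · exact .inr (.inl (.inr ⟨by simpa using h, by rwa [convexHull_inv]⟩))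
      · exact .inl (.inr ⟨h, hs⟩)
      · exact .inr (.inr h)
    · rcases hP.2.1 g with h | h | h
      · exact .inl (.inl ⟨h, hs⟩)
      · exact .inr (.inl (.inl ⟨h, by rwa [convexHull_inv]⟩))
      · exact .inr (.inr h)
  · rintro g (⟨hg, hgs⟩ | ⟨hg, hgs⟩) (⟨hg', hgs'⟩ | ⟨hg', hgs'⟩)
    · exact hP.inv_notMem hg hg'
    · rw [convexHull_inv] at hgs'
      exact hgs hgs'
    · rw [convexHull_inv] at hgs'
      exact hgs' hgs
    · exact hP.inv_notMem hg hg'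
  · rintro (⟨h, -⟩ | ⟨h, -⟩)
    · exact hP.one_notMem h
    · exact hP.one_notMem (by simpa using h)

/-- With only countably many left orders, each of them has finitely many convex jumps. -/
theorem finite_range_convexHull (hP : IsPositiveCone P)
    (hc : {Q : Set G | IsPositiveCone Q}.Countable) : (Set.range (convexHull P)).Finite := by
  let R : Set (Subgroup G) := convexHull P '' P
  have hsub : Set.range (convexHull P) ⊆ insert (convexHull P 1) R := by
    rintro _ ⟨x, rfl⟩
    rcases hP.2.1 x with h | h | h
    · exact .inr ⟨x, h, rfl⟩
    · exact .inr ⟨x⁻¹, h, convexHull_inv P x⟩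
    · exact .inl (by rw [h])
  refine Set.Finite.subset (Set.Finite.insert _ ?_) hsub
  let F : Set R → Set G := fun s => flip P (Subtype.val '' s)
  have hF : ∀ (s : Set R) (x : G) (hx : x ∈ P),
      x ∈ F s ↔ (⟨convexHull P x, x, hx, rfl⟩ : R) ∉ s := by
    intro s x hx
    have : x⁻¹ ∉ P := hP.inv_notMem hx
    simp only [F, flip, Set.mem_ofPred_eq, hx, this, true_and, false_and, or_false]
    simp only [Set.mem_image, Subtype.exists, exists_and_right, exists_eq_right, not_exists]
    exact ⟨fun h => h ⟨x, hx, rfl⟩, fun h _ => h⟩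
  have hinj : Function.Injective F := by
    intro s t hst
    ext ⟨_, x, hx, rfl⟩
    have h1 := hF s x hx
    have h2 := hF t x hx
    rw [hst] at h1
    exact not_iff_not.1 (h1.symm.trans h2)
  have hcount : Countable (Set R) :=
    Set.countable_univ_iff.1
      (Set.MapsTo.countable_of_injOn (f := F) (fun s _ => isPositiveCone_flip hP _) hinj.injOn hc)
  by_contra hR
  have : Infinite R := Set.infinite_coe_iff.2 hR
  have h1 := Cardinal.cantor (Cardinal.mk R)
  rw [← Cardinal.mk_set] at h1
  exact absurd (Cardinal.mk_le_aleph0_iff.2 hcount)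
    (not_le.2 ((Cardinal.aleph0_le_mk R).trans_lt h1))

end Convex

/-- Every element has a nontrivial power whose conjugation action preserves the order. -/
def IsRecurrent {G : Type*} [Group G] (P : Set G) : Prop :=
  ∀ g : G, ∃ k : ℕ, k ≠ 0 ∧ ∀ x, g ^ k * x * (g ^ k)⁻¹ ∈ P ↔ x ∈ P

/-- An element all of whose large powers exceed any given element. -/
def IsCofinal {G : Type*} [Group G] (P : Set G) (x : G) : Prop :=
  ∀ h : G, ∃ m₀ : ℕ, ∀ m ≥ m₀, h⁻¹ * x ^ m ∈ P

section Recurrent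

variable {G : Type*} [Group G] {P : Set G}

theorem IsCofinal.mem (hP : IsPositiveCone P) {x : G} (hx : IsCofinal P x) : x ∈ P := by
  obtain ⟨m, hm⟩ := hx 1
  exact hP.mem_of_pow_mem (by simpa using hm m le_rfl)

theorem IsCofinal.convexHull_eq_top (hP : IsPositiveCone P) {x : G} (hx : IsCofinal P x) :
    convexHull P x = ⊤ := by
  rw [eq_top_iff]
  have key : ∀ h ∈ P, h ∈ convexHull P x := fun h hh => by
    obtain ⟨m, hm⟩ := hx h
    exact isConvex_convexHull P x h (x ^ m) hh (hm m le_rfl) (pow_mem (mem_convexHull P x) m)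
  intro h _
  rcases hP.2.1 h with hh | hh | rfl
  · exact key h hh
  · simpa using key _ hh
  · exact one_mem _

theorem mul_pow_mem_of_mem (hP : IsPositiveCone P) {x y : G} (hx : x ∈ P) (hy : y ∈ P) (n : ℕ) :
    y * x ^ n ∈ P := by
  rcases Nat.eq_zero_or_pos n with rfl | hn
  · simpa using hy
  · exact hP.mul_mem hy (hP.pow_mem hx hn.ne')

theorem isCofinal_of_convexHull_eq_top (hP : IsPositiveCone P) (hr : IsRecurrent P) {x : G}
    (hx : x ∈ P) (htop : convexHull P x = ⊤) : IsCofinal P x := by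
  obtain ⟨k, hk, hz⟩ := hr x
  set z := x ^ k with hzdef
  have hzP : z ∈ P := hP.pow_mem hx hk
  have hzn : ∀ (n : ℕ) y, z ^ n * y * (z ^ n)⁻¹ ∈ P ↔ y ∈ P := fun n => by
    induction n with
    | zero => simp
    | succ n ih =>
      intro y
      rw [← ih y, ← hz (z ^ n * y * (z ^ n)⁻¹), pow_succ']
      simp only [mul_inv_rev, mul_assoc]
  have hzn' : ∀ (n : ℕ) y, (z ^ n)⁻¹ * y * z ^ n ∈ P ↔ y ∈ P := fun n y => by
    rw [← hzn n]
    simp [mul_assoc]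
  let B : Subgroup G :=
    { carrier := {g | ∃ m : ℕ, g⁻¹ * z ^ m ∈ P ∧ z ^ m * g ∈ P}
      mul_mem' := by
        rintro a b ⟨m, h1, h2⟩ ⟨n, h3, h4⟩
        refine ⟨m + n, ?_, ?_⟩
        · have := hP.mul_mem h3 ((hzn' n _).2 h1)
          convert this using 1
          rw [pow_add]
          group
        · have := hP.mul_mem ((hzn n _).2 h2) h4
          convert this using 1
          rw [add_comm, pow_add]
          group
      one_mem' := ⟨1, by simpa using hzP, by simpa using hzP⟩
      inv_mem' := by
        rintro a ⟨m, h1, h2⟩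
        refine ⟨m, ?_, ?_⟩
        · have := (hzn' m _).2 h2
          convert this using 1
          group
        · have := (hzn m _).2 h1
          convert this using 1
          group }
  have hB : IsConvex P B := by
    rintro a b ha hab ⟨m, h1, -⟩
    refine ⟨m, ?_, ?_⟩
    · have := hP.mul_mem hab h1
      convert this using 1
      group
    · rcases Nat.eq_zero_or_pos m with rfl | hm
      · simpa using ha
      · exact hP.mul_mem (hP.pow_mem hzP hm.ne') ha
  have hxB : x ∈ B := by
    refine ⟨2, ?_, hP.mul_mem (hP.pow_mem hzP two_ne_zero) hx⟩
    obtain ⟨j, rfl⟩ := Nat.exists_eq_succ_of_ne_zero hk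
    have : x⁻¹ * z ^ 2 = x ^ j * z := by
      rw [hzdef, pow_two, Nat.succ_eq_add_one, pow_succ' x j]
      group
    rw [this]
    rcases Nat.eq_zero_or_pos j with rfl | hj
    · simpa using hzP
    · exact hP.mul_mem (hP.pow_mem hx hj.ne') hzP
  intro h
  have hh : h ∈ B := convexHull_le hB hxB (by rw [htop]; trivial)
  obtain ⟨m, hm, -⟩ := hh
  refine ⟨k * m, fun n hn => ?_⟩
  obtain ⟨d, rfl⟩ := Nat.exists_eq_add_of_le hn
  rw [pow_add, pow_mul, ← mul_assoc]
  exact mul_pow_mem_of_mem hP hx hm d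

theorem IsCofinal.conj_inv (hP : IsPositiveCone P) {x g : G} (hx : IsCofinal P x)
    (hg : g ∈ P ∨ g = 1) : IsCofinal P (g⁻¹ * x * g) := by
  rcases hg with hg | rfl
  swap
  · simpa using hx
  intro h
  obtain ⟨m₀, hm₀⟩ := hx (g * h)
  refine ⟨m₀, fun m hm => ?_⟩
  have h1 := hP.mul_mem (hm₀ m hm) hg
  have h2 : (g⁻¹ * x * g) ^ m = g⁻¹ * x ^ m * g := by
    have := conj_pow (a := g⁻¹) (b := x) (i := m)
    simpa using this
  rw [h2]
  convert h1 using 1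
  group

theorem IsCofinal.conj (hP : IsPositiveCone P) (hr : IsRecurrent P) {x : G}
    (hx : IsCofinal P x) (g : G) : IsCofinal P (g * x * g⁻¹) := by
  have key : ∀ g ∈ P, IsCofinal P (g * x * g⁻¹) := by
    intro g hg
    obtain ⟨k, hk, hz⟩ := hr g
    have h1 : IsCofinal P (g ^ k * x * (g ^ k)⁻¹) := by
      intro h
      obtain ⟨m₀, hm₀⟩ := hx ((g ^ k)⁻¹ * h * g ^ k)
      refine ⟨m₀, fun m hm => ?_⟩
      have h2 := (hz _).2 (hm₀ m hm)
      rw [conj_pow]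
      convert h2 using 1
      group
    obtain ⟨j, rfl⟩ := Nat.exists_eq_succ_of_ne_zero hk
    have h3 : g ^ j ∈ P ∨ g ^ j = 1 := by
      rcases Nat.eq_zero_or_pos j with rfl | hj
      · exact .inr (pow_zero g)
      · exact .inl (hP.pow_mem hg hj.ne')
    have h4 := h1.conj_inv hP h3
    convert h4 using 1
    rw [Nat.succ_eq_add_one, pow_succ]
    group
  rcases hP.2.1 g with hg | hg | rfl
  · exact key g hg
  · simpa using hx.conj_inv hP (.inl hg)
  · simpa using hx

theorem isCofinal_iff (hP : IsPositiveCone P) (hr : IsRecurrent P) {x : G} :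
    IsCofinal P x ↔ x ∈ P ∧ convexHull P x = ⊤ :=
  ⟨fun h => ⟨h.mem hP, h.convexHull_eq_top hP⟩,
    fun h => isCofinal_of_convexHull_eq_top hP hr h.1 h.2⟩

theorem IsCofinal.of_mul (hP : IsPositiveCone P) (hr : IsRecurrent P) {x y : G}
    (h : IsCofinal P (x * y)) : IsCofinal P x ∨ IsCofinal P y := by
  by_contra! hxy
  rw [isCofinal_iff hP hr] at h
  rw [isCofinal_iff hP hr, isCofinal_iff hP hr, not_and, not_and] at hxy
  obtain ⟨hx, hy⟩ := hxy
  obtain ⟨hP', htop⟩ := h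
  have hinv : (x * y)⁻¹ ∉ P := hP.inv_notMem hP'
  rw [mul_inv_rev] at hinv
  by_cases hxt : convexHull P x = ⊤ <;> by_cases hyt : convexHull P y = ⊤
  · rcases hP.2.1 x with h | h | rfl
    · exact hx h hxt
    · rcases hP.2.1 y with h' | h' | rfl
      · exact hy h' hyt
      · exact hinv (hP.mul_mem h' h)
      · exact hinv (by simpa using h)
    · rw [one_mul] at hP'
      exact hy hP' hyt
  · have hxy : x ∉ convexHull P y := fun h => hyt (top_le_iff.1
      (hxt ▸ convexHull_le (isConvex_convexHull P y) h))
    rcases hP.2.1 x with h | h | rfl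
    · exact hx h hxt
    · exact hinv (mul_mem_of_mem_of_notMem hP (isConvex_convexHull P y)
        (inv_mem (mem_convexHull P y)) (by simpa) h)
    · exact hxy (one_mem _)
  · have hxy : y ∉ convexHull P x := fun h => hxt (top_le_iff.1
      (hyt ▸ convexHull_le (isConvex_convexHull P x) h))
    rcases hP.2.1 y with h | h | rfl
    · exact hy h hyt
    · exact hinv (mul_mem_of_notMem_of_mem hP (isConvex_convexHull P x)
        (inv_mem (mem_convexHull P x)) (by simpa) h)
    · exact hxy (one_mem _)
  · rcases convex_total hP (isConvex_convexHull P x) (isConvex_convexHull P y) with h | h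
    · exact hyt (top_le_iff.1 (htop ▸ convexHull_le (isConvex_convexHull P y)
        (mul_mem (h (mem_convexHull P x)) (mem_convexHull P y))))
    · exact hxt (top_le_iff.1 (htop ▸ convexHull_le (isConvex_convexHull P x)
        (mul_mem (mem_convexHull P x) (h (mem_convexHull P y)))))

theorem exists_isCofinal [Nontrivial G] (hP : IsPositiveCone P) (hr : IsRecurrent P)
    (hfin : (Set.range (convexHull P)).Finite) : ∃ z, IsCofinal P z := by
  obtain ⟨C, hC⟩ := hfin.exists_maximal (Set.range_nonempty _)
  obtain ⟨⟨y, rfl⟩, hmax⟩ := hC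
  have htop : convexHull P y = ⊤ := by
    refine top_le_iff.1 fun x _ => ?_
    rcases convex_total hP (isConvex_convexHull P x) (isConvex_convexHull P y) with h | h
    · exact h (mem_convexHull P x)
    · exact hmax ⟨x, rfl⟩ h (mem_convexHull P x)
  rcases hP.2.1 y with h | h | rfl
  · exact ⟨y, (isCofinal_iff hP hr).2 ⟨h, htop⟩⟩
  · exact ⟨y⁻¹, (isCofinal_iff hP hr).2 ⟨h, by rwa [convexHull_inv]⟩⟩
  · obtain ⟨x, hx⟩ := exists_ne (1 : G)
    have h1 : convexHull P 1 ≤ ⊥ := by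
      refine convexHull_le (fun a b ha hab hb => ?_) (one_mem _)
      rw [Subgroup.mem_bot] at hb
      rw [hb, mul_one] at hab
      exact absurd hab (hP.inv_notMem ha)
    have h2 : x ∈ convexHull P 1 := by rw [htop]; trivial
    exact absurd (Subgroup.mem_bot.1 (h1 h2)) hx

/-- A recurrent left order with finitely many convex jumps is, up to a convex normal subgroup,
archimedean. -/
theorem exists_isAdditive [Nontrivial G] (hP : IsPositiveCone P) (hr : IsRecurrent P)
    (hfin : (Set.range (convexHull P)).Finite) :
    ∃ ψ : G → ℝ, IsAdditive ψ ∧ ∀ x, 0 < ψ x ↔ x ∈ P ∧ convexHull P x = ⊤ := by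
  obtain ⟨z, hz⟩ := exists_isCofinal hP hr hfin
  let _ : Preorder G :=
    { le := fun a b => ¬ IsCofinal P (b⁻¹ * a)
      le_refl := fun a h => hP.one_notMem (by simpa using h.mem hP)
      le_trans := fun a b c hab hbc h => by
        have h' : IsCofinal P (c⁻¹ * b * (b⁻¹ * a)) := by simpa [mul_assoc] using h
        rcases h'.of_mul hP hr with h' | h'
        · exact hbc h'
        · exact hab h' }
  have hle : ∀ a b : G, a ≤ b ↔ ¬ IsCofinal P (b⁻¹ * a) := fun _ _ => Iff.rfl
  have : MulLeftMono G := ⟨fun a b c hbc => by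
    rw [hle] at hbc ⊢
    simpa [mul_assoc] using hbc⟩
  have : MulRightMono G := ⟨fun a b c hbc => by
    rw [hle] at hbc ⊢
    intro h
    refine hbc ?_
    have := h.conj hP hr a
    convert this using 1
    simp only [Function.swap]
    group⟩
  have htot : ∀ a b : G, a ≤ b ∨ b ≤ a := fun a b => by
    rw [hle, hle]
    by_contra! h
    refine hP.inv_notMem (h.1.mem hP) ?_
    simpa using h.2.mem hP
  have hlt : ∀ y : G, 1 < y ↔ IsCofinal P y := fun y => by
    rw [lt_iff_le_not_ge, and_iff_right_of_imp, hle, not_not]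
    · simp
    · exact fun h => (htot _ _).resolve_right h
  obtain ⟨ψ, hψ, hψ'⟩ := exists_isAdditive_nonneg_iff_one_le htot (fun x y hy => by
    rw [hlt] at hy
    obtain ⟨m, hm⟩ := hy x
    refine ⟨m, fun h => hP.inv_notMem (hm m le_rfl) ?_⟩
    simpa using h.mem hP) ((hlt z).2 hz)
  refine ⟨ψ, hψ, fun x => ?_⟩
  rw [← isCofinal_iff hP hr, ← not_iff_not, not_lt]
  have h1 := hψ' x⁻¹
  rw [hψ.map_inv, neg_nonneg, hle] at h1
  simpa using h1

end Recurrent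

/-- All elements of positive value have the same sign in the left order with positive cone `P`. -/
def IsCoherent {G : Type*} [Group G] (P : Set G) (ψ : G → ℝ) : Prop :=
  (∀ x, 0 < ψ x → x ∈ P) ∨ ∀ x, 0 < ψ x → x⁻¹ ∈ P

section Coherent

variable {G : Type*} [Group G] {P : Set G} {ψ : G → ℝ}

theorem map_convexHull {N : Subgroup G} (hN : IsConvex P N) (x : N) :
    (convexHull (N.subtype ⁻¹' P) x).map N.subtype = convexHull P (x : G) := by
  refine le_antisymm ?_ (convexHull_le ?_ ⟨x, mem_convexHull _ x, rfl⟩)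
  · rw [Subgroup.map_le_iff_le_comap]
    exact convexHull_le (C := (convexHull P (x : G)).comap N.subtype)
      (fun a b ha hab hb => isConvex_convexHull P (x : G) a b ha hab hb)
      (mem_convexHull P (x : G))
  · rintro a _ ha hab ⟨b, hb, rfl⟩
    exact ⟨⟨a, hN a b ha hab b.2⟩, isConvex_convexHull _ x ⟨a, hN a b ha hab b.2⟩ b ha hab hb, rfl⟩

theorem image_range_convexHull_ssubset {N : Subgroup G} (hN : IsConvex P N) (hN' : N ≠ ⊤) :
    Subgroup.map N.subtype '' Set.range (convexHull (N.subtype ⁻¹' P)) ⊂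
      Set.range (convexHull P) := by
  obtain ⟨z, hz⟩ : ∃ z, z ∉ N := by
    by_contra! h
    exact hN' (eq_top_iff.2 fun x _ => h x)
  refine Set.ssubset_iff_exists.2 ⟨?_, convexHull P z, ⟨z, rfl⟩, ?_⟩
  · rintro _ ⟨_, ⟨x, rfl⟩, rfl⟩
    exact ⟨x, (map_convexHull hN x).symm⟩
  · rintro ⟨C, -, hC⟩
    have := mem_convexHull P z
    rw [← hC] at this
    obtain ⟨y, -, rfl⟩ := this
    exact hz y.2

/-- An additive function and a left order on its kernel define a left order. -/
theorem extend (hψ : IsAdditive ψ) {Q : Set hψ.ker} (hQ : IsPositiveCone Q) :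
    IsPositiveCone {x | 0 < ψ x ∨ ∃ h : ψ x = 0, (⟨x, h⟩ : hψ.ker) ∈ Q} := by
  refine ⟨?_, fun g => ?_, ?_, ?_⟩
  · rintro p (hp | ⟨hp, hpQ⟩) q (hq | ⟨hq, hqQ⟩)
    · exact .inl (by rw [hψ]; linarith)
    · exact .inl (by rw [hψ]; linarith)
    · exact .inl (by rw [hψ]; linarith)
    · exact .inr ⟨by rw [hψ, hp, hq, add_zero], hQ.mul_mem hpQ hqQ⟩
  · rcases lt_trichotomy (ψ g) 0 with h | h | h
    · exact .inr (.inl (.inl (by rw [hψ.map_inv]; linarith)))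
    · rcases hQ.2.1 ⟨g, h⟩ with hg | hg | hg
      · exact .inl (.inr ⟨h, hg⟩)
      · exact .inr (.inl (.inr ⟨by rw [hψ.map_inv, h, neg_zero], hg⟩))
      · exact .inr (.inr (congrArg Subtype.val hg))
    · exact .inl (.inl h)
  · rintro g (hg | ⟨hg, hgP⟩) (hg' | ⟨hg', hgP'⟩)
    · rw [hψ.map_inv] at hg'
      linarith
    · rw [hψ.map_inv] at hg'
      linarith
    · rw [hψ.map_inv] at hg'
      linarith
    · exact hQ.inv_notMem hgP hgP'
  · rintro (h | ⟨_, h⟩)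
    · exact h.ne' hψ.map_one
    · exact hQ.one_notMem h

theorem countable_ker (hψ : IsAdditive ψ) (hc : {Q : Set G | IsPositiveCone Q}.Countable) :
    {Q : Set hψ.ker | IsPositiveCone Q}.Countable := by
  refine Set.MapsTo.countable_of_injOn
    (f := fun Q : Set hψ.ker => {x | 0 < ψ x ∨ ∃ h : ψ x = 0, (⟨x, h⟩ : hψ.ker) ∈ Q})
    (fun Q hQ => extend hψ hQ) ?_ hc
  intro Q _ R _ h
  ext ⟨x, hx⟩
  have h0 : ψ x = 0 := hx
  simpa [h0] using Set.ext_iff.1 h x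

theorem mem_of_mul_pos (hP : IsPositiveCone P) (hψ : IsAdditive ψ) (hr : IsAdditive.IsRankOne ψ)
    {c : G} (hc : ∀ n : hψ.ker, n * c ∈ P) {g : G} (hg : 0 < ψ g * ψ c) : g ∈ P := by
  obtain ⟨i, j, hi, hij⟩ := hr.2 g c (right_ne_zero_of_mul hg.ne')
  have hg0 := left_ne_zero_of_mul hg.ne'
  have hj : j ≠ 0 := by
    rintro rfl
    rw [Int.cast_zero, zero_mul] at hij
    exact mul_ne_zero (Int.cast_ne_zero.2 hi) hg0 hij
  have habs : (i.natAbs : ℝ) * ψ g = j.natAbs * ψ c := by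
    have h := congrArg abs hij
    rw [abs_mul, abs_mul] at h
    simp only [Nat.cast_natAbs, Int.cast_abs]
    rcases mul_pos_iff.1 hg with ⟨h1, h2⟩ | ⟨h1, h2⟩
    · rwa [abs_of_pos h1, abs_of_pos h2] at h
    · rw [abs_of_neg h1, abs_of_neg h2] at h
      linarith
  obtain ⟨b, hb⟩ := Nat.exists_eq_succ_of_ne_zero (Int.natAbs_ne_zero.2 hj)
  rw [hb] at habs
  have hker : g ^ i.natAbs * (c ^ b.succ)⁻¹ ∈ hψ.ker := by
    rw [hψ.mem_ker, hψ, hψ.map_inv, hψ.map_pow, hψ.map_pow, habs]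
    ring
  have hcP : c ∈ P := by simpa using hc 1
  refine hP.mem_of_pow_mem (n := i.natAbs) ?_
  have := mul_pow_mem_of_mem hP hcP (hc ⟨_, hker⟩) b
  convert this using 1
  change _ = g ^ i.natAbs * (c ^ b.succ)⁻¹ * c * c ^ b
  rw [Nat.succ_eq_add_one, pow_succ']
  group

theorem isCoherent_of_forall_mul_mem (hP : IsPositiveCone P) (hψ : IsAdditive ψ)
    (hr : IsAdditive.IsRankOne ψ) {c : G} (hc0 : ψ c ≠ 0) (hc : ∀ n : hψ.ker, n * c ∈ P) :
    IsCoherent P ψ := by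
  rcases lt_or_gt_of_ne hc0 with h | h
  · refine .inr fun x hx => hP.mem_of_mul_pos hψ hr hc ?_
    rw [hψ.map_inv]
    exact mul_pos_of_neg_of_neg (by linarith) h
  · exact .inl fun x hx => hP.mem_of_mul_pos hψ hr hc (mul_pos hx h)

/-- An additive function with a fixed sign in every left order is an eigenvector of every
automorphism. -/
theorem exists_map_eq_mul (hP : IsPositiveCone P) (hψ : IsAdditive ψ)
    (hr : IsAdditive.IsRankOne ψ) (hco : ∀ Q, IsPositiveCone Q → IsCoherent Q ψ) (α : MulAut G) :
    ∃ l : ℝ, l ≠ 0 ∧ ∀ x, ψ (α x) = l * ψ x := by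
  obtain ⟨⟨x₀, hx₀⟩, hr⟩ := hr
  have hα : IsAdditive fun x => ψ (α x) := fun x y => by
    change ψ (α (x * y)) = _
    rw [map_mul, hψ]
  obtain ⟨δ, hδ, hδP⟩ : ∃ δ : ℝ, δ ≠ 0 ∧ ∀ u ∈ P, 0 ≤ δ * ψ u := by
    rcases hco P hP with h | h
    · refine ⟨1, one_ne_zero, fun u hu => ?_⟩
      by_contra! h'
      exact hP.inv_notMem hu (h _ (by rw [hψ.map_inv]; linarith))
    · refine ⟨-1, by norm_num, fun u hu => ?_⟩
      by_contra! h'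
      exact hP.inv_notMem hu (h _ (by linarith))
  obtain ⟨σ, hσ, hσα⟩ : ∃ σ : ℝ, σ ≠ 0 ∧ ∀ u, 0 < ψ u → 0 ≤ σ * ψ (α u) := by
    rcases hco _ (hP.comap (f := α.toMonoidHom) α.injective) with h | h
    · exact ⟨δ, hδ, fun u hu => hδP _ (h u hu)⟩
    · refine ⟨-δ, neg_ne_zero.2 hδ, fun u hu => ?_⟩
      have := hδP _ (h u hu)
      change 0 ≤ δ * ψ (α u⁻¹) at this
      rw [hα.map_inv] at this
      linarith
  have hker : ∀ x, ψ x = 0 → ψ (α x) = 0 := by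
    intro x hx
    obtain ⟨y, hy⟩ : ∃ y, 0 < ψ y := by
      rcases lt_or_gt_of_ne hx₀ with h | h
      · exact ⟨x₀⁻¹, by rw [hψ.map_inv]; linarith⟩
      · exact ⟨x₀, h⟩
    by_contra h
    have hb : σ * ψ (α x) ≠ 0 := mul_ne_zero hσ h
    obtain ⟨m, hm⟩ : ∃ m : ℤ, σ * ψ (α y) + m * (σ * ψ (α x)) < 0 := by
      obtain ⟨k, hk⟩ := exists_nat_gt (σ * ψ (α y) / |σ * ψ (α x)|)
      rw [div_lt_iff₀ (abs_pos.2 hb)] at hk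
      rcases lt_or_gt_of_ne hb with h' | h'
      · rw [abs_of_neg h'] at hk
        exact ⟨k, by push_cast; linarith⟩
      · rw [abs_of_pos h'] at hk
        exact ⟨-k, by push_cast; linarith⟩
    have := hσα (y * x ^ m) (by rw [hψ, hψ.map_zpow, hx, mul_zero, add_zero]; exact hy)
    rw [map_mul, hψ, hα.map_zpow] at this
    linarith
  have hl : ∀ x, ψ (α x) = ψ (α x₀) / ψ x₀ * ψ x := by
    intro x
    obtain ⟨i, j, hi, hij⟩ := hr x x₀ hx₀
    have h1 := hker (x ^ i * x₀ ^ (-j)) (by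
      rw [hψ, hψ.map_zpow, hψ.map_zpow]
      push_cast
      linarith)
    rw [map_mul, hψ, hα.map_zpow, hα.map_zpow] at h1
    push_cast at h1
    have hi' : (i : ℝ) ≠ 0 := Int.cast_ne_zero.2 hi
    refine mul_left_cancel₀ hi' ?_
    calc (i : ℝ) * ψ (α x) = j * ψ (α x₀) := by linarith
      _ = ψ (α x₀) / ψ x₀ * (j * ψ x₀) := by field_simp
      _ = _ := by rw [← hij]; ring
  refine ⟨_, fun h0 => hx₀ ?_, hl⟩
  have := hl (α.symm x₀)
  rwa [h0, zero_mul, MulEquiv.apply_symm_apply] at this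

theorem coe_mul_mem_of_neg (hP : IsPositiveCone P) {N : Subgroup G} [N.Normal] {φ : N → ℝ}
    (hφ : IsAdditive φ) (hpos : ∀ n, 0 < φ n → (n : G) ∈ P) {m : N} (hm : φ m ≠ 0) {c : G}
    (hc : c ∈ P) {l : ℝ} (hl : l < 0) (hconj : ∀ n, φ (MulAut.conjNormal c n) = l * φ n) (n : N) :
    n * c ∈ P := by
  wlog hm0 : 0 < φ m generalizing m
  · exact this (m := m⁻¹) (by rwa [hφ.map_inv, neg_ne_zero]) (by
      rw [hφ.map_inv]
      rcases lt_or_gt_of_ne hm with h | h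
      · linarith
      · exact absurd h hm0)
  obtain ⟨k, hk⟩ := exists_nat_gt (-φ n / (-l * φ m))
  have hlm : 0 < -l * φ m := mul_pos (by linarith) hm0
  rw [div_lt_iff₀ hlm] at hk
  have h1 : c * (m ^ k : N) ∈ P := by
    simpa using mul_pow_mem_of_mem hP (hpos m hm0) hc k
  have h2 : ((n * (MulAut.conjNormal c (m ^ k))⁻¹ : N) : G) ∈ P := by
    refine hpos _ ?_
    rw [hφ, hφ.map_inv, hconj, hφ.map_pow]
    linarith
  have := hP.mul_mem h2 h1
  convert this using 1
  simp only [Subgroup.coe_mul, Subgroup.coe_inv, MulAut.conjNormal_apply]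
  group

theorem finite_of_isCoherent (hψ : IsAdditive ψ) (hfin : {Q : Set hψ.ker | IsPositiveCone Q}.Finite)
    (hco : ∀ Q, IsPositiveCone Q → IsCoherent Q ψ) : {Q : Set G | IsPositiveCone Q}.Finite := by
  let F : Set G → Set hψ.ker × Prop := fun Q => (hψ.ker.subtype ⁻¹' Q, ∀ x, 0 < ψ x → x ∈ Q)
  refine Set.Finite.of_injOn (f := F) (t := {Q | IsPositiveCone Q} ×ˢ Set.univ)
    (fun Q hQ => ⟨hQ.comap hψ.ker.subtype_injective, trivial⟩) ?_ (hfin.prod Set.finite_univ)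
  intro Q hQ R hR h
  obtain ⟨h1, h2⟩ := Prod.ext_iff.1 h
  refine hQ.eq_of_subset hR fun x hx => ?_
  rcases lt_trichotomy (ψ x) 0 with h | h | h
  · have hx' : 0 < ψ x⁻¹ := by
      rw [hψ.map_inv]
      linarith
    have hn : ¬ ∀ x, 0 < ψ x → x ∈ R := fun h' =>
      hQ.inv_notMem hx ((iff_of_eq h2).2 h' _ hx')
    simpa using ((hco R hR).resolve_left hn) _ hx'
  · exact (Set.ext_iff.1 h1 ⟨x, h⟩).1 hx
  · exact (iff_of_eq h2).1 ((hco Q hQ).resolve_right fun h' => hQ.inv_notMem hx (h' x h)) x h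

end Coherent

universe u

/-- If there are countably many left orders, one of which is recurrent, then there are finitely
many, and they all agree up to sign outside a convex subgroup. -/
theorem finite_of_isRecurrent {G : Type u} [Group G] {P : Set G} (hP : IsPositiveCone P)
    (hr : IsRecurrent P) (hc : {Q : Set G | IsPositiveCone Q}.Countable) :
    {Q : Set G | IsPositiveCone Q}.Finite ∧ (Subsingleton G ∨ ∃ ψ : G → ℝ,
      IsAdditive ψ ∧ IsAdditive.IsRankOne ψ ∧ ∀ Q, IsPositiveCone Q → IsCoherent Q ψ) := by
  induction h : (Set.range (convexHull P)).ncard using Nat.strong_induction_on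
    generalizing G with
  | _ d ih =>
  subst h
  rcases subsingleton_or_nontrivial G with hG | hG
  · exact ⟨Set.toFinite _, .inl hG⟩
  have hfin := hP.finite_range_convexHull hc
  obtain ⟨ψ, hψ, hψP⟩ := exists_isAdditive hP hr hfin
  have h0 : ∃ x, 0 < ψ x := by
    obtain ⟨z, hz⟩ := exists_isCofinal hP hr hfin
    exact ⟨z, (hψP z).2 ((isCofinal_iff hP hr).1 hz)⟩
  obtain ⟨c₀, hc₀⟩ := h0
  have hr1 := hP.isRankOne hc hψ ⟨c₀, hc₀.ne'⟩
  have hN : ∀ x y : G, ⁅x, y⁆ ∈ hψ.ker := fun x y => hψ.map_commutatorElement x y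
  have hconv : IsConvex P hψ.ker := by
    intro x y hx hxy hy
    have h1 : ∀ g ∈ P, 0 ≤ ψ g := fun g hg => by
      by_contra! hlt
      exact hP.inv_notMem hg ((hψP g⁻¹).1 (by rw [hψ.map_inv]; linarith)).1
    have h2 := h1 _ hxy
    rw [hψ, hψ.map_inv, hψ.mem_ker.1 hy] at h2
    exact hψ.mem_ker.2 (by linarith [h1 x hx])
  have htop : hψ.ker ≠ ⊤ := fun h =>
    hc₀.ne' (hψ.mem_ker.1 (h ▸ Subgroup.mem_top c₀))
  have hPN := hP.comap hψ.ker.subtype_injective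
  have hrN : IsRecurrent (hψ.ker.subtype ⁻¹' P) := fun g => by
    obtain ⟨k, hk, hx⟩ := hr g
    exact ⟨k, hk, fun x => hx x⟩
  have hlt : (Set.range (convexHull (hψ.ker.subtype ⁻¹' P))).ncard <
      (Set.range (convexHull P)).ncard := by
    rw [← Set.ncard_image_of_injective _ (Subgroup.map_injective hψ.ker.subtype_injective)]
    exact Set.ncard_lt_ncard (image_range_convexHull_ssubset hconv htop) hfin
  obtain ⟨hfinN, hdich⟩ := ih _ hlt hPN hrN (countable_ker hψ hc) rfl
  suffices hco : ∀ Q, IsPositiveCone Q → IsCoherent Q ψ from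
    ⟨finite_of_isCoherent hψ hfinN hco, .inr ⟨ψ, hψ, hr1, hco⟩⟩
  rcases hdich with hsub | ⟨φ, hφ, hφ1, hφco⟩
  · intro Q hQ
    have key : ∀ c ∈ Q, ψ c ≠ 0 → IsCoherent Q ψ := fun c hc h0 =>
      hQ.isCoherent_of_forall_mul_mem hψ hr1 h0 fun n => by
        rwa [Subsingleton.elim n 1, Subgroup.coe_one, one_mul]
    rcases hQ.2.1 c₀ with h | h | rfl
    · exact key _ h hc₀.ne'
    · exact key _ h (by rw [hψ.map_inv]; exact neg_ne_zero.2 hc₀.ne')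
    · exact absurd hψ.map_one hc₀.ne'
  · choose l hl0 hl using fun g : G => exists_map_eq_mul hPN hφ hφ1 hφco (MulAut.conjNormal g)
    obtain ⟨n₀, hn₀⟩ := hφ1.1
    obtain ⟨c, hc'⟩ : ∃ c, l c < 0 := by
      by_contra! hpos
      have hpos' : ∀ g, 0 < l g := fun g => lt_of_le_of_ne (hpos g) (hl0 g).symm
      by_cases hone : ∀ g, l g = 1
      · exact not_countable_of_invariant hP hψ hr1 hφ (fun g n => by rw [hl, hone, one_mul]) hn₀ hc
      · push Not at hone
        obtain ⟨t, ht⟩ := hone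
        exact not_countable_of_scaling hP hN hφ hpos' hl hn₀ ht hc
    have hψc : ψ c ≠ 0 := by
      intro h0
      have h1 := hl c n₀
      have h2 : MulAut.conjNormal c n₀ = ⟨c, h0⟩ * n₀ * (⟨c, h0⟩ : hψ.ker)⁻¹ :=
        Subtype.ext (MulAut.conjNormal_apply _ _)
      rw [h2, hφ.map_conj] at h1
      have h3 : (1 - l c) * φ n₀ = 0 := by linarith
      rcases mul_eq_zero.1 h3 with h | h
      · linarith
      · exact hn₀ h
    have hlinv : l c⁻¹ < 0 := by
      have h1 := hl c⁻¹ (MulAut.conjNormal c n₀)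
      rw [hl c, ← MulAut.mul_apply, ← map_mul, inv_mul_cancel, map_one, MulAut.one_apply,
        ← mul_assoc] at h1
      have h2 : l c⁻¹ * l c = 1 := (mul_right_cancel₀ hn₀ (by rwa [one_mul])).symm
      by_contra! h3
      linarith [mul_nonpos_of_nonneg_of_nonpos h3 hc'.le]
    intro Q hQ
    have key : ∀ c ∈ Q, ψ c ≠ 0 → l c < 0 → IsCoherent Q ψ := fun c hcQ h0 hlc => by
      refine hQ.isCoherent_of_forall_mul_mem hψ hr1 h0 fun n => ?_
      rcases hφco _ (hQ.comap hψ.ker.subtype_injective) with h | h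
      · exact hQ.coe_mul_mem_of_neg hφ h hn₀ hcQ hlc (hl c) n
      · refine hQ.coe_mul_mem_of_neg (φ := fun n => -φ n) (fun x y => ?_) (fun n hn => ?_)
          (neg_ne_zero.2 hn₀) hcQ hlc (fun n => ?_) n
        · change -φ (x * y) = _
          rw [hφ]
          ring
        · simpa using h n⁻¹ (by rwa [hφ.map_inv])
        · rw [hl c]
          ring
    rcases hQ.2.1 c with h | h | rfl
    · exact key _ h hψc hc'
    · exact key _ h (by rw [hψ.map_inv]; exact neg_ne_zero.2 hψc) hlinv
    · exact absurd hψ.map_one hψc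

end IsPositiveCone

/-- A group acting by homeomorphisms on a countable compact space has a finite orbit. -/
theorem exists_finite_orbit {G X : Type*} [Group G] [TopologicalSpace X] [CompactSpace X]
    [T2Space X] [MulAction G X] [ContinuousConstSMul G X] {S : Set X} (hS : IsClosed S)
    (hc : S.Countable) (hne : S.Nonempty) (hinv : ∀ g : G, ∀ x ∈ S, g • x ∈ S) :
    ∃ x ∈ S, (MulAction.orbit G x).Finite := by
  let A : Set (Set X) := {M | IsClosed M ∧ M.Nonempty ∧ ∀ g : G, ∀ x ∈ M, g • x ∈ M}
  obtain ⟨M, hMS, hM⟩ := zorn_superset_nonempty A (fun c hcA hchain hcne => by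
    refine ⟨⋂₀ c, ⟨isClosed_sInter fun s hs => (hcA hs).1, ?_, fun g x hx s hs =>
      (hcA hs).2.2 g x (hx s hs)⟩, fun s hs => Set.sInter_subset_of_mem hs⟩
    have : Nonempty c := hcne.to_subtype
    refine IsCompact.nonempty_sInter_of_directed_nonempty_isCompact_isClosed
      (fun s hs t ht => ?_) (fun s hs => (hcA hs).2.1) (fun s hs => (hcA hs).1.isCompact)
      fun s hs => (hcA hs).1
    rcases hchain.total hs ht with h | h
    · exact ⟨s, hs, subset_rfl, h⟩
    · exact ⟨t, ht, h, subset_rfl⟩) S ⟨hS, hne, hinv⟩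
  obtain ⟨hMcl, hMne, hMinv⟩ := hM.prop
  have : Nonempty M := hMne.to_subtype
  have : Countable M := (hc.mono hMS).to_subtype
  have : CompactSpace M := isCompact_iff_compactSpace.1 hMcl.isCompact
  obtain ⟨x, hx⟩ := nonempty_interior_of_iUnion_of_closed (f := fun x : M => ({x} : Set M))
    (fun _ => isClosed_singleton) (Set.iUnion_of_singleton M)
  have hxo : IsOpen ({x} : Set M) := by
    rw [← interior_eq_iff_isOpen]
    exact (Set.Nonempty.subset_singleton_iff hx).1 interior_subset
  obtain ⟨U, hU, hUx⟩ := isOpen_induced_iff.1 hxo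
  have hUM : ∀ y ∈ M, y ∈ U ↔ y = x := fun y hy => by
    have := Set.ext_iff.1 hUx ⟨y, hy⟩
    simpa [Subtype.ext_iff] using this
  refine ⟨x, hMS x.2, ?_⟩
  have hV : ∀ g : G, IsOpen ((fun y => g • y) ⁻¹' U) := fun g =>
    hU.preimage (continuous_const_smul g)
  have hcover : M ⊆ ⋃ g : G, (fun y => g • y) ⁻¹' U := by
    by_contra hcon
    have hK : M \ (⋃ g : G, (fun y => g • y) ⁻¹' U) ∈ A := by
      refine ⟨hMcl.sdiff (isOpen_iUnion hV), Set.sdiff_nonempty.2 hcon, fun g y hy => ?_⟩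
      refine ⟨hMinv g y hy.1, fun hy' => hy.2 ?_⟩
      obtain ⟨h, hh⟩ := Set.mem_iUnion.1 hy'
      exact Set.mem_iUnion.2 ⟨h * g, by simpa [mul_smul] using hh⟩
    have hxK := hM.le_of_le hK Set.sdiff_subset x.2
    refine hxK.2 (Set.mem_iUnion.2 ⟨1, ?_⟩)
    simpa using (hUM x x.2).2 rfl
  obtain ⟨t, ht⟩ := hMcl.isCompact.elim_finite_subcover _ hV hcover
  refine (t.finite_toSet.image fun g => g⁻¹ • (x : X)).subset ?_
  rintro _ ⟨h, rfl⟩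
  obtain ⟨g, hg, hgU⟩ := Set.mem_iUnion₂.1 (ht (hMinv h x x.2))
  refine ⟨g, hg, ?_⟩
  change g⁻¹ • (x : X) = h • (x : X)
  rw [inv_smul_eq_iff]
  exact ((hUM _ (hMinv g _ (hMinv h x x.2))).1 hgU).symm

namespace IsPositiveCone

section Recurrence

variable {G : Type*} [Group G]

theorem isClosed_setOf_isPositiveCone :
    IsClosed {f : G → Bool | IsPositiveCone {x | f x = true}} := by
  have hx : ∀ (x : G) (b : Bool), IsClosed {f : G → Bool | f x = b} := fun x b =>
    isClosed_eq (continuous_apply x) continuous_const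
  have heq : {f : G → Bool | IsPositiveCone {x | f x = true}} =
      (⋂ p, ⋂ q, {f | f p = false} ∪ ({f | f q = false} ∪ {f | f (p * q) = true})) ∩
      ((⋂ g, {f | f g = true} ∪ ({f | f g⁻¹ = true} ∪ {_f | g = 1})) ∩
      ((⋂ g, {f | f g = false} ∪ {f | f g⁻¹ = false}) ∩ {f | f 1 = false})) := by
    ext f
    simp only [IsPositiveCone, Set.mem_ofPred_eq, Set.mem_inter_iff, Set.mem_iInter,
      Set.mem_union, imp_iff_not_or, Bool.not_eq_true]
    grind
  rw [heq]
  refine (isClosed_iInter fun p => isClosed_iInter fun q => ?_).inter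
    ((isClosed_iInter fun g => ?_).inter ((isClosed_iInter fun g => ?_).inter (hx _ _)))
  · exact (hx _ _).union ((hx _ _).union (hx _ _))
  · exact (hx _ _).union ((hx _ _).union isClosed_const)
  · exact (hx _ _).union (hx _ _)

theorem exists_isRecurrent (hc : {P : Set G | IsPositiveCone P}.Countable)
    (hne : {P : Set G | IsPositiveCone P}.Nonempty) :
    ∃ P : Set G, IsPositiveCone P ∧ IsRecurrent P := by
  classical
  let _ : MulAction (ConjAct G) (G → Bool) := arrowAction
  have hsmul : ∀ (g : ConjAct G) (f : G → Bool) x, (g • f) x = f (g⁻¹ • x) := fun _ _ _ => rfl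
  have : ContinuousConstSMul (ConjAct G) (G → Bool) :=
    ⟨fun g => continuous_pi fun x => continuous_apply (g⁻¹ • x)⟩
  obtain ⟨f, hf, hfin⟩ := exists_finite_orbit (G := ConjAct G) isClosed_setOf_isPositiveCone
    (Set.MapsTo.countable_of_injOn (f := fun f : G → Bool => {x | f x = true})
      (fun f hf => hf) (fun f _ g _ h => funext fun x => Bool.eq_iff_iff.2 (Set.ext_iff.1 h x)) hc)
    (by
      obtain ⟨P, hP⟩ := hne
      exact ⟨fun x => decide (x ∈ P), by simpa using hP⟩)
    (fun g f hf => hf.comap (f := (MulDistribMulAction.toMulEquiv G g⁻¹).toMonoidHom)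
      (MulDistribMulAction.toMulEquiv G g⁻¹).injective)
  refine ⟨_, hf, fun g => ?_⟩
  have hidx : (MulAction.stabilizer (ConjAct G) f).index ≠ 0 := by
    rw [MulAction.index_stabilizer]
    exact ((Set.ncard_pos hfin).2 (MulAction.nonempty_orbit f)).ne'
  obtain ⟨k, hk, -, hmem⟩ := Subgroup.exists_pow_mem_of_index_ne_zero hidx
    (ConjAct.toConjAct g)
  refine ⟨k, hk.ne', fun x => ?_⟩
  have h := congrFun (MulAction.mem_stabilizer_iff.1 (inv_mem hmem)) x
  rw [hsmul, inv_inv, ConjAct.smul_def] at h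
  change f (g ^ k * x * (g ^ k)⁻¹) = f x at h
  change f _ = true ↔ f x = true
  rw [h]

end Recurrence

end IsPositiveCone

/-- Linnell. For any group `G`, the set of positive cones of left
orders on `G` is either finite or uncountable; it is never countably infinite. -/
theorem linnell_space_of_left_orders_finite_or_uncountable
    (G : Type*) [Group G] :
    {P : Set G | IsPositiveCone P}.Finite ∨
      ¬ {P : Set G | IsPositiveCone P}.Countable := by
  rw [or_iff_not_imp_right, not_not]
  intro hc
  rcases Set.eq_empty_or_nonempty {P : Set G | IsPositiveCone P} with h | h
  · rw [h]
    exact Set.finite_empty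
  · obtain ⟨P, hP, hr⟩ := IsPositiveCone.exists_isRecurrent hc h
    exact (hP.finite_of_isRecurrent hr hc).1
end
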